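/- (Coifman–McIntosh–Meyer type commutator estimate, Lebesgue form) Let s ∈ (0,1], p, q₁, q₂ ∈ (1,∞) with 1/q₁ + 1/q₂ = 1/p, and σ ∈ [s,1). There is a constant C such that for all f, g ∈ C_c^∞(ℝ^n), ‖(−Δ)^{s/2}(g f) − g (−Δ)^{s/2} f‖_{L^p(ℝ^n)} ≤ C ‖(−Δ)^{σ/2} g‖_{L^{q₁}(ℝ^n)} ‖I^{σ−s} f‖_{L^{q₂}(ℝ^n)}. -/

import Mathlib

open MeasureTheory Real NNReal ENNReal Topology Filter

noncomputable section

/-- Euclidean space `ℝⁿ`. -/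
abbrev En (n : ℕ) : Type := EuclideanSpace ℝ (Fin n)

/-- The fractional Laplacian `(−Δ)^a` (for `0 < a < 1`) on `ℝⁿ`, defined by the singular
integral `(−Δ)^a f (x) = C_{n,a} ∫ (f x − f y) / ‖x − y‖^(n+2a) dy` with
`C_{n,a} = Γ((n+2a)/2) / (2^(−2a) π^(n/2) |Γ(−a)|)`. -/
def fracLapN {n : ℕ} (a : ℝ) (f : En n → ℝ) : En n → ℝ := fun x =>
  (Real.Gamma (((n : ℝ) + 2 * a) / 2) /
      ((2 : ℝ) ^ (-(2 * a)) * Real.pi ^ ((n : ℝ) / 2) * |Real.Gamma (-a)|)) *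
    ∫ y : En n, (‖x - y‖ ^ (-((n : ℝ) + 2 * a))) * (f x - f y)

/-- The Riesz potential `I^a` (for `0 < a < n`) on `ℝⁿ`:
`I^a f (x) = (1 / C(a)) ∫ f y / ‖x − y‖^{n−a} dy`,
`C(a) = π^{n/2} 2^a Γ(a/2) / Γ((n−a)/2)`. -/
def rieszPotN {n : ℕ} (a : ℝ) (f : En n → ℝ) : En n → ℝ := fun x =>
  (Real.Gamma (((n : ℝ) - a) / 2) /
      (Real.pi ^ ((n : ℝ) / 2) * (2 : ℝ) ^ a * Real.Gamma (a / 2))) *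
    ∫ y : En n, (‖x - y‖ ^ (a - (n : ℝ))) * f y

/-- The Riesz potential `I^a`, with `I^0` the identity operator. -/
def rieszPotI {n : ℕ} (a : ℝ) (f : En n → ℝ) : En n → ℝ :=
  if a = 0 then f else rieszPotN a f

/-! ## Heat kernel -/

/-- Heat kernel (normalised so that `hk t` is a probability density with width `√t`). -/
def hk {n : ℕ} (t : ℝ) (z : En n) : ℝ := t ^ (-(n : ℝ) / 2) * Real.exp (-(π / t) * ‖z‖ ^ 2)

lemma hk_pos {n : ℕ} {t : ℝ} (ht : 0 < t) (z : En n) : 0 < hk t z := by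
  unfold hk; positivity

lemma hk_nonneg {n : ℕ} {t : ℝ} (ht : 0 < t) (z : En n) : 0 ≤ hk t z := (hk_pos ht z).le

lemma hk_neg {n : ℕ} (t : ℝ) (z : En n) : hk t (-z) = hk t z := by
  unfold hk; rw [norm_neg]

lemma hk_sub_comm {n : ℕ} (t : ℝ) (x y : En n) : hk t (x - y) = hk t (y - x) := by
  rw [← hk_neg, neg_sub]

lemma measurable_hk_uncurry {n : ℕ} : Measurable (fun q : ℝ × En n => hk q.1 q.2) := by
  unfold hk
  fun_prop

@[fun_prop]
lemma measurable_hk_comp {n : ℕ} {α : Type*} [MeasurableSpace α] {a : α → ℝ} {b : α → En n}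
    (ha : Measurable a) (hb : Measurable b) : Measurable (fun q => hk (a q) (b q)) :=
  measurable_hk_uncurry.comp (ha.prodMk hb)

lemma continuous_hk {n : ℕ} (t : ℝ) : Continuous (fun z : En n => hk t z) := by
  unfold hk; fun_prop

lemma integral_hk {n : ℕ} {t : ℝ} (ht : 0 < t) : ∫ z : En n, hk t z = 1 := by
  unfold hk
  rw [integral_const_mul, GaussianFourier.integral_rexp_neg_mul_sq_norm (by positivity)]
  have : π / (π / t) = t := by field_simp
  rw [this, finrank_euclideanSpace, Fintype.card_fin, ← Real.rpow_add ht]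
  simp [neg_div]

lemma integrable_hk {n : ℕ} {t : ℝ} (ht : 0 < t) : Integrable (fun z : En n => hk t z) := by
  by_contra h
  have := integral_undef h
  rw [integral_hk ht] at this
  exact one_ne_zero this

lemma integral_hk_sub {n : ℕ} {t : ℝ} (ht : 0 < t) (x : En n) : ∫ y : En n, hk t (x - y) = 1 := by
  rw [integral_sub_left_eq_self (fun z => hk t z) volume x, integral_hk ht]

lemma integrable_hk_sub {n : ℕ} {t : ℝ} (ht : 0 < t) (x : En n) :
    Integrable (fun y : En n => hk t (x - y)) := (integrable_hk ht).comp_sub_left x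

lemma integrable_hk_sub' {n : ℕ} {t : ℝ} (ht : 0 < t) (x : En n) :
    Integrable (fun y : En n => hk t (y - x)) := (integrable_hk ht).comp_sub_right x

lemma lintegral_hk_sub {n : ℕ} {t : ℝ} (ht : 0 < t) (x : En n) :
    ∫⁻ y : En n, ENNReal.ofReal (hk t (x - y)) = 1 := by
  rw [← ofReal_integral_eq_lintegral_ofReal (integrable_hk_sub ht x)
    (Filter.Eventually.of_forall fun y => hk_nonneg ht _), integral_hk_sub ht]
  simp

/-- comparison of kernels at different times -/
lemma hk_le_hk {n : ℕ} {t t' : ℝ} (ht : 0 < t) (htt : t ≤ t') (z : En n) :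
    hk t z ≤ (t' / t) ^ ((n : ℝ) / 2) * hk t' z := by
  have ht' : 0 < t' := ht.trans_le htt
  unfold hk
  have h1 : (t' / t) ^ ((n : ℝ) / 2) * (t' ^ (-(n : ℝ) / 2) * Real.exp (-(π / t') * ‖z‖ ^ 2))
      = t ^ (-(n : ℝ) / 2) * Real.exp (-(π / t') * ‖z‖ ^ 2) := by
    rw [Real.div_rpow ht'.le ht.le, neg_div, Real.rpow_neg ht'.le, Real.rpow_neg ht.le]
    have := (Real.rpow_pos_of_pos ht' ((n : ℝ) / 2)).ne'
    have := (Real.rpow_pos_of_pos ht ((n : ℝ) / 2)).ne'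
    field_simp
  rw [h1]
  gcongr

/-- multiplying by a small exponential is a change of time -/
lemma hk_mul_exp {n : ℕ} {t c : ℝ} (ht : 0 < t) (hc : c < 1) (z : En n) :
    hk t z * Real.exp (π * c / t * ‖z‖ ^ 2) =
      (1 - c) ^ (-(n : ℝ) / 2) * hk (t / (1 - c)) z := by
  have h1 : 0 < 1 - c := by linarith
  unfold hk
  rw [mul_assoc, ← Real.exp_add, Real.div_rpow ht.le h1.le]
  have := (Real.rpow_pos_of_pos h1 (-(n : ℝ) / 2)).ne'
  have e : -(π / t) * ‖z‖ ^ 2 + π * c / t * ‖z‖ ^ 2 = -(π / (t / (1 - c))) * ‖z‖ ^ 2 := by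
    field_simp
    ring
  rw [e]
  field_simp

/-- Semigroup property of kernels. -/
lemma hk_conv {n : ℕ} {s t : ℝ} (hs : 0 < s) (ht : 0 < t) (x z : En n) :
    ∫ y : En n, hk s (x - y) * hk t (y - z) = hk (s + t) (x - z) := by
  have hst : 0 < s + t := by linarith
  set w := x - z with hw
  have e1 : ∀ y : En n, hk s (x - y) * hk t (y - z) =
      hk (s + t) w * hk (s * t / (s + t)) (y - (z + (t / (s + t)) • w)) := by
    intro y
    have hx : x - y = w - (y - z) := by rw [hw]; abel
    set u := y - z with hu
    have hy : y - (z + (t / (s + t)) • w) = u - (t / (s + t)) • w := by rw [hu]; abel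
    rw [hx, hy]
    unfold hk
    have n1 : ‖w - u‖ ^ 2 = ‖w‖ ^ 2 - 2 * inner ℝ w u + ‖u‖ ^ 2 := norm_sub_sq_real w u
    have n2 : ‖u - (t / (s + t)) • w‖ ^ 2 =
        ‖u‖ ^ 2 - 2 * (t / (s + t)) * inner ℝ w u + (t / (s + t)) ^ 2 * ‖w‖ ^ 2 := by
      rw [norm_sub_sq_real, inner_smul_right, norm_smul, real_inner_comm, mul_pow,
        Real.norm_eq_abs, sq_abs]
      ring
    rw [mul_mul_mul_comm, mul_mul_mul_comm ((s + t) ^ _), ← Real.exp_add, ← Real.exp_add,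
      ← Real.mul_rpow hs.le ht.le, ← Real.mul_rpow hst.le (by positivity)]
    congr 2
    · field_simp
    · rw [n1, n2]
      field_simp
      ring
  simp_rw [e1]
  rw [integral_const_mul,
    integral_sub_right_eq_self (fun y => hk (s * t / (s + t)) y), integral_hk (by positivity), mul_one]

/-- basic scalar bound -/
lemma abs_exp_neg_sq_sub (a b : ℝ) (ha : 0 ≤ a) (hb : 0 ≤ b) :
    |Real.exp (-a ^ 2) - Real.exp (-b ^ 2)| ≤
      2 * |a - b| * (Real.exp (-a ^ 2 / 2) + Real.exp (-b ^ 2 / 2)) := by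
  wlog hab : a ≤ b generalizing a b
  · have := this b a hb ha (le_of_not_ge hab)
    rw [abs_sub_comm, abs_sub_comm a b, add_comm]
    exact this
  have h1 : Real.exp (-b ^ 2) ≤ Real.exp (-a ^ 2) := by
    apply Real.exp_le_exp.2; nlinarith
  rw [abs_of_nonneg (by linarith), abs_of_nonpos (by linarith)]
  -- exp(-a²) - exp(-b²) ≤ exp(-a²) (b² - a²)
  have h2 : Real.exp (-b ^ 2) ≥ Real.exp (-a ^ 2) * (1 - (b ^ 2 - a ^ 2)) := by
    have : Real.exp (-b ^ 2) = Real.exp (-a ^ 2) * Real.exp (-(b ^ 2 - a ^ 2)) := by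
      rw [← Real.exp_add]; ring_nf
    rw [this]
    have := Real.add_one_le_exp (-(b ^ 2 - a ^ 2))
    have := Real.exp_pos (-a ^ 2)
    nlinarith
  have ea : Real.exp (-a ^ 2) = Real.exp (-a ^ 2 / 2) * Real.exp (-a ^ 2 / 2) := by
    rw [← Real.exp_add]; ring_nf
  have hp := Real.exp_pos (-a ^ 2 / 2)
  have hpb := Real.exp_pos (-b ^ 2 / 2)
  have hle1 : Real.exp (-a ^ 2 / 2) ≤ 1 := by
    apply Real.exp_le_one_iff.2; nlinarith
  -- a exp(-a²/2) ≤ 1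
  have haexp : a * Real.exp (-a ^ 2 / 2) ≤ 1 := by
    have h3 : a ≤ Real.exp (a ^ 2 / 2) := by
      have := Real.add_one_le_exp (a ^ 2 / 2)
      nlinarith [sq_nonneg (a - 1)]
    have h4 : Real.exp (a ^ 2 / 2) * Real.exp (-a ^ 2 / 2) = 1 := by
      rw [← Real.exp_add]; ring_nf; simp
    nlinarith
  rcases le_total (b - a) 2 with hba | hba
  · -- difference of squares
    have h5 : Real.exp (-a ^ 2) - Real.exp (-b ^ 2) ≤
        (b - a) * (Real.exp (-a ^ 2 / 2) * (Real.exp (-a ^ 2 / 2) * (2 * a + (b - a)))) := by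
      rw [ea] at h2 ⊢; nlinarith
    have h6 : Real.exp (-a ^ 2 / 2) * (2 * a + (b - a)) ≤ 4 := by nlinarith
    have h7 : (b - a) * (Real.exp (-a ^ 2 / 2) * (Real.exp (-a ^ 2 / 2) * (2 * a + (b - a)))) ≤
        (b - a) * (Real.exp (-a ^ 2 / 2) * 4) := by
      gcongr
    -- use a sharper split
    have h8 : Real.exp (-a ^ 2 / 2) * (2 * a + (b - a)) ≤ 2 + 2 * 1 := by nlinarith
    by_cases hb2 : Real.exp (-a ^ 2 / 2) * (2 * a + (b - a)) ≤ 2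
    · have : (b - a) * (Real.exp (-a ^ 2 / 2) * (Real.exp (-a ^ 2 / 2) * (2 * a + (b - a)))) ≤
        (b - a) * (Real.exp (-a ^ 2 / 2) * 2) := by
        gcongr
      have h9 : 0 ≤ (b - a) * Real.exp (-b ^ 2 / 2) := mul_nonneg (by linarith) hpb.le
      linarith
    · -- in this case use the trivial bound
      push Not at hb2
      have : 1 ≤ 2 * (b - a) ∨ 2 * (b - a) < 1 := le_or_gt _ _
      rcases this with h | h
      · have : Real.exp (-a ^ 2) ≤ Real.exp (-a ^ 2 / 2) := by rw [ea]; nlinarith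
        have hpb' := Real.exp_pos (-b ^ 2)
        nlinarith
      · exfalso
        have h10 : a * Real.exp (-a ^ 2 / 2) ≤ 3 / 4 := by
          have h3 : a * (4 / 3) ≤ Real.exp (a ^ 2 / 2) := by
            have := Real.add_one_le_exp (a ^ 2 / 2)
            nlinarith [sq_nonneg (a - 4 / 3)]
          have h4 : Real.exp (a ^ 2 / 2) * Real.exp (-a ^ 2 / 2) = 1 := by
            rw [← Real.exp_add]; ring_nf; simp
          nlinarith
        nlinarith
  · have : Real.exp (-a ^ 2) ≤ Real.exp (-a ^ 2 / 2) := by rw [ea]; nlinarith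
    have hpb' := Real.exp_pos (-b ^ 2)
    nlinarith

lemma hk_diff {n : ℕ} {t : ℝ} (ht : 0 < t) (z z' : En n) :
    |hk t z - hk t z'| ≤ (4 * 2 ^ ((n : ℝ) / 2)) * (‖z - z'‖ / √t) * (hk (2 * t) z + hk (2 * t) z') := by
  have e : ∀ z : En n, hk t z = t ^ (-(n : ℝ) / 2) * Real.exp (-(√(π / t) * ‖z‖) ^ 2) := by
    intro z
    unfold hk
    rw [mul_pow, Real.sq_sqrt (by positivity)]; ring_nf
  have e2 : ∀ z : En n, 2 ^ ((n : ℝ) / 2) * hk (2 * t) z =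
      t ^ (-(n : ℝ) / 2) * Real.exp (-(√(π / t) * ‖z‖) ^ 2 / 2) := by
    intro z
    unfold hk
    rw [mul_pow, Real.sq_sqrt (by positivity), Real.mul_rpow (by norm_num) ht.le, ← mul_assoc,
      ← mul_assoc, ← Real.rpow_add (by norm_num)]
    have : (n : ℝ) / 2 + -(n : ℝ) / 2 = 0 := by ring
    rw [this, Real.rpow_zero, one_mul]
    congr 2
    field_simp
  have h := abs_exp_neg_sq_sub (√(π / t) * ‖z‖) (√(π / t) * ‖z'‖) (by positivity) (by positivity)
  have hT : 0 < t ^ (-(n : ℝ) / 2) := by positivity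
  have hpi : √(π / t) ≤ 2 / √t := by
    rw [Real.sqrt_div Real.pi_pos.le]
    gcongr
    rw [Real.sqrt_le_left (by norm_num)]
    nlinarith [Real.pi_lt_four]
  have hd : |√(π / t) * ‖z‖ - √(π / t) * ‖z'‖| ≤ 2 / √t * ‖z - z'‖ := by
    rw [← mul_sub, abs_mul, abs_of_nonneg (by positivity)]
    gcongr
    exact abs_norm_sub_norm_le z z'
  rw [e z, e z', ← mul_sub, abs_mul, abs_of_pos hT]
  calc _ ≤ t ^ (-(n : ℝ) / 2) * (2 * (2 / √t * ‖z - z'‖) *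
        (Real.exp (-(√(π / t) * ‖z‖) ^ 2 / 2) + Real.exp (-(√(π / t) * ‖z'‖) ^ 2 / 2))) := by
        gcongr
        exact h.trans (by gcongr)
    _ = 4 * (‖z - z'‖ / √t) * (2 ^ ((n : ℝ) / 2) * hk (2 * t) z + 2 ^ ((n : ℝ) / 2) * hk (2 * t) z') := by
        rw [e2, e2]; ring
    _ = _ := by ring

lemma sq_mul_hk_le {n : ℕ} {t : ℝ} (ht : 0 < t) (z : En n) :
    ‖z‖ ^ 2 * hk t z ≤ (2 * 2 ^ ((n : ℝ) / 2)) * t * hk (2 * t) z := by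
  have h := hk_mul_exp ht (show (1 / 2 : ℝ) < 1 by norm_num) z
  have h2 : ‖z‖ ^ 2 ≤ 2 * t * Real.exp (π * (1 / 2) / t * ‖z‖ ^ 2) := by
    have := Real.add_one_le_exp (π * (1 / 2) / t * ‖z‖ ^ 2)
    have h3 : ‖z‖ ^ 2 = 2 * t * (1 * (1 / 2) / t * ‖z‖ ^ 2) := by field_simp
    have h4 : (1 * (1 / 2) / t * ‖z‖ ^ 2) ≤ (π * (1 / 2) / t * ‖z‖ ^ 2) := by
      gcongr
      linarith [Real.pi_gt_three]
    calc ‖z‖ ^ 2 = 2 * t * (1 * (1 / 2) / t * ‖z‖ ^ 2) := h3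
      _ ≤ 2 * t * Real.exp (π * (1 / 2) / t * ‖z‖ ^ 2) := by
        gcongr; linarith
  have e : (1 - 1 / 2 : ℝ) ^ (-(n : ℝ) / 2) = 2 ^ ((n : ℝ) / 2) := by
    rw [neg_div, Real.rpow_neg (by norm_num), ← Real.inv_rpow (by norm_num)]; norm_num
  have e' : t / (1 - 1 / 2) = 2 * t := by ring
  rw [e, e'] at h
  calc _ ≤ 2 * t * Real.exp (π * (1 / 2) / t * ‖z‖ ^ 2) * hk t z := by
        gcongr; exact hk_nonneg ht z
    _ = 2 * t * (hk t z * Real.exp (π * (1 / 2) / t * ‖z‖ ^ 2)) := by ring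
    _ = _ := by rw [h]; ring

lemma norm_mul_hk_le {n : ℕ} {t : ℝ} (ht : 0 < t) (z : En n) :
    ‖z‖ * hk t z ≤ (3 * 2 ^ ((n : ℝ) / 2)) * √t * hk (2 * t) z := by
  have h1 := sq_mul_hk_le ht z
  have h2 := hk_le_hk ht (show t ≤ 2 * t by linarith) z
  have e : 2 * t / t = 2 := by field_simp
  rw [e] at h2
  have hst : 0 < √t := Real.sqrt_pos.2 ht
  have hh := hk_nonneg ht z
  have h3 : ‖z‖ * √t ≤ ‖z‖ ^ 2 + t := by
    nlinarith [Real.sq_sqrt ht.le, sq_nonneg (‖z‖ - √t), norm_nonneg z]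
  have h4 : ‖z‖ * √t * hk t z ≤ (3 * 2 ^ ((n : ℝ) / 2)) * t * hk (2 * t) z := by
    calc _ ≤ (‖z‖ ^ 2 + t) * hk t z := by gcongr
      _ = ‖z‖ ^ 2 * hk t z + t * hk t z := by ring
      _ ≤ (2 * 2 ^ ((n : ℝ) / 2)) * t * hk (2 * t) z + t * (2 ^ ((n : ℝ) / 2) * hk (2 * t) z) := by
          gcongr
      _ = _ := by ring
  have h5 : (‖z‖ * hk t z) * √t ≤ ((3 * 2 ^ ((n : ℝ) / 2)) * √t * hk (2 * t) z) * √t := by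
    calc _ = ‖z‖ * √t * hk t z := by ring
      _ ≤ _ := h4
      _ = (3 * 2 ^ ((n : ℝ) / 2)) * (√t * √t) * hk (2 * t) z := by rw [Real.mul_self_sqrt ht.le]
      _ = _ := by ring
  exact le_of_mul_le_mul_right h5 hst

/-! ## Heat semigroup -/

/-- Heat kernel as a Markov kernel in `(t, x)`; it is the identity for `t ≤ 0`. -/
def HK (n : ℕ) : ProbabilityTheory.Kernel (ℝ × En n) (En n) :=
  open Classical in
  ProbabilityTheory.Kernel.piecewise (s := {q : ℝ × En n | 0 < q.1})
    (measurableSet_lt measurable_const measurable_fst)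
    (ProbabilityTheory.Kernel.withDensity (ProbabilityTheory.Kernel.const _ volume)
      (fun q y => ENNReal.ofReal (hk q.1 (q.2 - y))))
    (ProbabilityTheory.Kernel.deterministic Prod.snd measurable_snd)

def hm {n : ℕ} (t : ℝ) (x : En n) : Measure (En n) := HK n (t, x)

lemma measurable_hk_dens {n : ℕ} : Measurable (Function.uncurry
    (fun (q : ℝ × En n) (y : En n) => ENNReal.ofReal (hk q.1 (q.2 - y)))) := by
  unfold Function.uncurry
  fun_prop

lemma hm_of_pos {n : ℕ} {t : ℝ} (ht : 0 < t) (x : En n) :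
    hm t x = volume.withDensity (fun y => ENNReal.ofReal (hk t (x - y))) := by
  classical
  unfold hm HK
  rw [ProbabilityTheory.Kernel.piecewise_apply]
  simp only [Set.mem_ofPred_eq, ht, if_true]
  rw [ProbabilityTheory.Kernel.withDensity_apply _ measurable_hk_dens]
  simp

lemma hm_zero {n : ℕ} (x : En n) : hm 0 x = Measure.dirac x := by
  classical
  unfold hm HK
  rw [ProbabilityTheory.Kernel.piecewise_apply]
  simp [ProbabilityTheory.Kernel.deterministic_apply]

lemma hm_nonpos {n : ℕ} {t : ℝ} (ht : t ≤ 0) (x : En n) : hm t x = Measure.dirac x := by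
  classical
  unfold hm HK
  rw [ProbabilityTheory.Kernel.piecewise_apply]
  simp [ProbabilityTheory.Kernel.deterministic_apply, ht.not_gt]

instance hm_prob {n : ℕ} (t : ℝ) (x : En n) : IsProbabilityMeasure (hm t x) := by
  rcases le_or_gt t 0 with h | h
  · rw [hm_nonpos h]; infer_instance
  · rw [hm_of_pos h]
    constructor
    rw [withDensity_apply _ MeasurableSet.univ, Measure.restrict_univ, lintegral_hk_sub h]

instance HK_markov {n : ℕ} : ProbabilityTheory.IsMarkovKernel (HK n) :=
  ⟨fun q => hm_prob q.1 q.2⟩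

lemma measurable_lintegral_hm {n : ℕ} {α : Type*} [MeasurableSpace α] {T : α → ℝ} {X : α → En n}
    (hT : Measurable T) (hX : Measurable X) {φ : α → En n → ℝ≥0∞}
    (hφ : Measurable (Function.uncurry φ)) :
    Measurable fun a => ∫⁻ y, φ a y ∂(hm (T a) (X a)) :=
  Measurable.lintegral_kernel_prod_right
    (κ := (HK n).comap (fun a => (T a, X a)) (hT.prodMk hX)) hφ

lemma measurable_integral_hm {n : ℕ} {α : Type*} [MeasurableSpace α] {T : α → ℝ} {X : α → En n}
    (hT : Measurable T) (hX : Measurable X) {φ : α → En n → ℝ}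
    (hφ : Measurable (Function.uncurry φ)) :
    Measurable fun a => ∫ y, φ a y ∂(hm (T a) (X a)) :=
  (StronglyMeasurable.integral_kernel_prod_right
    (κ := (HK n).comap (fun a => (T a, X a)) (hT.prodMk hX)) hφ.stronglyMeasurable).measurable

/-- heat semigroup on real functions -/
def P {n : ℕ} (t : ℝ) (f : En n → ℝ) (x : En n) : ℝ := ∫ y, f y ∂(hm t x)

/-- heat semigroup on nonnegative functions -/
def PE {n : ℕ} (t : ℝ) (f : En n → ℝ≥0∞) (x : En n) : ℝ≥0∞ := ∫⁻ y, f y ∂(hm t x)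

@[fun_prop]
lemma measurable_P {n : ℕ} {α : Type*} [MeasurableSpace α] {T : α → ℝ} {X : α → En n}
    {f : En n → ℝ} (hf : Measurable f) (hT : Measurable T) (hX : Measurable X) :
    Measurable fun a => P (T a) f (X a) :=
  measurable_integral_hm hT hX (φ := fun _ y => f y) (by unfold Function.uncurry; fun_prop)

@[fun_prop]
lemma measurable_PE {n : ℕ} {α : Type*} [MeasurableSpace α] {T : α → ℝ} {X : α → En n}
    {f : En n → ℝ≥0∞} (hf : Measurable f) (hT : Measurable T) (hX : Measurable X) :
    Measurable fun a => PE (T a) f (X a) :=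
  measurable_lintegral_hm hT hX (φ := fun _ y => f y) (by unfold Function.uncurry; fun_prop)

lemma P_zero {n : ℕ} {f : En n → ℝ} (x : En n) : P 0 f x = f x := by
  unfold P; rw [hm_zero, integral_dirac]

lemma PE_zero {n : ℕ} {f : En n → ℝ≥0∞} (hf : Measurable f) (x : En n) : PE 0 f x = f x := by
  unfold PE; rw [hm_zero, lintegral_dirac' _ hf]

lemma lintegral_hm {n : ℕ} {t : ℝ} (ht : 0 < t) (x : En n) {φ : En n → ℝ≥0∞} (hφ : Measurable φ) :
    ∫⁻ y, φ y ∂(hm t x) = ∫⁻ y, ENNReal.ofReal (hk t (x - y)) * φ y := by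
  rw [hm_of_pos ht, lintegral_withDensity_eq_lintegral_mul _ (by fun_prop) hφ]
  rfl

lemma integral_hm {n : ℕ} {t : ℝ} (ht : 0 < t) (x : En n) (φ : En n → ℝ) :
    ∫ y, φ y ∂(hm t x) = ∫ y, hk t (x - y) * φ y := by
  rw [hm_of_pos ht, integral_withDensity_eq_integral_toReal_smul (by fun_prop)
    (Eventually.of_forall fun _ => ENNReal.ofReal_lt_top)]
  congr 1; ext y
  rw [ENNReal.toReal_ofReal (hk_nonneg ht _), smul_eq_mul]

/-- bounded measurable -/
def BM {n : ℕ} (f : En n → ℝ) : Prop := Measurable f ∧ ∃ M, ∀ x, |f x| ≤ M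

lemma BM.meas {n : ℕ} {f : En n → ℝ} (hf : BM f) : Measurable f := hf.1

lemma BM.bd {n : ℕ} {f : En n → ℝ} (hf : BM f) : ∃ M, 0 ≤ M ∧ ∀ x, |f x| ≤ M := by
  obtain ⟨M, hM⟩ := hf.2
  exact ⟨M, (abs_nonneg _).trans (hM 0), hM⟩

lemma BM.int {n : ℕ} {f : En n → ℝ} (hf : BM f) (μ : Measure (En n)) [IsFiniteMeasure μ] :
    Integrable f μ := by
  obtain ⟨M, hM⟩ := hf.2
  exact Integrable.of_bound hf.1.aestronglyMeasurable M (Eventually.of_forall hM)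

lemma BM.const {n : ℕ} (c : ℝ) : BM (fun _ : En n => c) := ⟨measurable_const, |c|, fun _ => le_rfl⟩

lemma BM.add {n : ℕ} {f g : En n → ℝ} (hf : BM f) (hg : BM g) : BM (fun x => f x + g x) := by
  obtain ⟨M, hM⟩ := hf.2
  obtain ⟨N, hN⟩ := hg.2
  exact ⟨hf.1.add hg.1, M + N, fun x => (abs_add_le _ _).trans (add_le_add (hM x) (hN x))⟩

lemma BM.sub {n : ℕ} {f g : En n → ℝ} (hf : BM f) (hg : BM g) : BM (fun x => f x - g x) := by
  obtain ⟨M, hM⟩ := hf.2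
  obtain ⟨N, hN⟩ := hg.2
  exact ⟨hf.1.sub hg.1, M + N, fun x => (abs_sub _ _).trans (add_le_add (hM x) (hN x))⟩

lemma BM.mul {n : ℕ} {f g : En n → ℝ} (hf : BM f) (hg : BM g) : BM (fun x => f x * g x) := by
  obtain ⟨M, hM0, hM⟩ := hf.bd
  obtain ⟨N, hN⟩ := hg.2
  refine ⟨hf.1.mul hg.1, M * N, fun x => ?_⟩
  rw [abs_mul]
  exact mul_le_mul (hM x) (hN x) (abs_nonneg _) hM0

lemma BM.abs {n : ℕ} {f : En n → ℝ} (hf : BM f) : BM (fun x => |f x|) := by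
  obtain ⟨M, hM⟩ := hf.2
  exact ⟨by have := hf.1; fun_prop, M, fun x => by rw [abs_abs]; exact hM x⟩

lemma P_abs_le {n : ℕ} {f : En n → ℝ} {M : ℝ} (hM : ∀ x, |f x| ≤ M) (t : ℝ) (x : En n) :
    |P t f x| ≤ M := by
  unfold P
  have := norm_integral_le_of_norm_le_const (μ := hm t x) (f := f) (C := M) (Eventually.of_forall hM)
  simpa using this

lemma BM.P {n : ℕ} {f : En n → ℝ} (hf : BM f) (t : ℝ) : BM (P t f) := by
  obtain ⟨M, hM⟩ := hf.2
  have := hf.1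
  exact ⟨by fun_prop, M, P_abs_le hM t⟩

lemma hk_conv_lintegral {n : ℕ} {s t : ℝ} (hs : 0 < s) (ht : 0 < t) (x z : En n) :
    ∫⁻ y : En n, ENNReal.ofReal (hk s (x - y)) * ENNReal.ofReal (hk t (y - z)) =
      ENNReal.ofReal (hk (s + t) (x - z)) := by
  have hst : 0 < s + t := by linarith
  rw [← hk_conv hs ht, ofReal_integral_eq_lintegral_ofReal]
  · congr 1; ext y; rw [ENNReal.ofReal_mul (hk_nonneg hs _)]
  · by_contra h
    have := integral_undef h
    rw [hk_conv hs ht] at this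
    exact (hk_pos hst _).ne' this
  · exact Eventually.of_forall fun y => mul_nonneg (hk_nonneg hs _) (hk_nonneg ht _)

lemma PE_semigroup {n : ℕ} {s t : ℝ} (hs : 0 ≤ s) (ht : 0 ≤ t) {φ : En n → ℝ≥0∞}
    (hφ : Measurable φ) (x : En n) : PE s (PE t φ) x = PE (s + t) φ x := by
  rcases hs.eq_or_lt with rfl | hs
  · rw [PE_zero (by fun_prop), zero_add]
  rcases ht.eq_or_lt with rfl | ht
  · rw [add_zero]; congr 1; ext y; rw [PE_zero hφ]
  have hst : 0 < s + t := by linarith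
  have hm' : Measurable (PE t φ) := by fun_prop
  have e1 : PE s (PE t φ) x = ∫⁻ y, ENNReal.ofReal (hk s (x - y)) * PE t φ y := lintegral_hm hs x hm'
  have e2 : PE (s + t) φ x = ∫⁻ y, ENNReal.ofReal (hk (s + t) (x - y)) * φ y := lintegral_hm hst x hφ
  rw [e1, e2]
  unfold PE
  simp_rw [lintegral_hm ht _ hφ]
  have : ∀ y : En n, ENNReal.ofReal (hk s (x - y)) * ∫⁻ z, ENNReal.ofReal (hk t (y - z)) * φ z =
      ∫⁻ z, ENNReal.ofReal (hk s (x - y)) * (ENNReal.ofReal (hk t (y - z)) * φ z) := by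
    intro y
    rw [lintegral_const_mul _ (by fun_prop)]
  simp_rw [this]
  rw [lintegral_lintegral_swap (by fun_prop)]
  congr 1; ext z
  rw [← hk_conv_lintegral hs ht, ← lintegral_mul_const _ (by fun_prop)]
  congr 1; ext y; ring

lemma hm_bind {n : ℕ} {s t : ℝ} (hs : 0 ≤ s) (ht : 0 ≤ t) (x : En n) :
    (ProbabilityTheory.Kernel.comp ((HK n).comap (fun y => (t, y)) (by fun_prop))
      ((HK n).comap (fun y => (s, y)) (by fun_prop))) x = hm (s + t) x := by
  apply Measure.ext_of_lintegral
  intro φ hφ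
  rw [ProbabilityTheory.Kernel.lintegral_comp _ _ _ hφ]
  exact PE_semigroup hs ht hφ x

lemma P_semigroup {n : ℕ} {s t : ℝ} (hs : 0 ≤ s) (ht : 0 ≤ t) {f : En n → ℝ} (hf : BM f)
    (x : En n) : P s (P t f) x = P (s + t) f x := by
  have := ProbabilityTheory.Kernel.integral_comp
    (η := (HK n).comap (fun y => (t, y)) (by fun_prop))
    (κ := (HK n).comap (fun y => (s, y)) (by fun_prop)) (a := x) (f := f)
    (by rw [hm_bind hs ht]; exact hf.int _)
  rw [hm_bind hs ht] at this
  exact this.symm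

lemma PE_mono {n : ℕ} {t : ℝ} {φ ψ : En n → ℝ≥0∞} (h : ∀ y, φ y ≤ ψ y) (x : En n) :
    PE t φ x ≤ PE t ψ x := lintegral_mono h

lemma PE_const {n : ℕ} (t : ℝ) (c : ℝ≥0∞) (x : En n) : PE t (fun _ => c) x = c := by
  unfold PE; simp

/-- self-adjointness -/
lemma PE_symm {n : ℕ} (t : ℝ) {φ ψ : En n → ℝ≥0∞} (hφ : Measurable φ) (hψ : Measurable ψ) :
    ∫⁻ x, φ x * PE t ψ x = ∫⁻ x, PE t φ x * ψ x := by
  rcases le_or_gt t 0 with h | ht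
  · unfold PE
    simp_rw [hm_nonpos h, lintegral_dirac' _ hφ, lintegral_dirac' _ hψ]
  unfold PE
  simp_rw [lintegral_hm ht _ hφ, lintegral_hm ht _ hψ]
  have h1 : ∀ x, φ x * ∫⁻ y, ENNReal.ofReal (hk t (x - y)) * ψ y =
      ∫⁻ y, φ x * (ENNReal.ofReal (hk t (x - y)) * ψ y) := fun x => by
    rw [lintegral_const_mul _ (by fun_prop)]
  have h2 : ∀ x, (∫⁻ y, ENNReal.ofReal (hk t (x - y)) * φ y) * ψ x =
      ∫⁻ y, (ENNReal.ofReal (hk t (x - y)) * φ y) * ψ x := fun x => by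
    rw [lintegral_mul_const _ (by fun_prop)]
  simp_rw [h1, h2]
  rw [lintegral_lintegral_swap (by fun_prop)]
  congr 1; ext x; congr 1; ext y
  rw [hk_sub_comm]; ring

lemma lintegral_PE {n : ℕ} (t : ℝ) {φ : En n → ℝ≥0∞} (hφ : Measurable φ) :
    ∫⁻ x, PE t φ x = ∫⁻ x, φ x := by
  have := PE_symm t hφ (measurable_const (a := (1 : ℝ≥0∞)))
  simp_rw [PE_const] at this
  simpa using this.symm

lemma P_add {n : ℕ} {f g : En n → ℝ} (hf : BM f) (hg : BM g) (t : ℝ) (x : En n) :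
    P t (fun y => f y + g y) x = P t f x + P t g x := integral_add (hf.int _) (hg.int _)

lemma P_sub {n : ℕ} {f g : En n → ℝ} (hf : BM f) (hg : BM g) (t : ℝ) (x : En n) :
    P t (fun y => f y - g y) x = P t f x - P t g x := integral_sub (hf.int _) (hg.int _)

lemma P_const {n : ℕ} (c t : ℝ) (x : En n) : P t (fun _ => c) x = c := by
  unfold P; simp

lemma P_mono {n : ℕ} {f g : En n → ℝ} (hf : BM f) (hg : BM g) (h : ∀ y, f y ≤ g y) (t : ℝ)
    (x : En n) : P t f x ≤ P t g x := integral_mono (hf.int _) (hg.int _) h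

lemma PE_ofReal {n : ℕ} {f : En n → ℝ} (hf : BM f) (h0 : ∀ y, 0 ≤ f y) (t : ℝ) (x : En n) :
    PE t (fun y => ENNReal.ofReal (f y)) x = ENNReal.ofReal (P t f x) := by
  unfold P PE
  rw [ofReal_integral_eq_lintegral_ofReal (hf.int _) (Eventually.of_forall h0)]

lemma enorm_P_le {n : ℕ} (f : En n → ℝ) (t : ℝ) (x : En n) :
    ‖P t f x‖ₑ ≤ PE t (fun y => ‖f y‖ₑ) x := enorm_integral_le_lintegral_enorm _

lemma PE_le_PE {n : ℕ} {t t' : ℝ} (ht : 0 < t) (htt : t ≤ t') {φ : En n → ℝ≥0∞} (hφ : Measurable φ)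
    (x : En n) : PE t φ x ≤ ENNReal.ofReal ((t' / t) ^ ((n : ℝ) / 2)) * PE t' φ x := by
  have ht' : 0 < t' := ht.trans_le htt
  unfold PE
  rw [lintegral_hm ht _ hφ, lintegral_hm ht' _ hφ, ← lintegral_const_mul _ (by fun_prop)]
  apply lintegral_mono
  intro y
  dsimp only
  rw [← mul_assoc, ← ENNReal.ofReal_mul (by positivity)]
  gcongr
  exact hk_le_hk ht htt _

/-- kernel form of Harnack -/
lemma hk_harnack {n : ℕ} {t θ : ℝ} (ht : 0 < t) (hθ : 0 < θ) (x y z : En n) :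
    hk t (y - z) ≤ (1 + θ) ^ ((n : ℝ) / 2) * Real.exp (π / (θ * t) * ‖x - y‖ ^ 2) *
      hk ((1 + θ) * t) (x - z) := by
  have hn : ‖x - z‖ ^ 2 ≤ (1 + θ) * ‖y - z‖ ^ 2 + (1 + 1 / θ) * ‖x - y‖ ^ 2 := by
    have h1 : ‖x - z‖ ≤ ‖x - y‖ + ‖y - z‖ := norm_sub_le_norm_sub_add_norm_sub x y z
    have h2 : ‖x - z‖ ^ 2 ≤ (‖x - y‖ + ‖y - z‖) ^ 2 := by gcongr
    have h3 : (1 + θ) * ‖y - z‖ ^ 2 + (1 + 1 / θ) * ‖x - y‖ ^ 2 - (‖x - y‖ + ‖y - z‖) ^ 2 =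
      (θ * ‖y - z‖ - ‖x - y‖) ^ 2 / θ := by field_simp; ring
    have h4 : 0 ≤ (θ * ‖y - z‖ - ‖x - y‖) ^ 2 / θ := by positivity
    linarith
  unfold hk
  rw [Real.mul_rpow (by positivity) ht.le, neg_div, Real.rpow_neg (by positivity : 0 ≤ 1 + θ)]
  have h1 : 0 < (1 + θ) ^ ((n : ℝ) / 2) := by positivity
  have e : ∀ A B C D : ℝ, (1 + θ) ^ ((n : ℝ) / 2) * A * (((1 + θ) ^ ((n : ℝ) / 2))⁻¹ * B * D) =
      B * (A * D) := by
    intros; field_simp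
  rw [e _ _ 0, ← Real.exp_add]
  gcongr
  have : π / (θ * t) * ‖x - y‖ ^ 2 + -(π / ((1 + θ) * t)) * ‖x - z‖ ^ 2 - (-(π / t) * ‖y - z‖ ^ 2) =
     π / ((1 + θ) * t) * ((1 + θ) * ‖y - z‖ ^ 2 + (1 + 1 / θ) * ‖x - y‖ ^ 2 - ‖x - z‖ ^ 2) := by
    field_simp
    ring
  have : 0 ≤ π / ((1 + θ) * t) * ((1 + θ) * ‖y - z‖ ^ 2 + (1 + 1 / θ) * ‖x - y‖ ^ 2 - ‖x - z‖ ^ 2) :=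
    mul_nonneg (by positivity) (by linarith)
  linarith

lemma PE_harnack {n : ℕ} {t θ : ℝ} (ht : 0 < t) (hθ : 0 < θ) {φ : En n → ℝ≥0∞} (hφ : Measurable φ)
    (x y : En n) : PE t φ y ≤ ENNReal.ofReal ((1 + θ) ^ ((n : ℝ) / 2)) *
      ENNReal.ofReal (Real.exp (π / (θ * t) * ‖x - y‖ ^ 2)) * PE ((1 + θ) * t) φ x := by
  unfold PE
  rw [lintegral_hm ht _ hφ, lintegral_hm (by positivity) _ hφ, ← lintegral_const_mul _ (by fun_prop)]
  apply lintegral_mono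
  intro z
  dsimp only
  rw [← mul_assoc, ← ENNReal.ofReal_mul (by positivity), ← ENNReal.ofReal_mul (by positivity)]
  gcongr
  exact hk_harnack ht hθ x y z

/-! ## Maximal function -/

/-- dyadic heat maximal function -/
def Mx {n : ℕ} (φ : En n → ℝ≥0∞) (x : En n) : ℝ≥0∞ := ⨆ k : ℤ, PE ((2 : ℝ) ^ k) φ x

@[fun_prop]
lemma measurable_Mx {n : ℕ} {φ : En n → ℝ≥0∞} (hφ : Measurable φ) : Measurable (Mx φ) :=
  Measurable.iSup fun k => by fun_prop

lemma Mx_mono {n : ℕ} {φ ψ : En n → ℝ≥0∞} (h : ∀ y, φ y ≤ ψ y) (x : En n) : Mx φ x ≤ Mx ψ x :=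
  iSup_mono fun _ => PE_mono h x

lemma Mx_le_const {n : ℕ} {φ : En n → ℝ≥0∞} {K : ℝ≥0∞} (h : ∀ y, φ y ≤ K) (x : En n) :
    Mx φ x ≤ K :=
  iSup_le fun _ => (PE_mono h x).trans (PE_const _ _ _).le

lemma PE_le_Mx {n : ℕ} {φ : En n → ℝ≥0∞} (hφ : Measurable φ) {t : ℝ} (ht : 0 < t) (x : En n) :
    PE t φ x ≤ ENNReal.ofReal (2 ^ ((n : ℝ) / 2)) * Mx φ x := by
  obtain ⟨k, hk1, hk2⟩ := exists_mem_Ioc_zpow ht (show (1 : ℝ) < 2 by norm_num)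
  refine (PE_le_PE ht hk2 hφ x).trans ?_
  gcongr
  · rw [div_le_iff₀ ht, zpow_add_one₀ (by norm_num)]; linarith
  · exact le_iSup (fun k : ℤ => PE ((2 : ℝ) ^ k) φ x) (k + 1)

lemma hk_superlevel {n : ℕ} {t l : ℝ} (ht : 0 < t) (hl : 0 < l) (x : En n) :
    {y : En n | l < hk t (x - y)} = ∅ ∨ ∃ r, 0 < r ∧ {y : En n | l < hk t (x - y)} = Metric.ball x r := by
  set a := t / π * Real.log (t ^ (-(n : ℝ) / 2) / l) with ha
  have key : ∀ y : En n, l < hk t (x - y) ↔ ‖x - y‖ ^ 2 < a := by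
    intro y
    unfold hk
    have hT : 0 < t ^ (-(n : ℝ) / 2) := by positivity
    rw [← div_lt_iff₀' hT, ← Real.log_lt_iff_lt_exp (by positivity), ha,
      show l / t ^ (-(n : ℝ) / 2) = (t ^ (-(n : ℝ) / 2) / l)⁻¹ by rw [inv_div], Real.log_inv]
    have hpi := Real.pi_pos
    rw [div_mul_eq_mul_div, lt_div_iff₀ hpi, neg_mul, neg_lt_neg_iff, div_mul_eq_mul_div,
      div_lt_iff₀ ht]
    constructor <;> intro h <;> linarith
  rcases le_or_gt a 0 with h | h
  · left
    ext y
    simp only [Set.mem_setOf_eq, Set.mem_empty_iff_false, iff_false, key]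
    have : 0 ≤ ‖x - y‖ ^ 2 := by positivity
    linarith
  · right
    refine ⟨√a, Real.sqrt_pos.2 h, ?_⟩
    ext y
    simp only [Set.mem_setOf_eq, key, Metric.mem_ball, dist_eq_norm]
    rw [Real.lt_sqrt (norm_nonneg _), norm_sub_rev]

lemma PE_le_of_ball {n : ℕ} {φ : En n → ℝ≥0∞} (hφ : Measurable φ) {x : En n} {A : ℝ≥0∞}
    (hA : ∀ r, 0 < r → ∫⁻ y in Metric.closedBall x r, φ y ≤ A * volume (Metric.closedBall x r))
    {t : ℝ} (ht : 0 < t) : PE t φ x ≤ A := by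
  have e1 : PE t φ x = ∫⁻ y, ENNReal.ofReal (hk t (x - y)) ∂(volume.withDensity φ) := by
    unfold PE
    rw [lintegral_hm ht x hφ, lintegral_withDensity_eq_lintegral_mul _ hφ (by fun_prop)]
    congr 1; ext y; simp [mul_comm]
  have e2 := lintegral_hk_sub ht x
  rw [lintegral_eq_lintegral_meas_lt _ (Eventually.of_forall fun y => hk_nonneg ht _)
    (by fun_prop)] at e2
  rw [e1, lintegral_eq_lintegral_meas_lt _ (Eventually.of_forall fun y => hk_nonneg ht _)
    (by fun_prop)]
  calc _ ≤ ∫⁻ l in Set.Ioi (0 : ℝ), A * volume {y : En n | l < hk t (x - y)} := by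
        apply lintegral_mono_ae
        filter_upwards [ae_restrict_mem measurableSet_Ioi] with l hl
        rcases hk_superlevel ht hl x with h | ⟨r, hr, h⟩
        · rw [h]; simp
        · rw [h, withDensity_apply _ Metric.isOpen_ball.measurableSet]
          calc _ ≤ ∫⁻ y in Metric.closedBall x r, φ y :=
                lintegral_mono_set Metric.ball_subset_closedBall
            _ ≤ _ := hA r hr
            _ = _ := by
              rw [Measure.addHaar_closedBall _ _ hr.le, Measure.addHaar_ball_of_pos _ _ hr]
    _ ≤ A * 1 := by
        rw [← e2, lintegral_const_mul]
        apply Antitone.measurable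
        intro a b hab
        apply measure_mono
        intro y hy
        exact lt_of_le_of_lt hab hy
    _ = A := mul_one A

lemma weak_type {n : ℕ} (hn : 0 < n) {φ : En n → ℝ≥0∞} (hφ : Measurable φ) {A : ℝ≥0∞}
    (hA0 : A ≠ 0) (hAt : A ≠ ⊤) :
    A * volume {x | A < Mx φ x} ≤ 4 ^ n * ∫⁻ x, φ x := by
  by_cases hI : ∫⁻ x, φ x = ⊤
  · rw [hI, ENNReal.mul_top (by positivity)]; exact le_top
  set D := {x | A < Mx φ x} with hD
  have hex : ∀ x ∈ D, ∃ r : ℝ, 0 < r ∧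
      A * volume (Metric.closedBall x r) < ∫⁻ y in Metric.closedBall x r, φ y := by
    intro x hx
    by_contra! hcon
    have : Mx φ x ≤ A := iSup_le fun k => PE_le_of_ball hφ hcon (by positivity)
    exact absurd hx (not_lt.2 this)
  choose! r hr0 hr using hex
  set v1 := volume (Metric.ball (0 : En n) 1) with hv1
  have hv0 : v1 ≠ 0 := (Metric.measure_ball_pos _ _ one_pos).ne'
  have hvt : v1 ≠ ⊤ := measure_ball_lt_top.ne
  have hfin : Module.finrank ℝ (En n) = n := by simp
  set Q := (∫⁻ x, φ x) / (A * v1) with hQ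
  have hQt : Q ≠ ⊤ := ENNReal.div_ne_top hI (mul_ne_zero hA0 hv0)
  have hR : ∀ x ∈ D, r x ≤ max 1 Q.toReal := by
    intro x hx
    rcases le_or_gt (r x) 1 with h | h
    · exact h.trans (le_max_left _ _)
    · refine le_trans ?_ (le_max_right _ _)
      have h1 : A * (ENNReal.ofReal (r x ^ n) * v1) ≤ ∫⁻ x, φ x := by
        have := (hr x hx).le.trans (setLIntegral_le_lintegral _ _)
        rwa [Measure.addHaar_closedBall _ _ (hr0 x hx).le, hfin] at this
      have h2 : ENNReal.ofReal (r x ^ n) ≤ Q := by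
        rw [hQ, ENNReal.le_div_iff_mul_le (Or.inl (mul_ne_zero hA0 hv0))
          (Or.inl (ENNReal.mul_ne_top hAt hvt))]
        refine le_trans (le_of_eq ?_) h1
        ring
      have h3 : r x ^ n ≤ Q.toReal := (ENNReal.ofReal_le_iff_le_toReal hQt).1 h2
      refine le_trans ?_ h3
      exact le_self_pow₀ h.le hn.ne'
  obtain ⟨u, huD, hdisj, hcov⟩ := Vitali.exists_disjoint_subfamily_covering_enlargement_closedBall
    D (fun x => x) r (max 1 Q.toReal) hR 4 (by norm_num)
  have hcount : u.Countable := hdisj.countable_of_nonempty_interior fun x hx =>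
    ⟨x, mem_interior_iff_mem_nhds.2 (Metric.closedBall_mem_nhds x (hr0 x (huD hx)))⟩
  have hsub : D ⊆ ⋃ b ∈ u, Metric.closedBall b (4 * r b) := by
    intro x hx
    obtain ⟨b, hb, hb'⟩ := hcov x hx
    exact Set.mem_biUnion hb (hb' (Metric.mem_closedBall_self (hr0 x hx).le))
  calc A * volume D ≤ A * ∑' b : u, volume (Metric.closedBall (b : En n) (4 * r b)) := by
        gcongr
        exact (measure_mono hsub).trans (measure_biUnion_le _ hcount _)
    _ = ∑' b : u, 4 ^ n * (A * volume (Metric.closedBall (b : En n) (r b))) := by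
        rw [← ENNReal.tsum_mul_left]
        congr 1; ext b
        have hb := hr0 b (huD b.2)
        rw [Measure.addHaar_closedBall _ _ hb.le, Measure.addHaar_closedBall _ _ (by positivity), hfin,
          mul_pow, ENNReal.ofReal_mul (by positivity)]
        have : ENNReal.ofReal (4 ^ n) = 4 ^ n := by
          rw [ENNReal.ofReal_pow (by norm_num)]; norm_num
        rw [this]; ring
    _ ≤ ∑' b : u, 4 ^ n * ∫⁻ y in Metric.closedBall (b : En n) (r b), φ y := by
        gcongr with b
        exact (hr b (huD b.2)).le
    _ = 4 ^ n * ∫⁻ y in ⋃ b ∈ u, Metric.closedBall b (r b), φ y := by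
        rw [ENNReal.tsum_mul_left,
          lintegral_biUnion hcount (fun b _ => Metric.isClosed_closedBall.measurableSet) hdisj]
    _ ≤ _ := by
        gcongr
        exact Measure.restrict_le_self

lemma lintegral_Ioo_rpow {r a : ℝ} (hr : 1 < r) (ha : 0 ≤ a) :
    ∫⁻ l in Set.Ioo 0 a, ENNReal.ofReal (l ^ (r - 2)) = ENNReal.ofReal (a ^ (r - 1) / (r - 1)) := by
  have hi : IntervalIntegrable (fun l : ℝ => l ^ (r - 2)) volume 0 a :=
    intervalIntegral.intervalIntegrable_rpow' (by linarith)
  have hv := integral_rpow (a := 0) (b := a) (r := r - 2) (Or.inl (by linarith))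
  rw [intervalIntegral.integral_of_le ha, ← setIntegral_congr_set Ioo_ae_eq_Ioc] at hv
  rw [intervalIntegrable_iff_integrableOn_Ioo_of_le ha] at hi
  rw [← ofReal_integral_eq_lintegral_ofReal hi, hv]
  · rw [show r - 2 + 1 = r - 1 by ring, Real.zero_rpow (by linarith)]; simp
  · filter_upwards [ae_restrict_mem measurableSet_Ioo] with l hl
    exact Real.rpow_nonneg hl.1.le _

lemma strong_type {n : ℕ} (hn : 0 < n) {r : ℝ} (hr : 1 < r) :
    ∃ C : ℝ≥0∞, C ≠ ⊤ ∧ ∀ φ : En n → ℝ, Measurable φ → (∀ x, 0 ≤ φ x) → (∃ K, ∀ x, φ x ≤ K) →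
      ∫⁻ x, (Mx (fun y => ENNReal.ofReal (φ y)) x) ^ r ≤ C * ∫⁻ x, ENNReal.ofReal (φ x) ^ r := by
  refine ⟨ENNReal.ofReal r * (4 ^ n * 2 * ENNReal.ofReal (2 ^ (r - 1) / (r - 1))), ?_, ?_⟩
  · refine ENNReal.mul_ne_top ENNReal.ofReal_ne_top (ENNReal.mul_ne_top ?_ ENNReal.ofReal_ne_top)
    exact ENNReal.mul_ne_top (by simp) (by simp)
  rintro φ hφ h0 ⟨K, hK⟩
  set Φ : En n → ℝ≥0∞ := fun y => ENNReal.ofReal (φ y) with hΦ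
  have hΦm : Measurable Φ := by fun_prop
  have hMt : ∀ x, Mx Φ x ≠ ⊤ := fun x => ne_top_of_le_ne_top ENNReal.ofReal_ne_top
    (Mx_le_const (K := ENNReal.ofReal K) (fun y => ENNReal.ofReal_le_ofReal (hK y)) x)
  have hMm := measurable_Mx hΦm
  have e1 : ∀ x, (Mx Φ x) ^ r = ENNReal.ofReal ((Mx Φ x).toReal ^ r) := by
    intro x
    rw [← ENNReal.ofReal_rpow_of_nonneg ENNReal.toReal_nonneg (by linarith),
      ENNReal.ofReal_toReal (hMt x)]
  simp_rw [e1]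
  rw [lintegral_rpow_eq_lintegral_meas_lt_mul _ (Eventually.of_forall fun x => ENNReal.toReal_nonneg)
    (by fun_prop) (by linarith)]
  have key : ∀ l : ℝ, 0 < l → volume {x | l < (Mx Φ x).toReal} * ENNReal.ofReal (l ^ (r - 1)) ≤
      ∫⁻ x, 4 ^ n * 2 * Φ x * (Set.Ioo 0 (2 * φ x)).indicator
        (fun l => ENNReal.ofReal (l ^ (r - 2))) l := by
    intro l hl
    set ψ : En n → ℝ≥0∞ := {y | l / 2 < φ y}.indicator Φ with hψ
    have hψm : Measurable ψ := hΦm.indicator (measurableSet_lt measurable_const hφ)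
    have hsub : {x | l < (Mx Φ x).toReal} ⊆ {x | ENNReal.ofReal (l / 2) < Mx ψ x} := by
      intro x hx
      simp only [Set.mem_setOf_eq] at hx ⊢
      by_contra! hcon
      have hle : Mx Φ x ≤ ENNReal.ofReal (l / 2) + ENNReal.ofReal (l / 2) := by
        refine iSup_le fun k => ?_
        calc PE (2 ^ k) Φ x ≤ PE (2 ^ k) (fun y => ENNReal.ofReal (l / 2) + ψ y) x := by
              apply PE_mono
              intro y
              rw [hψ]
              by_cases hy : l / 2 < φ y
              · rw [Set.indicator_of_mem (by exact hy)]; exact le_add_self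
              · rw [Set.indicator_of_notMem (by exact hy), add_zero]
                exact ENNReal.ofReal_le_ofReal (not_lt.1 hy)
          _ = ENNReal.ofReal (l / 2) + PE (2 ^ k) ψ x := by
              unfold PE
              rw [lintegral_add_left measurable_const]; simp
          _ ≤ _ := by
              gcongr
              exact (le_iSup (fun k : ℤ => PE ((2 : ℝ) ^ k) ψ x) k).trans hcon
      rw [← ENNReal.ofReal_add (by positivity) (by positivity), add_halves] at hle
      have := ENNReal.toReal_mono ENNReal.ofReal_ne_top hle
      rw [ENNReal.toReal_ofReal hl.le] at this
      linarith
    have hw := weak_type hn hψm (A := ENNReal.ofReal (l / 2)) (by simpa using hl) ENNReal.ofReal_ne_top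
    calc _ ≤ volume {x | ENNReal.ofReal (l / 2) < Mx ψ x} * ENNReal.ofReal (l ^ (r - 1)) := by
          gcongr
      _ = 2 * ENNReal.ofReal (l ^ (r - 2)) *
          (ENNReal.ofReal (l / 2) * volume {x | ENNReal.ofReal (l / 2) < Mx ψ x}) := by
          have : ENNReal.ofReal (l ^ (r - 1)) =
              2 * ENNReal.ofReal (l ^ (r - 2)) * ENNReal.ofReal (l / 2) := by
            rw [show (2 : ℝ≥0∞) = ENNReal.ofReal 2 by norm_num, ← ENNReal.ofReal_mul (by norm_num),
              ← ENNReal.ofReal_mul (by positivity)]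
            congr 1
            rw [show r - 1 = (r - 2) + 1 by ring, Real.rpow_add_one hl.ne']; ring
          rw [this]; ring
      _ ≤ 2 * ENNReal.ofReal (l ^ (r - 2)) * (4 ^ n * ∫⁻ x, ψ x) := by gcongr
      _ = ∫⁻ x, 4 ^ n * 2 * ENNReal.ofReal (l ^ (r - 2)) * ψ x := by
          rw [lintegral_const_mul _ hψm]; ring
      _ = _ := by
          congr 1; ext x
          rw [hψ]
          by_cases hy : l / 2 < φ x
          · rw [Set.indicator_of_mem (by exact hy), Set.indicator_of_mem (by constructor <;> linarith)]
            ring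
          · rw [Set.indicator_of_notMem (by exact hy), Set.indicator_of_notMem (fun h => hy (by
              have := h.2; linarith))]
            simp
  have hmeas : Measurable (Function.uncurry fun (l : ℝ) (x : En n) => 4 ^ n * 2 * Φ x *
      (Set.Ioo 0 (2 * φ x)).indicator (fun l => ENNReal.ofReal (l ^ (r - 2))) l) := by
    unfold Function.uncurry
    apply Measurable.mul (by fun_prop)
    have : (fun p : ℝ × En n => (Set.Ioo 0 (2 * φ p.2)).indicator
        (fun l => ENNReal.ofReal (l ^ (r - 2))) p.1) =
        {p : ℝ × En n | 0 < p.1 ∧ p.1 < 2 * φ p.2}.indicator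
          (fun p => ENNReal.ofReal (p.1 ^ (r - 2))) := by
      ext p; simp [Set.indicator_apply]
    rw [this]
    apply Measurable.indicator (by fun_prop)
    have h1 : MeasurableSet {p : ℝ × En n | 0 < p.1} := measurableSet_lt (by fun_prop) (by fun_prop)
    have h2 : MeasurableSet {p : ℝ × En n | p.1 < 2 * φ p.2} :=
      measurableSet_lt (by fun_prop) (by fun_prop)
    exact h1.inter h2
  calc _ ≤ ENNReal.ofReal r * ∫⁻ l in Set.Ioi (0 : ℝ), ∫⁻ x, 4 ^ n * 2 * Φ x *
        (Set.Ioo 0 (2 * φ x)).indicator (fun l => ENNReal.ofReal (l ^ (r - 2))) l := by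
        gcongr 1
        apply lintegral_mono_ae
        filter_upwards [ae_restrict_mem measurableSet_Ioi] with l hl
        exact key l hl
    _ ≤ ENNReal.ofReal r * ∫⁻ l, ∫⁻ x, 4 ^ n * 2 * Φ x *
        (Set.Ioo 0 (2 * φ x)).indicator (fun l => ENNReal.ofReal (l ^ (r - 2))) l := by
        gcongr
        exact Measure.restrict_le_self
    _ = ENNReal.ofReal r * ∫⁻ x, ∫⁻ l, 4 ^ n * 2 * Φ x *
        (Set.Ioo 0 (2 * φ x)).indicator (fun l => ENNReal.ofReal (l ^ (r - 2))) l := by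
        rw [lintegral_lintegral_swap hmeas.aemeasurable]
    _ = ENNReal.ofReal r * ∫⁻ x, 4 ^ n * 2 * ENNReal.ofReal (2 ^ (r - 1) / (r - 1)) * Φ x ^ r := by
        congr 2; ext x
        rw [lintegral_const_mul _ (Measurable.indicator (by fun_prop) measurableSet_Ioo),
          lintegral_indicator measurableSet_Ioo, lintegral_Ioo_rpow hr (by linarith [h0 x])]
        have : Φ x * ENNReal.ofReal ((2 * φ x) ^ (r - 1) / (r - 1)) =
            ENNReal.ofReal (2 ^ (r - 1) / (r - 1)) * Φ x ^ r := by
          rw [hΦ]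
          dsimp only
          have hr1 : 0 < r - 1 := by linarith
          rw [ENNReal.ofReal_rpow_of_nonneg (h0 x) (by linarith), ← ENNReal.ofReal_mul (h0 x),
            ← ENNReal.ofReal_mul (by positivity)]
          congr 1
          rw [Real.mul_rpow (by norm_num) (h0 x)]
          rcases (h0 x).eq_or_lt with h | h
          · rw [← h, Real.zero_rpow (by linarith), Real.zero_rpow (by linarith)]; simp
          · have : φ x ^ r = φ x ^ (r - 1) * φ x := by
              rw [← Real.rpow_add_one h.ne']; ring_nf
            rw [this]; ring
        rw [mul_assoc, this]; ring
    _ = _ := by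
        rw [lintegral_const_mul _ (by fun_prop)]; ring

/-! ## Energy lemma -/

lemma young_defect {b : ℝ} (hb0 : 0 ≤ b) (hb1 : b < 1) {r : ℝ} (hr : 0 < r) :
    min b (1 - b) * (1 - √r) ^ 2 ≤ 1 - b + b * r - r ^ b := by
  have hs : 0 < √r := Real.sqrt_pos.2 hr
  have hsr : √r ^ 2 = r := Real.sq_sqrt hr.le
  have hpow : ∀ c : ℝ, √r ^ c = r ^ (c / 2) := fun c => by
    rw [Real.sqrt_eq_rpow, ← Real.rpow_mul hr.le]; ring_nf
  rcases le_total b (1 / 2) with h | h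
  · rw [min_eq_left (by linarith)]
    have := Real.geom_mean_le_arith_mean2_weighted (w₁ := 1 - 2 * b) (w₂ := 2 * b) (p₁ := 1)
      (p₂ := √r) (by linarith) (by linarith) (by norm_num) hs.le (by ring)
    rw [Real.one_rpow, one_mul, hpow, mul_div_cancel_left₀ _ (by norm_num : (2 : ℝ) ≠ 0)] at this
    nlinarith
  · rw [min_eq_right (by linarith)]
    have := Real.geom_mean_le_arith_mean2_weighted (w₁ := 2 * b - 1) (w₂ := 2 * (1 - b)) (p₁ := r)
      (p₂ := √r) (by linarith) (by linarith) hr.le hs.le (by ring)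
    rw [hpow, mul_div_cancel_left₀ _ (by norm_num : (2 : ℝ) ≠ 0), ← Real.rpow_add hr,
      show 2 * b - 1 + (1 - b) = b by ring] at this
    nlinarith

lemma one_sub_rpow_sq_le {b : ℝ} (hb0 : 0 ≤ b) (hb1 : b < 1) {r : ℝ} (hr : 0 < r) :
    (1 - r ^ b) ^ 2 ≤ 4 * (1 - √r) ^ 2 * (1 + r) ^ b := by
  have hs : 0 < √r := Real.sqrt_pos.2 hr
  set x := √r with hx
  have hsr : x ^ 2 = r := Real.sq_sqrt hr.le
  have hrb : r ^ b = x ^ b * x ^ b := by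
    rw [← hsr, ← Real.mul_rpow hs.le hs.le]; ring_nf
  have hy0 : 0 < x ^ b := by positivity
  have h1r : 1 ≤ (1 + r) ^ b := Real.one_le_rpow (by linarith) hb0
  rcases le_total x 1 with h | h
  · have h1 : x ≤ x ^ b := by
      have := Real.rpow_le_rpow_of_exponent_ge hs h hb1.le
      rwa [Real.rpow_one] at this
    have h2 : x ^ b ≤ 1 := Real.rpow_le_one hs.le h hb0
    have h3 : 1 - r ^ b ≤ 2 * (1 - x) := by rw [hrb]; nlinarith
    have h4 : 0 ≤ 1 - r ^ b := by rw [hrb]; nlinarith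
    calc (1 - r ^ b) ^ 2 ≤ (2 * (1 - x)) ^ 2 := by gcongr
      _ = 4 * (1 - x) ^ 2 * 1 := by ring
      _ ≤ _ := by gcongr
  · have h1 : x ^ b ≤ x := by
      have := Real.rpow_le_rpow_of_exponent_le h hb1.le
      rwa [Real.rpow_one] at this
    have h2 : 1 ≤ x ^ b := Real.one_le_rpow h hb0
    have h3 : r ^ b - 1 ≤ 2 * (x - 1) * x ^ b := by rw [hrb]; nlinarith
    have h4 : 0 ≤ r ^ b - 1 := by rw [hrb]; nlinarith
    have h5 : r ^ b ≤ (1 + r) ^ b := by gcongr; linarith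
    calc (1 - r ^ b) ^ 2 = (r ^ b - 1) ^ 2 := by ring
      _ ≤ (2 * (x - 1) * x ^ b) ^ 2 := by gcongr
      _ = 4 * (1 - x) ^ 2 * (r ^ b) := by rw [hrb]; ring
      _ ≤ _ := by gcongr

lemma defect {b : ℝ} (hb0 : 0 ≤ b) (hb1 : b < 1) : ∃ C : ℝ, 0 < C ∧ ∀ a a0 v v0 : ℝ, 0 < v → 0 < v0 →
    (a - a0) ^ 2 * (v + v0) ^ (-b) ≤ C * (a ^ 2 * v ^ (-b) - a0 ^ 2 * v0 ^ (-b) -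
      2 * a0 * v0 ^ (-b) * (a - a0) + b * a0 ^ 2 * v0 ^ (-b) / v0 * (v - v0)) := by
  -- first the scalar bound
  obtain ⟨C, hC, hCb⟩ : ∃ C : ℝ, 0 < C ∧ ∀ r : ℝ, 0 < r →
      (1 - r ^ b) ^ 2 ≤ C * (1 - b + b * r - r ^ b) * (1 + r) ^ b := by
    rcases hb0.eq_or_lt with h | h
    · refine ⟨1, one_pos, fun r hr => ?_⟩
      rw [← h]; simp
    · have hmu : 0 < min b (1 - b) := lt_min h (by linarith)
      refine ⟨4 / min b (1 - b), by positivity, fun r hr => (one_sub_rpow_sq_le hb0 hb1 hr).trans ?_⟩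
      have := young_defect hb0 hb1 hr
      have h2 : 4 * (1 - √r) ^ 2 ≤ 4 / min b (1 - b) * (1 - b + b * r - r ^ b) := by
        rw [div_mul_eq_mul_div, le_div_iff₀ hmu]
        linarith
      exact mul_le_mul_of_nonneg_right h2 (by positivity)
  refine ⟨2 + 2 * C, by positivity, fun a a0 v v0 hv hv0 => ?_⟩
  set r := v / v0 with hr
  have hr0 : 0 < r := by positivity
  have hvr : v = v0 * r := by rw [hr]; field_simp
  set ρ := r ^ b with hρ
  have hρ0 : 0 < ρ := by positivity
  set T := v0 ^ (-b) with hT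
  have hT0 : 0 < T := by positivity
  have hvb : v ^ (-b) = T / ρ := by
    rw [hvr, Real.mul_rpow hv0.le hr0.le, Real.rpow_neg hr0.le]; rfl
  have hvv : (v + v0) ^ (-b) = T * ((1 + r) ^ b)⁻¹ := by
    rw [show v + v0 = v0 * (1 + r) by rw [hvr]; ring, Real.mul_rpow hv0.le (by positivity),
      Real.rpow_neg (by positivity : 0 ≤ 1 + r)]
  set Q := 1 - b + b * r - ρ with hQ
  have hQ0 : 0 ≤ Q := le_trans (mul_nonneg (le_min hb0 (by linarith)) (sq_nonneg _))
    (young_defect hb0 hb1 hr0)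
  have hL : a ^ 2 * v ^ (-b) - a0 ^ 2 * T - 2 * a0 * T * (a - a0) + b * a0 ^ 2 * T / v0 * (v - v0) =
      T / ρ * (a - a0 * ρ) ^ 2 + T * a0 ^ 2 * Q := by
    rw [hvb, hQ, hvr]; field_simp; ring
  rw [hL, hvv]
  have hR1 : ρ ≤ (1 + r) ^ b := by rw [hρ]; gcongr; linarith
  have hR0 : 0 < (1 + r) ^ b := by positivity
  have hd : (a - a0) ^ 2 ≤ 2 * (a - a0 * ρ) ^ 2 + 2 * (a0 ^ 2 * (1 - ρ) ^ 2) := by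
    nlinarith [sq_nonneg ((a - a0 * ρ) + a0 * (1 - ρ))]
  have h1 := hCb r hr0
  have p1 : 0 ≤ T / ρ * (a - a0 * ρ) ^ 2 := by positivity
  have p2 : 0 ≤ T * a0 ^ 2 * Q := by positivity
  have p3 : T * ((1 + r) ^ b)⁻¹ ≤ T / ρ := by rw [div_eq_mul_inv]; gcongr
  have p4 : T * ((1 + r) ^ b)⁻¹ * (1 - ρ) ^ 2 ≤ C * T * Q := by
    calc _ ≤ T * ((1 + r) ^ b)⁻¹ * (C * Q * (1 + r) ^ b) := by gcongr
      _ = _ := by field_simp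
  calc (a - a0) ^ 2 * (T * ((1 + r) ^ b)⁻¹)
      ≤ (2 * (a - a0 * ρ) ^ 2 + 2 * (a0 ^ 2 * (1 - ρ) ^ 2)) * (T * ((1 + r) ^ b)⁻¹) := by gcongr
    _ = 2 * (a - a0 * ρ) ^ 2 * (T * ((1 + r) ^ b)⁻¹) +
        2 * a0 ^ 2 * (T * ((1 + r) ^ b)⁻¹ * (1 - ρ) ^ 2) := by ring
    _ ≤ 2 * (a - a0 * ρ) ^ 2 * (T / ρ) + 2 * a0 ^ 2 * (C * T * Q) := by gcongr
    _ ≤ _ := by nlinarith [mul_nonneg hC.le p1]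

lemma BM.rpow_neg {n : ℕ} {v : En n → ℝ} (hv : Measurable v) {e b : ℝ} (he : 0 < e) (hb : 0 ≤ b)
    (h : ∀ x, e ≤ v x) : BM (fun x => v x ^ (-b)) := by
  refine ⟨by fun_prop, e ^ (-b), fun x => ?_⟩
  have : 0 < v x := he.trans_le (h x)
  rw [abs_of_nonneg (by positivity)]
  exact Real.rpow_le_rpow_of_nonpos he (h x) (by linarith)

lemma prob_defect {b : ℝ} (hb0 : 0 ≤ b) (hb1 : b < 1) : ∃ C : ℝ, 0 < C ∧
    ∀ (n : ℕ) (μ : Measure (En n)) [IsProbabilityMeasure μ] (u v : En n → ℝ) (e : ℝ), BM u → BM v →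
    0 < e → (∀ x, e ≤ v x) →
    (∫⁻ y, ENNReal.ofReal ((u y - ∫ z, u z ∂μ) ^ 2 * (v y + ∫ z, v z ∂μ) ^ (-b)) ∂μ) +
      ENNReal.ofReal C * ENNReal.ofReal ((∫ z, u z ∂μ) ^ 2 * (∫ z, v z ∂μ) ^ (-b)) ≤
      ENNReal.ofReal C * ∫⁻ y, ENNReal.ofReal (u y ^ 2 * v y ^ (-b)) ∂μ := by
  obtain ⟨C, hC, h⟩ := defect hb0 hb1
  refine ⟨C, hC, fun n μ _ u v e hu hv he hev => ?_⟩
  set u0 := ∫ z, u z ∂μ with hu0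
  set v0 := ∫ z, v z ∂μ with hv0
  have hv0e : e ≤ v0 := by
    have := integral_mono (μ := μ) (integrable_const e) (hv.int μ) hev
    simpa using this
  have hv0p : 0 < v0 := he.trans_le hv0e
  have hvp : ∀ x, 0 < v x := fun x => he.trans_le (hev x)
  have b1 : BM (fun y => (u y - u0) ^ 2 * (v y + v0) ^ (-b)) := by
    have hd := hu.sub (BM.const u0)
    have := (hd.mul hd).mul (BM.rpow_neg (v := fun y => v y + v0) (by have := hv.1; fun_prop) he hb0
      (fun x => by linarith [hev x]))
    simpa [sq] using this
  have b2 : BM (fun y => u y ^ 2 * v y ^ (-b)) := by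
    have := (hu.mul hu).mul (BM.rpow_neg hv.1 he hb0 hev)
    simpa [sq] using this
  have n1 : ∀ y, 0 ≤ (u y - u0) ^ 2 * (v y + v0) ^ (-b) := fun y => by
    have := hvp y; positivity
  have n2 : ∀ y, 0 ≤ u y ^ 2 * v y ^ (-b) := fun y => by
    have := hvp y; positivity
  rw [← ofReal_integral_eq_lintegral_ofReal (b1.int μ) (Eventually.of_forall n1),
    ← ofReal_integral_eq_lintegral_ofReal (b2.int μ) (Eventually.of_forall n2),
    ← ENNReal.ofReal_mul hC.le, ← ENNReal.ofReal_mul hC.le, ← ENNReal.ofReal_add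
      (integral_nonneg n1) (by positivity)]
  apply ENNReal.ofReal_le_ofReal
  have hI : ∫ y, (u y - u0) ^ 2 * (v y + v0) ^ (-b) ∂μ ≤ ∫ y, C * (u y ^ 2 * v y ^ (-b) - u0 ^ 2 * v0 ^ (-b) -
      2 * u0 * v0 ^ (-b) * (u y - u0) + b * u0 ^ 2 * v0 ^ (-b) / v0 * (v y - v0)) ∂μ := by
    apply integral_mono (b1.int μ)
    · exact ((((b2.int μ).sub (integrable_const _)).sub
        (((hu.int μ).sub (integrable_const _)).const_mul _)).add
        (((hv.int μ).sub (integrable_const _)).const_mul _)).const_mul _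
    · intro y; exact h _ _ _ _ (hvp y) hv0p
  have hE : ∫ y, C * (u y ^ 2 * v y ^ (-b) - u0 ^ 2 * v0 ^ (-b) -
      2 * u0 * v0 ^ (-b) * (u y - u0) + b * u0 ^ 2 * v0 ^ (-b) / v0 * (v y - v0)) ∂μ =
      C * (∫ y, u y ^ 2 * v y ^ (-b) ∂μ - u0 ^ 2 * v0 ^ (-b)) := by
    have z1 : ∫ y, (u y - u0) ∂μ = 0 := by
      rw [integral_sub (hu.int μ) (integrable_const _)]; simp [← hu0]
    have z2 : ∫ y, (v y - v0) ∂μ = 0 := by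
      rw [integral_sub (hv.int μ) (integrable_const _)]; simp [← hv0]
    have gen : ∀ c1 c2 c3 : ℝ, ∫ y, C * (u y ^ 2 * v y ^ (-b) - c1 -
        c2 * (u y - u0) + c3 * (v y - v0)) ∂μ = C * (∫ y, u y ^ 2 * v y ^ (-b) ∂μ - c1) := by
      intro c1 c2 c3
      have i1 : Integrable (fun y => c2 * (u y - u0)) μ :=
        ((hu.int μ).sub (integrable_const _)).const_mul _
      have i2 : Integrable (fun y => c3 * (v y - v0)) μ :=
        ((hv.int μ).sub (integrable_const _)).const_mul _
      have i3 : Integrable (fun y => u y ^ 2 * v y ^ (-b) - c1) μ :=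
        (b2.int μ).sub (integrable_const _)
      have i4 : Integrable (fun y => u y ^ 2 * v y ^ (-b) - c1 - c2 * (u y - u0)) μ := i3.sub i1
      rw [integral_const_mul, integral_add i4 i2, integral_sub i3 i1,
        integral_sub (b2.int μ) (integrable_const _), integral_const_mul c2, integral_const_mul c3,
        z1, z2]
      simp
    exact gen _ _ _
  rw [hE] at hI
  linarith

/-! ### the measure dt/t -/

/-- the measure `dt / t` on the half line -/
def mdt : Measure ℝ := (volume.restrict (Set.Ioi 0)).withDensity (fun t => ENNReal.ofReal t⁻¹)

instance : SigmaFinite mdt := by unfold mdt; infer_instance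

lemma lintegral_mdt {φ : ℝ → ℝ≥0∞} (hφ : Measurable φ) :
    ∫⁻ t, φ t ∂mdt = ∫⁻ t in Set.Ioi 0, ENNReal.ofReal t⁻¹ * φ t := by
  unfold mdt
  rw [lintegral_withDensity_eq_lintegral_mul _ (by fun_prop) hφ]; rfl

lemma ae_mdt_pos : ∀ᵐ t ∂mdt, 0 < t := by
  unfold mdt
  have : ∀ᵐ t ∂(volume.restrict (Set.Ioi (0 : ℝ))), 0 < t := ae_restrict_mem measurableSet_Ioi
  exact (withDensity_absolutelyContinuous _ _).ae_le this

lemma lintegral_vol_scale {φ : ℝ → ℝ≥0∞} (hφ : Measurable φ) {c : ℝ} (hc : 0 < c) :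
    ∫⁻ t in Set.Ioi 0, φ t = ENNReal.ofReal c * ∫⁻ t in Set.Ioi 0, φ (c * t) := by
  have h := Real.smul_map_volume_mul_left hc.ne'
  rw [← lintegral_indicator measurableSet_Ioi, ← lintegral_indicator measurableSet_Ioi]
  conv_lhs => rw [← h]
  rw [lintegral_smul_measure, lintegral_map (hφ.indicator measurableSet_Ioi) (by fun_prop),
    abs_of_pos hc, smul_eq_mul]
  congr 2; ext t
  simp only [Set.indicator_apply, Set.mem_Ioi, mul_pos_iff_of_pos_left hc]

lemma lintegral_mdt_scale {φ : ℝ → ℝ≥0∞} (hφ : Measurable φ) {c : ℝ} (hc : 0 < c) :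
    ∫⁻ t, φ (c * t) ∂mdt = ∫⁻ t, φ t ∂mdt := by
  rw [lintegral_mdt hφ, lintegral_mdt (by fun_prop), lintegral_vol_scale (φ := fun t => ENNReal.ofReal t⁻¹ * φ t) (by fun_prop) hc,
    ← lintegral_const_mul _ (by fun_prop)]
  apply lintegral_congr_ae
  filter_upwards [ae_restrict_mem measurableSet_Ioi] with t ht
  have ht : 0 < t := ht
  rw [← mul_assoc, ← ENNReal.ofReal_mul hc.le]
  congr 2
  field_simp

lemma mdt_Ico_lt_top {a b : ℝ} (ha : 0 < a) : mdt (Set.Ico a b) < ⊤ := by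
  unfold mdt
  rw [withDensity_apply _ measurableSet_Ico]
  calc _ ≤ ∫⁻ t in Set.Ico a b, ENNReal.ofReal t⁻¹ :=
        lintegral_mono' (Measure.restrict_mono le_rfl Measure.restrict_le_self) le_rfl
    _ ≤ ∫⁻ t in Set.Ico a b, ENNReal.ofReal a⁻¹ := by
        apply setLIntegral_mono (by fun_prop)
        intro t ht
        apply ENNReal.ofReal_le_ofReal
        have := ht.1
        gcongr
    _ < ⊤ := by
        rw [setLIntegral_const]
        exact ENNReal.mul_lt_top ENNReal.ofReal_lt_top (by simp)

lemma setLIntegral_mdt_scale {φ : ℝ → ℝ≥0∞} (hφ : Measurable φ) {c : ℝ} (hc : 0 < c) (a b : ℝ) :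
    ∫⁻ t in Set.Ico a b, φ (c * t) ∂mdt = ∫⁻ t in Set.Ico (c * a) (c * b), φ t ∂mdt := by
  rw [← lintegral_indicator measurableSet_Ico, ← lintegral_indicator measurableSet_Ico,
    ← lintegral_mdt_scale (hφ.indicator measurableSet_Ico) hc]
  congr 1; ext t
  simp only [Set.indicator_apply, Set.mem_Ico, mul_le_mul_iff_right₀ hc, mul_lt_mul_iff_right₀ hc]

lemma telescoping_bound {Z Y : ℝ → ℝ≥0∞} (hZ : Measurable Z) (hY : Measurable Y) {L : ℝ} (hL : 1 < L)
    {C Y0 : ℝ≥0∞} (hC : C ≠ ⊤)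
    (h : ∀ t, 0 < t → Z t + C * Y (L * t) ≤ C * Y t) (hY0 : ∀ t, 0 < t → Y t ≤ Y0) :
    ∫⁻ t, Z t ∂mdt ≤ C * mdt (Set.Ico 1 L) * Y0 := by
  by_cases hT : Y0 = ⊤
  · by_cases hC0 : C = 0
    · have : ∫⁻ t, Z t ∂mdt = 0 := by
        rw [lintegral_eq_zero_iff hZ]
        filter_upwards [ae_mdt_pos] with t ht
        have := h t ht
        simpa [hC0] using this
      rw [this]; exact zero_le
    · have hm0 : mdt (Set.Ico 1 L) ≠ 0 := by
        unfold mdt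
        rw [withDensity_apply _ measurableSet_Ico, Measure.restrict_restrict measurableSet_Ico,
          Set.inter_eq_self_of_subset_left (show Set.Ico 1 L ⊆ Set.Ioi (0 : ℝ) from
            fun t ht => lt_of_lt_of_le one_pos ht.1)]
        intro h0
        rw [lintegral_eq_zero_iff (by fun_prop)] at h0
        have h1 : ∀ᵐ t ∂(volume.restrict (Set.Ico (1 : ℝ) L)), False := by
          filter_upwards [h0, ae_restrict_mem measurableSet_Ico] with t ht ht'
          have : 0 < t := lt_of_lt_of_le one_pos ht'.1
          simp at ht
          linarith
        rw [ae_iff] at h1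
        simp at h1
        linarith
      rw [hT, ENNReal.mul_top (mul_ne_zero hC0 hm0)]; exact le_top
  have hL0 : 0 < L := by linarith
  have key : ∀ ε R, 0 < ε → ∫⁻ t in Set.Ico ε R, Z t ∂mdt ≤ C * mdt (Set.Ico 1 L) * Y0 := by
    intro ε R hε
    have h1 : ∫⁻ t in Set.Ico ε R, Z t ∂mdt + C * ∫⁻ t in Set.Ico ε R, Y (L * t) ∂mdt ≤
        C * ∫⁻ t in Set.Ico ε R, Y t ∂mdt := by
      rw [← lintegral_const_mul _ (by fun_prop), ← lintegral_const_mul _ hY,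
        ← lintegral_add_left hZ]
      apply setLIntegral_mono (by fun_prop)
      intro t ht
      exact h t (hε.trans_le ht.1)
    rw [setLIntegral_mdt_scale hY hL0] at h1
    have h2 : ∫⁻ t in Set.Ico ε R, Y t ∂mdt ≤ ∫⁻ t in Set.Ico ε (L * ε), Y t ∂mdt +
        ∫⁻ t in Set.Ico (L * ε) (L * R), Y t ∂mdt := by
      refine le_trans ?_ (lintegral_union_le _ _ _)
      apply lintegral_mono_set
      intro t ht
      by_cases h' : t < L * ε
      · left; exact ⟨ht.1, h'⟩
      · right
        refine ⟨not_lt.1 h', ht.2.trans ?_⟩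
        have : 0 < R := hε.trans (ht.1.trans_lt ht.2)
        nlinarith
    have hbd : ∀ a b, 0 < a → ∫⁻ t in Set.Ico a b, Y t ∂mdt ≤ Y0 * mdt (Set.Ico a b) := by
      intro a b ha
      rw [← setLIntegral_const]
      apply setLIntegral_mono (by fun_prop)
      intro t ht
      exact hY0 t (ha.trans_le ht.1)
    have hfin : C * ∫⁻ t in Set.Ico (L * ε) (L * R), Y t ∂mdt ≠ ⊤ :=
      ENNReal.mul_ne_top hC (ne_top_of_le_ne_top (ENNReal.mul_ne_top hT
        (mdt_Ico_lt_top (by positivity)).ne) (hbd _ _ (by positivity)))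
    have h3 : ∫⁻ t in Set.Ico ε R, Z t ∂mdt ≤ C * ∫⁻ t in Set.Ico ε (L * ε), Y t ∂mdt := by
      rw [← ENNReal.add_le_add_iff_right hfin]
      refine h1.trans ?_
      rw [← mul_add]
      gcongr
    refine h3.trans ?_
    rw [mul_assoc]
    gcongr
    refine (hbd _ _ hε).trans ?_
    have := setLIntegral_mdt_scale (φ := fun _ => 1) measurable_const hε 1 L
    simp only [lintegral_const, one_mul, Measure.restrict_apply, MeasurableSet.univ,
      Set.univ_inter, mul_one] at this
    rw [this, mul_comm ε L, mul_comm]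
  have hU : Set.Ioi (0 : ℝ) = ⋃ k : ℕ, Set.Ico (1 / ((k : ℝ) + 1)) ((k : ℝ) + 1) := by
    ext t
    simp only [Set.mem_Ioi, Set.mem_iUnion, Set.mem_Ico]
    constructor
    · intro ht
      obtain ⟨k, hk⟩ := exists_nat_gt (max t (1 / t))
      have h1 := (le_max_left _ _).trans_lt hk
      have h2 := (le_max_right _ _).trans_lt hk
      refine ⟨k, ?_, by linarith⟩
      rw [div_le_iff₀ (by positivity)]
      rw [div_lt_iff₀ ht] at h2
      nlinarith
    · rintro ⟨k, hk, -⟩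
      exact lt_of_lt_of_le (by positivity) hk
  have hZ' : ∫⁻ t, Z t ∂mdt = ∫⁻ t in Set.Ioi 0, Z t ∂mdt := by
    rw [Measure.restrict_eq_self_of_ae_mem (s := Set.Ioi (0 : ℝ)) ae_mdt_pos]
  rw [hZ', hU, setLIntegral_iUnion_of_directed]
  · exact iSup_le fun k => key _ _ (by positivity)
  · apply Monotone.directed_le
    intro k l hkl
    apply Set.Ico_subset_Ico
    · gcongr
    · gcongr

/-- the energy lemma -/
lemma energy {b : ℝ} (hb0 : 0 ≤ b) (hb1 : b < 1) {K : ℝ} (hK : 0 < K) :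
    ∃ C : ℝ≥0∞, C ≠ ⊤ ∧ ∀ (n : ℕ) (f w : En n → ℝ) (e : ℝ), BM f → BM w → 0 < e → (∀ x, e ≤ w x) →
    ∫⁻ t, ∫⁻ x, ∫⁻ y, ENNReal.ofReal ((P t f y - P (t + K * t) f x) ^ 2 *
      (P t w y + P (t + K * t) w x) ^ (-b)) ∂(hm (K * t) x) ∂volume ∂mdt ≤
      C * ∫⁻ x, ENNReal.ofReal (f x ^ 2 * w x ^ (-b)) := by
  obtain ⟨C, hC, h⟩ := prob_defect hb0 hb1
  refine ⟨ENNReal.ofReal C * mdt (Set.Ico 1 (1 + K)),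
    ENNReal.mul_ne_top ENNReal.ofReal_ne_top (mdt_Ico_lt_top one_pos).ne,
    fun n f w e hf hw he hew => ?_⟩
  have hfm := hf.1
  have hwm := hw.1
  set Y : ℝ → ℝ≥0∞ := fun t => ∫⁻ x, ENNReal.ofReal (P t f x ^ 2 * P t w x ^ (-b)) with hY
  set Z : ℝ → ℝ → ℝ≥0∞ := fun t d => ∫⁻ x, ∫⁻ y, ENNReal.ofReal ((P t f y - P (t + d) f x) ^ 2 *
      (P t w y + P (t + d) w x) ^ (-b)) ∂(hm d x) with hZ
  have hwt : ∀ t x, e ≤ P t w x := fun t x => by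
    rw [← P_const e t x]; exact P_mono (BM.const e) hw hew t x
  have key : ∀ t d, 0 ≤ t → 0 ≤ d → Z t d + ENNReal.ofReal C * Y (t + d) ≤ ENNReal.ofReal C * Y t := by
    intro t d ht hd
    have h1 : ∀ x, (∫⁻ y, ENNReal.ofReal ((P t f y - P (t + d) f x) ^ 2 *
      (P t w y + P (t + d) w x) ^ (-b)) ∂(hm d x)) + ENNReal.ofReal C *
        ENNReal.ofReal (P (t + d) f x ^ 2 * P (t + d) w x ^ (-b)) ≤
        ENNReal.ofReal C * PE d (fun y => ENNReal.ofReal (P t f y ^ 2 * P t w y ^ (-b))) x := by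
      intro x
      have := h n (hm d x) (P t f) (P t w) e (hf.P t) (hw.P t) he (hwt t)
      have e1 : ∫ z, P t f z ∂(hm d x) = P (t + d) f x := by
        rw [add_comm]; exact P_semigroup hd ht hf x
      have e2 : ∫ z, P t w z ∂(hm d x) = P (t + d) w x := by
        rw [add_comm]; exact P_semigroup hd ht hw x
      rw [e1, e2] at this
      exact this
    have h2 := lintegral_mono (μ := volume) h1
    rw [lintegral_add_right _ (by fun_prop), lintegral_const_mul _ (by fun_prop),
      lintegral_const_mul _ (by fun_prop), lintegral_PE d (by fun_prop)] at h2
    exact h2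
  have hY0 : ∀ t, 0 < t → Y t ≤ ∫⁻ x, ENNReal.ofReal (f x ^ 2 * w x ^ (-b)) := by
    intro t ht
    have h1 := key 0 t le_rfl ht.le
    have h2 : ENNReal.ofReal C * Y t ≤ ENNReal.ofReal C * Y 0 := by
      rw [zero_add] at h1; exact le_add_self.trans h1
    rw [ENNReal.mul_le_mul_iff_right (by simpa using hC) ENNReal.ofReal_ne_top] at h2
    refine h2.trans (le_of_eq ?_)
    simp only [hY, P_zero]
  refine telescoping_bound (Y := Y) (Z := fun t => Z t (K * t)) (L := 1 + K) ?_ ?_ (by linarith)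
    ENNReal.ofReal_ne_top ?_ hY0
  · apply Measurable.lintegral_prod_right
    apply measurable_lintegral_hm (by fun_prop) (by fun_prop)
    unfold Function.uncurry
    fun_prop
  · apply Measurable.lintegral_prod_right
    unfold Function.uncurry
    fun_prop
  · intro t ht
    have := key t (K * t) ht.le (by positivity)
    rwa [show (1 + K) * t = t + K * t by ring]

/-! ## Square function, small exponents -/

lemma hk_two {n : ℕ} {s : ℝ} (hs : 0 < s) (z : En n) :
    hk s z * Real.exp (π / (2 * s) * ‖z‖ ^ 2) = 2 ^ ((n : ℝ) / 2) * hk (2 * s) z := by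
  unfold hk
  rw [Real.mul_rpow (by norm_num) hs.le, mul_assoc, ← Real.exp_add, ← mul_assoc, ← mul_assoc,
    ← Real.rpow_add (by norm_num : (0 : ℝ) < 2)]
  rw [show (n : ℝ) / 2 + -(n : ℝ) / 2 = 0 by ring, Real.rpow_zero, one_mul]
  congr 2
  field_simp
  ring

lemma lintegral_hm_double {n : ℕ} {s : ℝ} (hs : 0 < s) (x : En n) {φ : En n → ℝ≥0∞}
    (hφ : Measurable φ) : ∫⁻ y, φ y ∂(hm s x) ≤ ENNReal.ofReal (2 ^ ((n : ℝ) / 2)) *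
      ∫⁻ y, ENNReal.ofReal (Real.exp (-(π / (2 * s) * ‖x - y‖ ^ 2))) * φ y ∂(hm (2 * s) x) := by
  rw [lintegral_hm hs x hφ, lintegral_hm (by positivity) x (by fun_prop),
    ← lintegral_const_mul _ (by fun_prop)]
  apply lintegral_mono
  intro y
  simp only
  rw [← mul_assoc, ← mul_assoc, ← ENNReal.ofReal_mul (by positivity)]
  rw [← hk_two hs, ← ENNReal.ofReal_mul (by have := hk_pos hs (x - y); positivity), mul_assoc,
    ← Real.exp_add]
  simp

lemma lintegral_hm_exp {n : ℕ} {s κ : ℝ} (hs : 0 < s) (hκ : 2 * s ≤ κ) (x : En n)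
    {φ : En n → ℝ≥0∞} (hφ : Measurable φ) :
    ∫⁻ y, ENNReal.ofReal (Real.exp (π / κ * ‖x - y‖ ^ 2)) * φ y ∂(hm s x) ≤
      ENNReal.ofReal (2 ^ ((n : ℝ) / 2)) * ∫⁻ y, φ y ∂(hm (2 * s) x) := by
  rw [lintegral_hm hs x (by fun_prop), lintegral_hm (by positivity) x hφ,
    ← lintegral_const_mul _ (by fun_prop)]
  apply lintegral_mono
  intro y
  simp only
  rw [← mul_assoc, ← mul_assoc, ← ENNReal.ofReal_mul (hk_nonneg hs _),
    ← ENNReal.ofReal_mul (by positivity), ← hk_two hs]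
  have := hk_nonneg hs (x - y)
  have := Real.pi_pos
  gcongr

lemma variance_le {n : ℕ} (μ : Measure (En n)) [IsProbabilityMeasure μ] {u : En n → ℝ} (hu : BM u)
    (a : ℝ) : ∫⁻ y, ENNReal.ofReal ((u y - ∫ z, u z ∂μ) ^ 2) ∂μ ≤
      ∫⁻ y, ENNReal.ofReal ((u y - a) ^ 2) ∂μ := by
  set m := ∫ z, u z ∂μ with hm
  have b : ∀ c, BM (fun y => (u y - c) ^ 2) := fun c => by
    have := (hu.sub (BM.const c)).mul (hu.sub (BM.const c))
    simpa [sq] using this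
  rw [← ofReal_integral_eq_lintegral_ofReal ((b m).int μ) (Eventually.of_forall fun y => sq_nonneg _),
    ← ofReal_integral_eq_lintegral_ofReal ((b a).int μ) (Eventually.of_forall fun y => sq_nonneg _)]
  apply ENNReal.ofReal_le_ofReal
  have z1 : ∫ y, (u y - m) ∂μ = 0 := by
    rw [integral_sub (hu.int μ) (integrable_const _)]; simp [← hm]
  have i1 : Integrable (fun y => (u y - m) ^ 2 + (m - a) ^ 2) μ := ((b m).int μ).add (integrable_const _)
  have i2 : Integrable (fun y => 2 * (m - a) * (u y - m)) μ :=
    ((hu.int μ).sub (integrable_const _)).const_mul _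
  have : ∫ y, (u y - a) ^ 2 ∂μ = ∫ y, (u y - m) ^ 2 ∂μ + (m - a) ^ 2 := by
    rw [show (fun y => (u y - a) ^ 2) = fun y => ((u y - m) ^ 2 + (m - a) ^ 2) + 2 * (m - a) * (u y - m)
      by ext y; ring, integral_add i1 i2, integral_add ((b m).int μ) (integrable_const _),
      integral_const_mul, z1]
    simp
  rw [this]
  nlinarith [sq_nonneg (m - a)]

/-- local energy -/
def E2 {n : ℕ} (t : ℝ) (f : En n → ℝ) (x : En n) : ℝ≥0∞ :=
  ∫⁻ y, ENNReal.ofReal ((P t f y - P (9 * t) f x) ^ 2) ∂(hm (8 * t) x)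

/-- square function (squared) -/
def S2 {n : ℕ} (f : En n → ℝ) (x : En n) : ℝ≥0∞ := ∫⁻ t, E2 t f x ∂mdt

@[fun_prop]
lemma measurable_E2 {n : ℕ} {α : Type*} [MeasurableSpace α] {T : α → ℝ} {X : α → En n}
    {f : En n → ℝ} (hf : Measurable f) (hT : Measurable T) (hX : Measurable X) :
    Measurable fun a => E2 (T a) f (X a) := by
  unfold E2
  apply measurable_lintegral_hm (by fun_prop) (by fun_prop)
  unfold Function.uncurry
  fun_prop

@[fun_prop]
lemma measurable_S2 {n : ℕ} {f : En n → ℝ} (hf : Measurable f) : Measurable (S2 f) := by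
  unfold S2
  apply Measurable.lintegral_prod_right
  unfold Function.uncurry
  fun_prop

lemma E2_le {n : ℕ} {t : ℝ} (ht : 0 ≤ t) {f : En n → ℝ} (hf : BM f) (x : En n) (a : ℝ) :
    E2 t f x ≤ ∫⁻ y, ENNReal.ofReal ((P t f y - a) ^ 2) ∂(hm (8 * t) x) := by
  have := variance_le (hm (8 * t) x) (hf.P t) a
  rw [show ∫ z, P t f z ∂(hm (8 * t) x) = P (9 * t) f x by
    have := P_semigroup (s := 8 * t) (t := t) (by positivity) ht hf x
    rw [show 8 * t + t = 9 * t by ring] at this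
    exact this] at this
  exact this

lemma rpow_neg_lower {A e M v b : ℝ} (hA : 1 ≤ A) (he : 1 ≤ e) (hM : 0 < M) (hv : 0 < v)
    (hb0 : 0 ≤ b) (hb1 : b < 1) (h : v ≤ A * e * M) : M ^ (-b) * e⁻¹ ≤ A * v ^ (-b) := by
  have hA0 : 0 < A := by linarith
  have he0 : 0 < e := by linarith
  have h1 : (A * e * M) ^ (-b) ≤ v ^ (-b) := Real.rpow_le_rpow_of_nonpos hv h (by linarith)
  have h2 : (A * e * M) ^ (-b) = (A ^ b)⁻¹ * (e ^ b)⁻¹ * M ^ (-b) := by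
    rw [Real.mul_rpow (by positivity) hM.le, Real.mul_rpow hA0.le he0.le, Real.rpow_neg hA0.le,
      Real.rpow_neg he0.le]
  have h3 : A ^ b ≤ A := by simpa using Real.rpow_le_rpow_of_exponent_le hA hb1.le
  have h4 : e ^ b ≤ e := by simpa using Real.rpow_le_rpow_of_exponent_le he hb1.le
  calc M ^ (-b) * e⁻¹ = A * (A⁻¹ * e⁻¹ * M ^ (-b)) := by field_simp
    _ ≤ A * ((A ^ b)⁻¹ * (e ^ b)⁻¹ * M ^ (-b)) := by gcongr
    _ ≤ A * v ^ (-b) := by rw [← h2]; gcongr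

lemma low_bound {n : ℕ} {b : ℝ} (hb0 : 0 ≤ b) (hb1 : b < 1) : ∃ C : ℝ≥0∞, C ≠ ⊤ ∧
    ∀ (f : En n → ℝ) (ε t : ℝ) (x : En n), BM f → 0 < ε → 0 < t →
    ENNReal.ofReal (((Mx (fun y => ENNReal.ofReal |f y|) x).toReal + ε) ^ (-b)) * E2 t f x ≤
    C * ∫⁻ y, ENNReal.ofReal ((P t f y - P (t + 16 * t) f x) ^ 2 *
      (P t (fun z => |f z| + ε) y + P (t + 16 * t) (fun z => |f z| + ε) x) ^ (-b)) ∂(hm (16 * t) x) := by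
  set A : ℝ := (17 : ℝ) ^ ((n : ℝ) / 2) * 2 ^ ((n : ℝ) / 2) + 2 ^ ((n : ℝ) / 2) + 2 with hA
  have hA1 : 1 ≤ A := by
    have : 0 < (17 : ℝ) ^ ((n : ℝ) / 2) * 2 ^ ((n : ℝ) / 2) + 2 ^ ((n : ℝ) / 2) := by positivity
    linarith
  refine ⟨ENNReal.ofReal (2 ^ ((n : ℝ) / 2)) * ENNReal.ofReal A,
    ENNReal.mul_ne_top ENNReal.ofReal_ne_top ENNReal.ofReal_ne_top, fun f ε t x hf hε ht => ?_⟩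
  have hfm := hf.1
  set φ : En n → ℝ≥0∞ := fun y => ENNReal.ofReal |f y| with hφ
  have hφm : Measurable φ := by fun_prop
  obtain ⟨M0, hM0, hM⟩ := hf.bd
  have hfin : Mx φ x ≠ ⊤ := ne_top_of_le_ne_top (b := ENNReal.ofReal M0) ENNReal.ofReal_ne_top
    (Mx_le_const (fun y => ENNReal.ofReal_le_ofReal (hM y)) x)
  set m := (Mx φ x).toReal with hm
  have hm0 : 0 ≤ m := ENNReal.toReal_nonneg
  have hmM : Mx φ x = ENNReal.ofReal m := (ENNReal.ofReal_toReal hfin).symm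
  have hPw : ∀ t y, P t (fun z => |f z| + ε) y = P t (fun z => |f z|) y + ε := fun t y => by
    rw [P_add hf.abs (BM.const ε), P_const]
  have hPn : ∀ t y, 0 ≤ P t (fun z => |f z|) y := fun t y => integral_nonneg (fun z => abs_nonneg _)
  have hP1 : P (17 * t) (fun z => |f z|) x ≤ 2 ^ ((n : ℝ) / 2) * m := by
    have := PE_le_Mx hφm (by positivity : 0 < 17 * t) x
    rw [hφ, PE_ofReal hf.abs (fun _ => abs_nonneg _), ← hφ, hmM, ← ENNReal.ofReal_mul (by positivity),
      ENNReal.ofReal_le_ofReal_iff (by positivity)] at this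
    exact this
  have hP2 : ∀ y, P t (fun z => |f z|) y ≤ 17 ^ ((n : ℝ) / 2) *
      Real.exp (π / (16 * t) * ‖x - y‖ ^ 2) * (2 ^ ((n : ℝ) / 2) * m) := fun y => by
    have := PE_harnack ht (by norm_num : (0 : ℝ) < 16) hφm x y
    rw [hφ, PE_ofReal hf.abs (fun _ => abs_nonneg _), PE_ofReal hf.abs (fun _ => abs_nonneg _),
      ← ENNReal.ofReal_mul (by positivity), ← ENNReal.ofReal_mul (by positivity),
      ENNReal.ofReal_le_ofReal_iff (by have := hPn ((1 + 16) * t) x; positivity)] at this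
    norm_num at this
    refine this.trans ?_
    gcongr
  calc _ ≤ ENNReal.ofReal ((m + ε) ^ (-b)) * (ENNReal.ofReal (2 ^ ((n : ℝ) / 2)) *
      ∫⁻ y, ENNReal.ofReal (Real.exp (-(π / (2 * (8 * t)) * ‖x - y‖ ^ 2))) *
        ENNReal.ofReal ((P t f y - P (t + 16 * t) f x) ^ 2) ∂(_root_.hm (2 * (8 * t)) x)) := by
        gcongr
        exact (E2_le ht.le hf x _).trans (lintegral_hm_double (by positivity) x (by fun_prop))
    _ = ENNReal.ofReal (2 ^ ((n : ℝ) / 2)) * ∫⁻ y, ENNReal.ofReal ((m + ε) ^ (-b)) *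
      (ENNReal.ofReal (Real.exp (-(π / (16 * t) * ‖x - y‖ ^ 2))) *
        ENNReal.ofReal ((P t f y - P (t + 16 * t) f x) ^ 2)) ∂(_root_.hm (16 * t) x) := by
        rw [lintegral_const_mul _ (by fun_prop), show 2 * (8 * t) = 16 * t by ring]
        ring
    _ ≤ _ := by
        rw [mul_assoc]
        refine mul_le_mul_right ?_ _
        rw [← lintegral_const_mul (ENNReal.ofReal A) (by fun_prop)]
        refine lintegral_mono fun y => ?_
        set v := P t (fun z => |f z| + ε) y + P (t + 16 * t) (fun z => |f z| + ε) x with hv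
        have hv0 : 0 < v := by
          rw [hv, hPw, hPw]
          have := hPn t y
          have := hPn (t + 16 * t) x
          linarith
        have he : 1 ≤ Real.exp (π / (16 * t) * ‖x - y‖ ^ 2) := Real.one_le_exp (by positivity)
        have hle : v ≤ A * Real.exp (π / (16 * t) * ‖x - y‖ ^ 2) * (m + ε) := by
          rw [hv, hPw, hPw, show t + 16 * t = 17 * t by ring]
          have h2 := hP2 y
          set e := Real.exp (π / (16 * t) * ‖x - y‖ ^ 2) with he'
          have e1 : 2 ^ ((n : ℝ) / 2) * m ≤ 2 ^ ((n : ℝ) / 2) * m * e :=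
            le_mul_of_one_le_right (by positivity) he
          have e2 : ε ≤ ε * e := le_mul_of_one_le_right hε.le he
          have e3 : 0 ≤ (A - 2) * e * ε := by
            rw [hA]; ring_nf; positivity
          have e4 : 0 ≤ m * e := by positivity
          rw [hA] at e3 ⊢
          nlinarith
        have := rpow_neg_lower hA1 he (by positivity : 0 < m + ε) hv0 hb0 hb1 hle
        rw [← ENNReal.ofReal_mul (by positivity), ← ENNReal.ofReal_mul (by positivity),
          ← ENNReal.ofReal_mul (by positivity)]
        apply ENNReal.ofReal_le_ofReal
        rw [Real.exp_neg]
        calc _ = ((m + ε) ^ (-b) * (Real.exp (π / (16 * t) * ‖x - y‖ ^ 2))⁻¹) *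
            (P t f y - P (t + 16 * t) f x) ^ 2 := by ring
          _ ≤ (A * v ^ (-b)) * (P t f y - P (t + 16 * t) f x) ^ 2 := by gcongr
          _ = _ := by ring

lemma low_weighted {n : ℕ} {q : ℝ} (hq1 : 1 < q) (hq2 : q ≤ 2) : ∃ C : ℝ≥0∞, C ≠ ⊤ ∧
    ∀ f : En n → ℝ, BM f → ∫⁻ x, (Mx (fun y => ENNReal.ofReal |f y|) x) ^ (-(2 - q)) * S2 f x ≤
      C * ∫⁻ x, ENNReal.ofReal |f x| ^ q := by
  have hb0 : 0 ≤ 2 - q := by linarith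
  have hb1 : 2 - q < 1 := by linarith
  obtain ⟨C1, hC1, h1⟩ := low_bound (n := n) hb0 hb1
  obtain ⟨C2, hC2, h2⟩ := energy hb0 hb1 (by norm_num : (0 : ℝ) < 16)
  refine ⟨C1 * C2, ENNReal.mul_ne_top hC1 hC2, fun f hf => ?_⟩
  have hfm := hf.1
  set M : En n → ℝ≥0∞ := Mx (fun y => ENNReal.ofReal |f y|) with hM
  have hMm : Measurable M := by rw [hM]; fun_prop
  obtain ⟨M0, hM0, hMb⟩ := hf.bd
  have hfin : ∀ x, M x ≠ ⊤ := fun x => ne_top_of_le_ne_top (b := ENNReal.ofReal M0) ENNReal.ofReal_ne_top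
    (Mx_le_const (fun y => ENNReal.ofReal_le_ofReal (hMb y)) x)
  have key : ∀ ε : ℝ, 0 < ε → ∫⁻ x, ENNReal.ofReal (((M x).toReal + ε) ^ (-(2 - q))) * S2 f x ≤
      C1 * C2 * ∫⁻ x, ENNReal.ofReal |f x| ^ q := by
    intro ε hε
    set w : En n → ℝ := fun z => |f z| + ε with hw
    have hwB : BM w := hf.abs.add (BM.const ε)
    have hwm := hwB.1
    calc _ = ∫⁻ x, ∫⁻ t, ENNReal.ofReal (((M x).toReal + ε) ^ (-(2 - q))) * E2 t f x ∂mdt := by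
          apply lintegral_congr; intro x
          rw [lintegral_const_mul _ (by fun_prop)]; rfl
      _ = ∫⁻ t, ∫⁻ x, ENNReal.ofReal (((M x).toReal + ε) ^ (-(2 - q))) * E2 t f x ∂volume ∂mdt := by
          apply lintegral_lintegral_swap
          apply Measurable.aemeasurable
          unfold Function.uncurry
          fun_prop
      _ ≤ ∫⁻ t, C1 * ∫⁻ x, ∫⁻ y, ENNReal.ofReal ((P t f y - P (t + 16 * t) f x) ^ 2 *
            (P t w y + P (t + 16 * t) w x) ^ (-(2 - q))) ∂(hm (16 * t) x) ∂volume ∂mdt := by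
          apply lintegral_mono_ae
          filter_upwards [ae_mdt_pos] with t ht
          rw [← lintegral_const_mul]
          · exact lintegral_mono fun x => h1 f ε t x hf hε ht
          · apply measurable_lintegral_hm (by fun_prop) (by fun_prop)
            unfold Function.uncurry
            fun_prop
      _ = C1 * ∫⁻ t, ∫⁻ x, ∫⁻ y, ENNReal.ofReal ((P t f y - P (t + 16 * t) f x) ^ 2 *
            (P t w y + P (t + 16 * t) w x) ^ (-(2 - q))) ∂(hm (16 * t) x) ∂volume ∂mdt := by
          rw [lintegral_const_mul' _ _ hC1]
      _ ≤ C1 * (C2 * ∫⁻ x, ENNReal.ofReal (f x ^ 2 * w x ^ (-(2 - q)))) := by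
          gcongr
          exact h2 n f w ε hf hwB hε (fun x => by rw [hw]; linarith [abs_nonneg (f x)])
      _ ≤ C1 * C2 * ∫⁻ x, ENNReal.ofReal |f x| ^ q := by
          rw [mul_assoc]
          gcongr with x
          rw [ENNReal.ofReal_rpow_of_nonneg (abs_nonneg _) (by linarith)]
          apply ENNReal.ofReal_le_ofReal
          rcases (abs_nonneg (f x)).eq_or_lt with h | h
          · have : f x = 0 := by simpa using h.symm
            rw [this]; simp [Real.zero_rpow (by linarith : q ≠ 0)]
          · calc f x ^ 2 * w x ^ (-(2 - q)) ≤ |f x| ^ (2 : ℝ) * |f x| ^ (-(2 - q)) := by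
                  rw [← sq_abs (f x), ← Real.rpow_natCast]
                  push_cast
                  refine mul_le_mul_of_nonneg_left ?_ (by positivity)
                  apply Real.rpow_le_rpow_of_nonpos h _ (by linarith)
                  rw [hw]; simp only; linarith
              _ = |f x| ^ q := by rw [← Real.rpow_add h]; ring_nf
  have htend : ∀ x, Tendsto (fun k : ℕ => ENNReal.ofReal (((M x).toReal + 1 / ((k : ℝ) + 1)) ^ (-(2 - q))) * S2 f x)
      atTop (𝓝 (M x ^ (-(2 - q)) * S2 f x)) := by
    intro x
    apply ENNReal.Tendsto.mul_const
    · have e1 : ∀ k : ℕ, ENNReal.ofReal (((M x).toReal + 1 / ((k : ℝ) + 1)) ^ (-(2 - q))) =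
          (M x + ENNReal.ofReal (1 / ((k : ℝ) + 1))) ^ (-(2 - q)) := by
        intro k
        rw [← ENNReal.ofReal_rpow_of_pos (by positivity), ENNReal.ofReal_add (by positivity) (by positivity),
          ENNReal.ofReal_toReal (hfin x)]
      simp only [e1]
      apply (ENNReal.continuous_rpow_const.tendsto (M x)).comp
      have : Tendsto (fun k : ℕ => ENNReal.ofReal (1 / ((k : ℝ) + 1))) atTop (𝓝 0) := by
        rw [← ENNReal.ofReal_zero]
        exact ENNReal.tendsto_ofReal tendsto_one_div_add_atTop_nhds_zero_nat
      simpa using this.const_add (M x)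
    · left
      intro h
      rw [ENNReal.rpow_eq_zero_iff] at h
      rcases h with ⟨h, h'⟩ | ⟨h, -⟩
      · linarith
      · exact hfin x h
  calc ∫⁻ x, M x ^ (-(2 - q)) * S2 f x
      = ∫⁻ x, liminf (fun k : ℕ => ENNReal.ofReal (((M x).toReal + 1 / ((k : ℝ) + 1)) ^ (-(2 - q))) * S2 f x)
        atTop := lintegral_congr fun x => (htend x).liminf_eq.symm
    _ ≤ liminf (fun k : ℕ => ∫⁻ x, ENNReal.ofReal (((M x).toReal + 1 / ((k : ℝ) + 1)) ^ (-(2 - q))) * S2 f x)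
        atTop := lintegral_liminf_le (fun k => by fun_prop)
    _ ≤ _ := liminf_le_of_le (by isBoundedDefault) (fun b hb => by
        obtain ⟨k, hk⟩ := hb.exists
        exact hk.trans (key _ (by positivity)))

lemma sq_low {n : ℕ} (hn : 0 < n) {q : ℝ} (hq1 : 1 < q) (hq2 : q ≤ 2) : ∃ C : ℝ≥0∞, C ≠ ⊤ ∧
    ∀ f : En n → ℝ, BM f → ∫⁻ x, S2 f x ^ (q / 2) ≤ C * ∫⁻ x, ENNReal.ofReal |f x| ^ q := by
  obtain ⟨C1, hC1, h1⟩ := low_weighted (n := n) hq1 hq2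
  obtain ⟨C2, hC2, h2⟩ := strong_type hn hq1
  refine ⟨C1 ^ (q / 2) * C2 ^ (1 - q / 2) + 1, by
    have : C1 ^ (q / 2) ≠ ⊤ := ENNReal.rpow_ne_top_of_nonneg (by linarith) hC1
    have : C2 ^ (1 - q / 2) ≠ ⊤ := ENNReal.rpow_ne_top_of_nonneg (by linarith) hC2
    finiteness, fun f hf => ?_⟩
  have hfm := hf.1
  by_cases hI : ∫⁻ x, ENNReal.ofReal |f x| ^ q = ⊤
  · rw [hI, ENNReal.mul_top (by simp)]; exact le_top
  have h1 := h1 f hf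
  obtain ⟨M0, hM0, hMb⟩ := hf.bd
  have h2 := h2 (fun x => |f x|) (by fun_prop) (fun x => abs_nonneg _) ⟨M0, hMb⟩
  have hfin : ∀ x, Mx (fun y => ENNReal.ofReal |f y|) x ≠ ⊤ := fun x =>
    ne_top_of_le_ne_top (b := ENNReal.ofReal M0) ENNReal.ofReal_ne_top
    (Mx_le_const (fun y => ENNReal.ofReal_le_ofReal (hMb y)) x)
  have hMm : Measurable (Mx (fun y => ENNReal.ofReal |f y|)) := by fun_prop
  generalize Mx (fun y => ENNReal.ofReal |f y|) = M at *
  generalize hII : ∫⁻ x, ENNReal.ofReal |f x| ^ q = I at *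
  have hae : ∀ᵐ x, M x ^ (-(2 - q)) * S2 f x < ⊤ := by
    apply ae_lt_top (by fun_prop)
    exact ne_top_of_le_ne_top (ENNReal.mul_ne_top hC1 hI) h1
  have hpt : ∀ᵐ x, S2 f x ^ (q / 2) ≤ (M x ^ (-(2 - q)) * S2 f x) ^ (q / 2) * (M x ^ q) ^ (1 - q / 2) := by
    filter_upwards [hae] with x hx
    rcases hq2.eq_or_lt with h | h
    · rw [h]; simp
    by_cases hM : M x = 0
    · rw [hM, ENNReal.zero_rpow_of_neg (by linarith)] at hx
      have : S2 f x = 0 := by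
        by_contra h0
        rw [ENNReal.top_mul h0] at hx
        exact lt_irrefl _ hx
      rw [this, ENNReal.zero_rpow_of_pos (by linarith)]; exact zero_le
    · rw [ENNReal.mul_rpow_of_nonneg _ _ (by linarith), ← ENNReal.rpow_mul, ← ENNReal.rpow_mul,
        mul_comm (M x ^ _), mul_assoc, ← ENNReal.rpow_add _ _ hM (hfin x),
        show -(2 - q) * (q / 2) + q * (1 - q / 2) = 0 by ring]
      simp
  calc _ ≤ ∫⁻ x, (M x ^ (-(2 - q)) * S2 f x) ^ (q / 2) * (M x ^ q) ^ (1 - q / 2) := lintegral_mono_ae hpt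
    _ ≤ (∫⁻ x, M x ^ (-(2 - q)) * S2 f x) ^ (q / 2) * (∫⁻ x, M x ^ q) ^ (1 - q / 2) :=
        ENNReal.lintegral_mul_norm_pow_le (by fun_prop) (by fun_prop) (by linarith) (by linarith) (by ring)
    _ ≤ (C1 * I) ^ (q / 2) * (C2 * I) ^ (1 - q / 2) := by
        gcongr
        linarith
    _ = C1 ^ (q / 2) * C2 ^ (1 - q / 2) * I := by
        rw [ENNReal.mul_rpow_of_nonneg _ _ (by linarith), ENNReal.mul_rpow_of_nonneg _ _ (by linarith),
          mul_mul_mul_comm, ← ENNReal.rpow_add_of_nonneg _ _ (by linarith) (by linarith)]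
        simp
    _ ≤ _ := by gcongr; exact le_self_add

/-! ## Square function, large exponents -/

/-- a second local energy -/
def Eb {n : ℕ} (t : ℝ) (f : En n → ℝ) (x : En n) : ℝ≥0∞ :=
  ∫⁻ y, ENNReal.ofReal ((P t f y - P (t + 32 * t) f x) ^ 2) ∂(hm (16 * t) x)

@[fun_prop]
lemma measurable_Eb {n : ℕ} {α : Type*} [MeasurableSpace α] {T : α → ℝ} {X : α → En n}
    {f : En n → ℝ} (hf : Measurable f) (hT : Measurable T) (hX : Measurable X) :
    Measurable fun a => Eb (T a) f (X a) := by
  unfold Eb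
  apply measurable_lintegral_hm (by fun_prop) (by fun_prop)
  unfold Function.uncurry
  fun_prop

lemma high_avg {n : ℕ} {t : ℝ} (ht : 0 < t) {f : En n → ℝ} (hf : BM f) (x : En n) :
    E2 t f x ≤ (ENNReal.ofReal (2 ^ ((n : ℝ) / 2)) * ENNReal.ofReal (2 ^ ((n : ℝ) / 2))) *
      PE (2 * t) (Eb t f) x := by
  have hfm := hf.1
  have h1 : ∀ x', E2 t f x ≤ ENNReal.ofReal (2 ^ ((n : ℝ) / 2)) *
      (ENNReal.ofReal (Real.exp (π / (8 * t) * ‖x - x'‖ ^ 2)) * Eb t f x') := by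
    intro x'
    refine (E2_le ht.le hf x (P (t + 32 * t) f x')).trans ?_
    have := PE_harnack (t := 8 * t) (θ := 1) (by positivity) one_pos
      (φ := fun y => ENNReal.ofReal ((P t f y - P (t + 32 * t) f x') ^ 2)) (by fun_prop) x' x
    rw [show (1 : ℝ) + 1 = 2 by norm_num, show 2 * (8 * t) = 16 * t by ring, one_mul, norm_sub_rev,
      mul_assoc] at this
    exact this
  calc E2 t f x = ∫⁻ x', E2 t f x ∂(hm t x) := by simp
    _ ≤ ∫⁻ x', ENNReal.ofReal (2 ^ ((n : ℝ) / 2)) *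
      (ENNReal.ofReal (Real.exp (π / (8 * t) * ‖x - x'‖ ^ 2)) * Eb t f x') ∂(hm t x) :=
        lintegral_mono h1
    _ = ENNReal.ofReal (2 ^ ((n : ℝ) / 2)) *
      ∫⁻ x', (ENNReal.ofReal (Real.exp (π / (8 * t) * ‖x - x'‖ ^ 2)) * Eb t f x') ∂(hm t x) := by
        rw [lintegral_const_mul _ (by fun_prop)]
    _ ≤ _ := by
        rw [mul_assoc]
        refine mul_le_mul_right ?_ _
        exact lintegral_hm_exp ht (by linarith) x (by fun_prop)

lemma high_low {n : ℕ} : ∃ C : ℝ≥0∞, C ≠ ⊤ ∧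
    ∀ (f φ : En n → ℝ) (ε t : ℝ) (x : En n), BM f → BM φ → (∀ y, 0 ≤ φ y) → 0 < ε → 0 < t →
    PE (2 * t) (fun y => ENNReal.ofReal (φ y)) x * Eb t f x ≤
    C * ∫⁻ y, ENNReal.ofReal ((P t f y - P (t + 32 * t) f x) ^ 2 *
      (P t (fun z => ((Mx (fun y => ENNReal.ofReal (φ y)) z).toReal + ε) ^ (-2 : ℝ)) y +
       P (t + 32 * t) (fun z => ((Mx (fun y => ENNReal.ofReal (φ y)) z).toReal + ε) ^ (-2 : ℝ)) x)
        ^ (-(1 / 2) : ℝ)) ∂(hm (32 * t) x) := by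
  set A : ℝ := (129 : ℝ) ^ ((n : ℝ) / 2) * 2 ^ ((n : ℝ) / 2) with hA
  have hA0 : 0 < A := by positivity
  have hA1 : 1 ≤ A := by
    have h1 : (1 : ℝ) ≤ 129 ^ ((n : ℝ) / 2) := Real.one_le_rpow (by norm_num) (by positivity)
    have h2 : (1 : ℝ) ≤ 2 ^ ((n : ℝ) / 2) := Real.one_le_rpow (by norm_num) (by positivity)
    rw [hA]; nlinarith
  set B : ℝ := 2 * (A ^ 2 * 2 ^ ((n : ℝ) / 2)) with hB
  have hB1 : 1 ≤ B := by
    have h2 : (1 : ℝ) ≤ 2 ^ ((n : ℝ) / 2) := Real.one_le_rpow (by norm_num) (by positivity)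
    have h3 : 1 ≤ A ^ 2 := one_le_pow₀ hA1
    rw [hB]; nlinarith
  refine ⟨ENNReal.ofReal (2 ^ ((n : ℝ) / 2)) * ENNReal.ofReal B,
    ENNReal.mul_ne_top ENNReal.ofReal_ne_top ENNReal.ofReal_ne_top,
    fun f φ ε t x hf hφ hφ0 hε ht => ?_⟩
  have hfm := hf.1
  have hφm := hφ.1
  set Φ : En n → ℝ≥0∞ := fun y => ENNReal.ofReal (φ y) with hΦ
  have hΦm : Measurable Φ := by fun_prop
  obtain ⟨M0, hM0, hM⟩ := hφ.bd
  have hfin : ∀ x, Mx Φ x ≠ ⊤ := fun x => ne_top_of_le_ne_top (b := ENNReal.ofReal M0)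
    ENNReal.ofReal_ne_top
    (Mx_le_const (fun y => ENNReal.ofReal_le_ofReal ((le_abs_self _).trans (hM y))) x)
  set w : En n → ℝ := fun z => ((Mx Φ z).toReal + ε) ^ (-2 : ℝ) with hw
  have hw0 : ∀ z, 0 < w z := fun z => by
    have : 0 ≤ (Mx Φ z).toReal := ENNReal.toReal_nonneg
    rw [hw]; positivity
  have hwB : BM w := BM.rpow_neg (v := fun z => (Mx Φ z).toReal + ε) (by fun_prop) hε (by norm_num)
    (fun x => by have : 0 ≤ (Mx Φ x).toReal := ENNReal.toReal_nonneg
                 linarith)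
  have hwm := hwB.1
  set p := P (2 * t) φ x with hp
  have hp0 : 0 ≤ p := integral_nonneg hφ0
  have hPEp : PE (2 * t) Φ x = ENNReal.ofReal p := PE_ofReal hφ hφ0 _ _
  have hpz : ∀ z, p ≤ A * Real.exp (π / (256 * t) * ‖x - z‖ ^ 2) * ((Mx Φ z).toReal + ε) := by
    intro z
    have h1 := PE_harnack (t := 2 * t) (θ := 128) (by positivity) (by norm_num) hΦm z x
    rw [hPEp] at h1
    have h2 := h1.trans (mul_le_mul_right (PE_le_Mx hΦm (by positivity) z) _)
    rw [← ENNReal.ofReal_toReal (hfin z), ← ENNReal.ofReal_mul (by positivity),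
      ← ENNReal.ofReal_mul (by positivity), ← ENNReal.ofReal_mul (by positivity),
      ENNReal.ofReal_le_ofReal_iff (by positivity)] at h2
    refine h2.trans (le_of_eq_of_le ?_ (mul_le_mul_of_nonneg_left
      (show (Mx Φ z).toReal ≤ (Mx Φ z).toReal + ε by linarith) (by positivity)))
    rw [hA, norm_sub_rev z x, show (128 : ℝ) * (2 * t) = 256 * t by ring]
    norm_num
    ring
  have hpw : ∀ z, p ^ 2 * w z ≤ A ^ 2 * Real.exp (π / (128 * t) * ‖x - z‖ ^ 2) := by
    intro z
    have hm0 : 0 < (Mx Φ z).toReal + ε := by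
      have : 0 ≤ (Mx Φ z).toReal := ENNReal.toReal_nonneg
      linarith
    have h1 := pow_le_pow_left₀ hp0 (hpz z) 2
    have h2 : w z = (((Mx Φ z).toReal + ε) ^ 2)⁻¹ := by
      rw [hw]; simp only
      rw [Real.rpow_neg hm0.le]
      norm_num
    rw [h2, ← div_eq_mul_inv, div_le_iff₀ (by positivity)]
    refine h1.trans (le_of_eq ?_)
    rw [mul_pow, mul_pow, ← Real.exp_nat_mul]
    congr 3
    push_cast
    field_simp
    ring
  have hPt : ∀ r y, ENNReal.ofReal (p ^ 2 * P r w y) ≤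
      ENNReal.ofReal (A ^ 2) * ∫⁻ z, ENNReal.ofReal (Real.exp (π / (128 * t) * ‖x - z‖ ^ 2)) ∂(hm r y) := by
    intro r y
    rw [ENNReal.ofReal_mul (by positivity), ← PE_ofReal hwB (fun z => (hw0 z).le)]
    unfold PE
    rw [← lintegral_const_mul _ (by fun_prop), ← lintegral_const_mul _ (by fun_prop)]
    refine lintegral_mono fun z => ?_
    rw [← ENNReal.ofReal_mul (by positivity), ← ENNReal.ofReal_mul (by positivity)]
    exact ENNReal.ofReal_le_ofReal (hpw z)
  have hv1 : ∀ y, p ^ 2 * P t w y ≤ A ^ 2 * 2 ^ ((n : ℝ) / 2) * Real.exp (π / (64 * t) * ‖x - y‖ ^ 2) := by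
    intro y
    rw [← ENNReal.ofReal_le_ofReal_iff (by positivity)]
    refine (hPt t y).trans ?_
    rw [mul_assoc, ENNReal.ofReal_mul (by positivity)]
    refine mul_le_mul_right ?_ _
    calc _ ≤ ∫⁻ z, ENNReal.ofReal (Real.exp (π / (64 * t) * ‖x - y‖ ^ 2)) *
          (ENNReal.ofReal (Real.exp (π / (64 * t) * ‖y - z‖ ^ 2)) * 1) ∂(hm t y) := by
          refine lintegral_mono fun z => ?_
          rw [mul_one, ← ENNReal.ofReal_mul (by positivity), ← Real.exp_add]
          apply ENNReal.ofReal_le_ofReal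
          apply Real.exp_le_exp.2
          have h1 : ‖x - z‖ ≤ ‖x - y‖ + ‖y - z‖ := norm_sub_le_norm_sub_add_norm_sub _ _ _
          have h2 : ‖x - z‖ ^ 2 ≤ 2 * (‖x - y‖ ^ 2 + ‖y - z‖ ^ 2) := by
            have := norm_nonneg (x - z)
            nlinarith [sq_nonneg (‖x - y‖ - ‖y - z‖)]
          calc π / (128 * t) * ‖x - z‖ ^ 2 ≤ π / (128 * t) * (2 * (‖x - y‖ ^ 2 + ‖y - z‖ ^ 2)) := by
                gcongr
            _ = _ := by field_simp; ring
      _ ≤ _ := by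
          rw [lintegral_const_mul _ (by fun_prop), mul_comm (2 ^ ((n : ℝ) / 2)),
            ENNReal.ofReal_mul (by positivity)]
          refine mul_le_mul_right ?_ _
          refine (lintegral_hm_exp ht (by linarith) y measurable_const).trans ?_
          simp
  have hv2 : p ^ 2 * P (t + 32 * t) w x ≤ A ^ 2 * 2 ^ ((n : ℝ) / 2) := by
    rw [← ENNReal.ofReal_le_ofReal_iff (by positivity)]
    refine (hPt _ x).trans ?_
    rw [ENNReal.ofReal_mul (by positivity)]
    refine mul_le_mul_right ?_ _
    have := lintegral_hm_exp (s := t + 32 * t) (κ := 128 * t) (by positivity) (by linarith) x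
      (φ := fun _ => 1) measurable_const
    simpa using this
  have hPw0 : ∀ r y, 0 < P r w y := by
    intro r y
    have := (hwB.int (hm r y))
    unfold P
    rw [integral_pos_iff_support_of_nonneg (fun z => (hw0 z).le) this]
    rw [show Function.support w = Set.univ by ext z; simp [(hw0 z).ne']]
    simp
  rw [hPEp]
  calc _ ≤ ENNReal.ofReal p * (ENNReal.ofReal (2 ^ ((n : ℝ) / 2)) *
      ∫⁻ y, ENNReal.ofReal (Real.exp (-(π / (2 * (16 * t)) * ‖x - y‖ ^ 2))) *
        ENNReal.ofReal ((P t f y - P (t + 32 * t) f x) ^ 2) ∂(_root_.hm (2 * (16 * t)) x)) := by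
        gcongr
        exact lintegral_hm_double (by positivity) x (by fun_prop)
    _ = ENNReal.ofReal (2 ^ ((n : ℝ) / 2)) * ∫⁻ y, ENNReal.ofReal p *
      (ENNReal.ofReal (Real.exp (-(π / (32 * t) * ‖x - y‖ ^ 2))) *
        ENNReal.ofReal ((P t f y - P (t + 32 * t) f x) ^ 2)) ∂(_root_.hm (32 * t) x) := by
        rw [lintegral_const_mul _ (by fun_prop), show 2 * (16 * t) = 32 * t by ring]
        ring
    _ ≤ _ := by
        rw [mul_assoc]
        refine mul_le_mul_right ?_ _
        rw [← lintegral_const_mul (ENNReal.ofReal B) (by fun_prop)]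
        refine lintegral_mono fun y => ?_
        set v := P t w y + P (t + 32 * t) w x with hv
        have hv0 : 0 < v := add_pos (hPw0 _ _) (hPw0 _ _)
        set e := Real.exp (π / (32 * t) * ‖x - y‖ ^ 2) with he'
        have he : 1 ≤ e := Real.one_le_exp (by positivity)
        have hle : p ^ 2 * v ≤ B * e := by
          have h1 := hv1 y
          have h3 : Real.exp (π / (64 * t) * ‖x - y‖ ^ 2) ≤ e := by
            apply Real.exp_le_exp.2
            have := Real.pi_pos
            gcongr
            norm_num
          have h4 : A ^ 2 * 2 ^ ((n : ℝ) / 2) * Real.exp (π / (64 * t) * ‖x - y‖ ^ 2) ≤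
            A ^ 2 * 2 ^ ((n : ℝ) / 2) * e := by gcongr
          have h5 : A ^ 2 * 2 ^ ((n : ℝ) / 2) ≤ A ^ 2 * 2 ^ ((n : ℝ) / 2) * e :=
            le_mul_of_one_le_right (by positivity) he
          rw [hv, mul_add, hB]
          linarith
        have hfinal : p ≤ B * e * v ^ (-(1 / 2) : ℝ) := by
          have hvh : (v ^ (-(1 / 2) : ℝ)) ^ 2 = v⁻¹ := by
            rw [← Real.rpow_natCast, ← Real.rpow_mul hv0.le]
            norm_num
            rw [Real.rpow_neg_one]
          apply le_of_sq_le_sq _ (by positivity)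
          rw [mul_pow, hvh, ← div_eq_mul_inv, le_div_iff₀ hv0]
          refine hle.trans ?_
          have : 1 ≤ B * e := by nlinarith
          nlinarith
        rw [← ENNReal.ofReal_mul (by positivity), ← ENNReal.ofReal_mul (by positivity),
          ← ENNReal.ofReal_mul (by positivity)]
        apply ENNReal.ofReal_le_ofReal
        rw [Real.exp_neg, ← he']
        calc _ ≤ (B * e * v ^ (-(1 / 2) : ℝ)) * (e⁻¹ * (P t f y - P (t + 32 * t) f x) ^ 2) := by gcongr
          _ = _ := by
            have : e ≠ 0 := by positivity
            field_simp

lemma high_weighted {n : ℕ} : ∃ C : ℝ≥0∞, C ≠ ⊤ ∧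
    ∀ f φ : En n → ℝ, BM f → BM φ → (∀ y, 0 ≤ φ y) → ∫⁻ x, ENNReal.ofReal (f x ^ 2) ≠ ⊤ →
      ∫⁻ x, ENNReal.ofReal (φ x) * S2 f x ≤
      C * ∫⁻ x, ENNReal.ofReal (f x ^ 2) * Mx (fun y => ENNReal.ofReal (φ y)) x := by
  obtain ⟨C1, hC1, h1⟩ := high_low (n := n)
  obtain ⟨C2, hC2, h2⟩ := energy (b := 1 / 2) (by norm_num) (by norm_num) (by norm_num : (0 : ℝ) < 32)
  set C0 : ℝ≥0∞ := ENNReal.ofReal (2 ^ ((n : ℝ) / 2)) * ENNReal.ofReal (2 ^ ((n : ℝ) / 2)) with hC0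
  have hC0t : C0 ≠ ⊤ := ENNReal.mul_ne_top ENNReal.ofReal_ne_top ENNReal.ofReal_ne_top
  refine ⟨C0 * (C1 * C2), ENNReal.mul_ne_top hC0t (ENNReal.mul_ne_top hC1 hC2),
    fun f φ hf hφ hφ0 hJ => ?_⟩
  have hfm := hf.1
  have hφm := hφ.1
  set Φ : En n → ℝ≥0∞ := fun y => ENNReal.ofReal (φ y) with hΦ
  have hΦm : Measurable Φ := by fun_prop
  obtain ⟨M0, hM0, hM⟩ := hφ.bd
  have hle : ∀ x, Mx Φ x ≤ ENNReal.ofReal M0 := fun x =>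
    Mx_le_const (fun y => ENNReal.ofReal_le_ofReal ((le_abs_self _).trans (hM y))) x
  have hfin : ∀ x, Mx Φ x ≠ ⊤ := fun x => ne_top_of_le_ne_top (b := ENNReal.ofReal M0)
    ENNReal.ofReal_ne_top (hle x)
  have key : ∀ ε : ℝ, 0 < ε → ∫⁻ x, Φ x * S2 f x ≤
      C0 * (C1 * C2) * (∫⁻ x, ENNReal.ofReal (f x ^ 2) * Mx Φ x) +
      C0 * (C1 * C2) * (∫⁻ x, ENNReal.ofReal (f x ^ 2)) * ENNReal.ofReal ε := by
    intro ε hε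
    set w : En n → ℝ := fun z => ((Mx Φ z).toReal + ε) ^ (-2 : ℝ) with hw
    have hmn : ∀ z, 0 ≤ (Mx Φ z).toReal := fun z => ENNReal.toReal_nonneg
    have hwB : BM w := BM.rpow_neg (v := fun z => (Mx Φ z).toReal + ε) (by fun_prop) hε (by norm_num)
      (fun x => by linarith [hmn x])
    have hwm := hwB.1
    have hwe : ∀ x, (M0 + ε) ^ (-2 : ℝ) ≤ w x := fun x => by
      have h3 : (Mx Φ x).toReal ≤ M0 := ENNReal.toReal_le_of_le_ofReal hM0 (hle x)
      have := hmn x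
      exact Real.rpow_le_rpow_of_nonpos (by linarith) (by linarith) (by norm_num)
    calc ∫⁻ x, Φ x * S2 f x = ∫⁻ x, ∫⁻ t, Φ x * E2 t f x ∂mdt := by
          apply lintegral_congr; intro x
          rw [lintegral_const_mul _ (by fun_prop)]; rfl
      _ = ∫⁻ t, ∫⁻ x, Φ x * E2 t f x ∂volume ∂mdt := by
          apply lintegral_lintegral_swap
          apply Measurable.aemeasurable
          unfold Function.uncurry
          fun_prop
      _ ≤ ∫⁻ t, C0 * (C1 * ∫⁻ x, ∫⁻ y, ENNReal.ofReal ((P t f y - P (t + 32 * t) f x) ^ 2 *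
            (P t w y + P (t + 32 * t) w x) ^ (-(1 / 2) : ℝ)) ∂(hm (32 * t) x) ∂volume) ∂mdt := by
          apply lintegral_mono_ae
          filter_upwards [ae_mdt_pos] with t ht
          calc _ ≤ ∫⁻ x, C0 * (Φ x * PE (2 * t) (Eb t f) x) := by
                refine lintegral_mono fun x => ?_
                refine (mul_le_mul_right (high_avg ht hf x) _).trans (le_of_eq ?_)
                rw [← hC0]; ring
            _ = C0 * ∫⁻ x, PE (2 * t) Φ x * Eb t f x := by
                rw [lintegral_const_mul _ (by fun_prop), PE_symm _ (by fun_prop) (by fun_prop)]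
            _ ≤ _ := by
                refine mul_le_mul_right ?_ _
                rw [← lintegral_const_mul]
                · exact lintegral_mono fun x => h1 f φ ε t x hf hφ hφ0 hε ht
                · apply measurable_lintegral_hm (by fun_prop) (by fun_prop)
                  unfold Function.uncurry
                  fun_prop
      _ = C0 * (C1 * ∫⁻ t, ∫⁻ x, ∫⁻ y, ENNReal.ofReal ((P t f y - P (t + 32 * t) f x) ^ 2 *
            (P t w y + P (t + 32 * t) w x) ^ (-(1 / 2) : ℝ)) ∂(hm (32 * t) x) ∂volume ∂mdt) := by
          rw [lintegral_const_mul' _ _ hC0t, lintegral_const_mul' _ _ hC1]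
      _ ≤ C0 * (C1 * (C2 * ∫⁻ x, ENNReal.ofReal (f x ^ 2 * w x ^ (-(1 / 2) : ℝ)))) := by
          gcongr
          exact h2 n f w _ hf hwB (by positivity) hwe
      _ = C0 * (C1 * (C2 * ∫⁻ x, (ENNReal.ofReal (f x ^ 2) * Mx Φ x +
            ENNReal.ofReal (f x ^ 2) * ENNReal.ofReal ε))) := by
          congr 3
          apply lintegral_congr; intro x
          have h4 : w x ^ (-(1 / 2) : ℝ) = (Mx Φ x).toReal + ε := by
            rw [hw]; simp only
            have := hmn x
            rw [← Real.rpow_mul (by linarith)]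
            norm_num
          rw [h4, ENNReal.ofReal_mul (sq_nonneg _), ENNReal.ofReal_add (hmn x) hε.le,
            ENNReal.ofReal_toReal (hfin x), mul_add]
      _ = _ := by
          rw [lintegral_add_left (by fun_prop), lintegral_mul_const _ (by fun_prop)]
          ring
  set a := ∫⁻ x, Φ x * S2 f x
  set b := C0 * (C1 * C2) * ∫⁻ x, ENNReal.ofReal (f x ^ 2) * Mx Φ x
  have hcf : C0 * (C1 * C2) * (∫⁻ x, ENNReal.ofReal (f x ^ 2)) ≠ ⊤ :=
    ENNReal.mul_ne_top (ENNReal.mul_ne_top hC0t (ENNReal.mul_ne_top hC1 hC2)) hJ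
  set c := C0 * (C1 * C2) * (∫⁻ x, ENNReal.ofReal (f x ^ 2))
  have htend : Tendsto (fun k : ℕ => b + c * ENNReal.ofReal (1 / ((k : ℝ) + 1))) atTop (𝓝 (b + c * 0)) := by
    apply Tendsto.const_add
    apply ENNReal.Tendsto.const_mul
    · rw [← ENNReal.ofReal_zero]
      exact ENNReal.tendsto_ofReal tendsto_one_div_add_atTop_nhds_zero_nat
    · right; exact hcf
  have := ge_of_tendsto' htend (fun k => key _ (by positivity))
  simpa using this

/-- division trick -/
lemma div_trick {A K I : ℝ≥0∞} {θ : ℝ} (hθ : 0 < θ) (hA : A ≠ ⊤)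
    (h : A ≤ K * I ^ θ * A ^ (1 - θ)) : A ≤ K ^ (1 / θ) * I := by
  by_cases h0 : A = 0
  · rw [h0]; exact zero_le
  have h1 : A ^ θ ≤ K * I ^ θ := by
    have hp0 : A ^ (1 - θ) ≠ 0 := by
      rw [Ne, ENNReal.rpow_eq_zero_iff]; tauto
    have hpt : A ^ (1 - θ) ≠ ⊤ := by
      rw [Ne, ENNReal.rpow_eq_top_iff]; tauto
    rw [← ENNReal.mul_le_mul_iff_left hp0 hpt, ← ENNReal.rpow_add _ _ h0 hA]
    simpa using h
  have h2 := ENNReal.rpow_le_rpow h1 (by positivity : 0 ≤ 1 / θ)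
  rw [ENNReal.mul_rpow_of_nonneg _ _ (by positivity), ← ENNReal.rpow_mul, ← ENNReal.rpow_mul,
    mul_one_div_cancel hθ.ne', ENNReal.rpow_one, ENNReal.rpow_one] at h2
  exact h2

lemma sq_high_cpt {n : ℕ} (hn : 0 < n) {q : ℝ} (hq : 2 < q) : ∃ C : ℝ≥0∞, C ≠ ⊤ ∧
    ∀ f : En n → ℝ, BM f → (∃ R : ℝ, ∀ x, R < ‖x‖ → f x = 0) →
      ∫⁻ x, S2 f x ^ (q / 2) ≤ C * ∫⁻ x, ENNReal.ofReal |f x| ^ q := by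
  obtain ⟨C1, hC1, h1⟩ := high_weighted (n := n)
  have hr : 1 < q / (q - 2) := by rw [lt_div_iff₀ (by linarith)]; linarith
  obtain ⟨C2, hC2, h2⟩ := strong_type hn hr
  have hθ : 0 < 2 / q := by positivity
  have hθ1 : 2 / q < 1 := by rw [div_lt_one (by linarith)]; exact hq
  refine ⟨(C1 * C2 ^ (1 - 2 / q)) ^ (1 / (2 / q)), by
    have : C2 ^ (1 - 2 / q) ≠ ⊤ := ENNReal.rpow_ne_top_of_nonneg (by linarith) hC2
    exact ENNReal.rpow_ne_top_of_nonneg (by positivity) (ENNReal.mul_ne_top hC1 this), ?_⟩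
  rintro f hf ⟨R, hR⟩
  have hfm := hf.1
  obtain ⟨M0, hM0, hM⟩ := hf.bd
  have hJ : ∫⁻ x, ENNReal.ofReal (f x ^ 2) ≠ ⊤ := by
    have : ∀ x, ENNReal.ofReal (f x ^ 2) ≤ (Metric.closedBall (0 : En n) R).indicator
        (fun _ => ENNReal.ofReal (M0 ^ 2)) x := by
      intro x
      by_cases hx : R < ‖x‖
      · rw [hR x hx]; simp
      · rw [Set.indicator_of_mem (by simpa using hx)]
        apply ENNReal.ofReal_le_ofReal
        rw [← sq_abs]
        have := hM x
        gcongr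
    refine ne_top_of_le_ne_top ?_ (lintegral_mono this)
    rw [lintegral_indicator_const measurableSet_closedBall]
    exact ENNReal.mul_ne_top ENNReal.ofReal_ne_top measure_closedBall_lt_top.ne
  set I := ∫⁻ x, ENNReal.ofReal |f x| ^ q with hI
  have key : ∀ N : ℕ, ∫⁻ x, (Metric.closedBall (0 : En n) N).indicator
      (fun x => (min (S2 f x) N) ^ (q / 2)) x ≤ (C1 * C2 ^ (1 - 2 / q)) ^ (1 / (2 / q)) * I := by
    intro N
    set A := ∫⁻ x, (Metric.closedBall (0 : En n) N).indicator
      (fun x => (min (S2 f x) N) ^ (q / 2)) x with hA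
    have hAt : A ≠ ⊤ := by
      have : ∀ x, (Metric.closedBall (0 : En n) N).indicator
        (fun x => (min (S2 f x) N) ^ (q / 2)) x ≤ (Metric.closedBall (0 : En n) N).indicator
          (fun x => (N : ℝ≥0∞) ^ (q / 2)) x := by
        intro x
        apply Set.indicator_le_indicator
        gcongr
        exact min_le_right _ _
      refine ne_top_of_le_ne_top ?_ (lintegral_mono this)
      rw [lintegral_indicator_const measurableSet_closedBall]
      refine ENNReal.mul_ne_top (ENNReal.rpow_ne_top_of_nonneg (by linarith) (by simp))
        measure_closedBall_lt_top.ne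
    apply div_trick hθ hAt
    set Φ : En n → ℝ≥0∞ := (Metric.closedBall (0 : En n) N).indicator
        (fun x => (min (S2 f x) N) ^ ((q - 2) / 2)) with hΦ
    have hΦm : Measurable Φ := Measurable.indicator (by fun_prop) measurableSet_closedBall
    have hΦb : ∀ x, Φ x ≤ (N : ℝ≥0∞) ^ ((q - 2) / 2) := by
      intro x
      refine (Set.indicator_le_self _ _ x).trans ?_
      have := min_le_right (S2 f x) (N : ℝ≥0∞)
      have : 0 ≤ (q - 2) / 2 := by linarith
      simp only
      gcongr
    have hNt : (N : ℝ≥0∞) ^ ((q - 2) / 2) ≠ ⊤ :=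
      ENNReal.rpow_ne_top_of_nonneg (by linarith) (by simp)
    have hΦt : ∀ x, Φ x ≠ ⊤ := fun x => ne_top_of_le_ne_top hNt (hΦb x)
    have hφ1 : (fun y => ENNReal.ofReal (Φ y).toReal) = Φ := by
      ext y; exact ENNReal.ofReal_toReal (hΦt y)
    have hbd : ∀ x, (Φ x).toReal ≤ ((N : ℝ≥0∞) ^ ((q - 2) / 2)).toReal := fun x =>
      ENNReal.toReal_mono hNt (hΦb x)
    have hφB : BM (fun y => (Φ y).toReal) := ⟨by fun_prop, _, fun x => by
      rw [abs_of_nonneg ENNReal.toReal_nonneg]; exact hbd x⟩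
    have a1 := h1 f _ hf hφB (fun _ => ENNReal.toReal_nonneg) hJ
    rw [hφ1] at a1
    have a2 := h2 (fun y => (Φ y).toReal) hφB.1 (fun _ => ENNReal.toReal_nonneg) ⟨_, hbd⟩
    rw [hφ1] at a2
    have a3 : ∀ x, ENNReal.ofReal (Φ x).toReal = Φ x := fun x => ENNReal.ofReal_toReal (hΦt x)
    simp only [a3] at a1 a2
    have a4 : ∫⁻ x, Φ x ^ (q / (q - 2)) = A := by
      rw [hA]
      apply lintegral_congr; intro x
      rw [hΦ]
      by_cases hx : x ∈ Metric.closedBall (0 : En n) N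
      · rw [Set.indicator_of_mem hx, Set.indicator_of_mem hx, ← ENNReal.rpow_mul]
        congr 1
        have : q - 2 ≠ 0 := by linarith
        field_simp
      · rw [Set.indicator_of_notMem hx, Set.indicator_of_notMem hx, ENNReal.zero_rpow_of_pos (by linarith)]
    rw [a4] at a2
    calc A ≤ ∫⁻ x, Φ x * S2 f x := by
          rw [hA]
          refine lintegral_mono fun x => ?_
          rw [hΦ]
          by_cases hx : x ∈ Metric.closedBall (0 : En n) N
          · rw [Set.indicator_of_mem hx, Set.indicator_of_mem hx]
            calc (min (S2 f x) N) ^ (q / 2) = (min (S2 f x) N) ^ ((q - 2) / 2) * (min (S2 f x) N) := by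
                  conv_rhs => rw [← ENNReal.rpow_one (min (S2 f x) N), ← ENNReal.rpow_mul]
                  rw [← ENNReal.rpow_add_of_nonneg _ _ (by linarith) (by norm_num)]
                  congr 1; ring
              _ ≤ _ := mul_le_mul_right (min_le_left _ _) _
          · rw [Set.indicator_of_notMem hx]; exact zero_le
      _ ≤ C1 * ∫⁻ x, ENNReal.ofReal (f x ^ 2) * Mx Φ x := a1
      _ = C1 * ∫⁻ x, (ENNReal.ofReal |f x| ^ q) ^ (2 / q) * (Mx Φ x ^ (q / (q - 2))) ^ (1 - 2 / q) := by
          congr 2; ext x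
          rw [← ENNReal.rpow_mul, ← ENNReal.rpow_mul]
          have : q - 2 ≠ 0 := by linarith
          rw [show q * (2 / q) = 2 by field_simp, show q / (q - 2) * (1 - 2 / q) = 1 by field_simp]
          rw [ENNReal.rpow_one, ENNReal.ofReal_rpow_of_nonneg (abs_nonneg _) (by norm_num)]
          norm_num
      _ ≤ C1 * (I ^ (2 / q) * (∫⁻ x, Mx Φ x ^ (q / (q - 2))) ^ (1 - 2 / q)) := by
          gcongr
          exact ENNReal.lintegral_mul_norm_pow_le (by fun_prop) (by fun_prop) hθ.le (by linarith) (by ring)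
      _ ≤ C1 * (I ^ (2 / q) * (C2 * A) ^ (1 - 2 / q)) := by
          gcongr
      _ = _ := by
          rw [ENNReal.mul_rpow_of_nonneg _ _ (by linarith)]; ring
  have htend : ∀ x, Tendsto (fun N : ℕ => (Metric.closedBall (0 : En n) N).indicator
      (fun x => (min (S2 f x) N) ^ (q / 2)) x) atTop (𝓝 (S2 f x ^ (q / 2))) := by
    intro x
    have e1 : ∀ᶠ N : ℕ in atTop, (min (S2 f x) N) ^ (q / 2) = (Metric.closedBall (0 : En n) N).indicator
      (fun x => (min (S2 f x) N) ^ (q / 2)) x := by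
      obtain ⟨N0, hN0⟩ := exists_nat_ge ‖x‖
      filter_upwards [eventually_ge_atTop N0] with N hN
      rw [Set.indicator_of_mem]
      simp only [Metric.mem_closedBall, dist_zero_right]
      exact hN0.trans (by exact_mod_cast hN)
    refine Tendsto.congr' e1 ?_
    apply (ENNReal.continuous_rpow_const.tendsto _).comp
    have := (tendsto_const_nhds (x := S2 f x)).min ENNReal.tendsto_nat_nhds_top
    simpa using this
  calc ∫⁻ x, S2 f x ^ (q / 2) = ∫⁻ x, liminf (fun N : ℕ => (Metric.closedBall (0 : En n) N).indicator
      (fun x => (min (S2 f x) N) ^ (q / 2)) x) atTop := lintegral_congr fun x => (htend x).liminf_eq.symm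
    _ ≤ liminf (fun N : ℕ => ∫⁻ x, (Metric.closedBall (0 : En n) N).indicator
      (fun x => (min (S2 f x) N) ^ (q / 2)) x) atTop :=
        lintegral_liminf_le (fun k => Measurable.indicator (by fun_prop) measurableSet_closedBall)
    _ ≤ _ := liminf_le_of_le (by isBoundedDefault) (fun b hb => by
        obtain ⟨k, hk⟩ := hb.exists
        exact hk.trans (key _))

/-- truncation -/
def trunc {n : ℕ} (f : En n → ℝ) (N : ℕ) : En n → ℝ := (Metric.closedBall (0 : En n) N).indicator f

lemma trunc_abs_le {n : ℕ} (f : En n → ℝ) (N : ℕ) (x : En n) : |trunc f N x| ≤ |f x| := by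
  unfold trunc
  by_cases hx : x ∈ Metric.closedBall (0 : En n) N
  · rw [Set.indicator_of_mem hx]
  · rw [Set.indicator_of_notMem hx]; simp

lemma trunc_tendsto {n : ℕ} (f : En n → ℝ) (x : En n) :
    Tendsto (fun N => trunc f N x) atTop (𝓝 (f x)) := by
  refine tendsto_const_nhds.congr' ?_
  obtain ⟨N0, hN0⟩ := exists_nat_ge ‖x‖
  filter_upwards [eventually_ge_atTop N0] with N hN
  unfold trunc
  rw [Set.indicator_of_mem]
  simp only [Metric.mem_closedBall, dist_zero_right]
  exact hN0.trans (by exact_mod_cast hN)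

lemma BM.trunc {n : ℕ} {f : En n → ℝ} (hf : BM f) (N : ℕ) : BM (trunc f N) :=
  ⟨hf.1.indicator measurableSet_closedBall, by
    obtain ⟨M, hM⟩ := hf.2
    exact ⟨M, fun x => (trunc_abs_le f N x).trans (hM x)⟩⟩

lemma trunc_supp {n : ℕ} (f : En n → ℝ) (N : ℕ) : ∃ R : ℝ, ∀ x, R < ‖x‖ → trunc f N x = 0 := by
  refine ⟨N, fun x hx => ?_⟩
  unfold trunc
  rw [Set.indicator_of_notMem]
  simpa using hx

lemma P_trunc_tendsto {n : ℕ} {f : En n → ℝ} (hf : BM f) (t : ℝ) (x : En n) :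
    Tendsto (fun N => P t (trunc f N) x) atTop (𝓝 (P t f x)) := by
  unfold P
  obtain ⟨M, hM0, hM⟩ := hf.bd
  apply tendsto_integral_of_dominated_convergence (fun _ => M)
  · intro N; exact (hf.trunc N).1.aestronglyMeasurable
  · exact integrable_const _
  · intro N
    exact Eventually.of_forall fun y => (trunc_abs_le f N y).trans (hM y)
  · exact Eventually.of_forall fun y => trunc_tendsto f y

lemma E2_trunc {n : ℕ} {f : En n → ℝ} (hf : BM f) (t : ℝ) (x : En n) :
    E2 t f x ≤ liminf (fun N => E2 t (trunc f N) x) atTop := by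
  unfold E2
  have hmt : ∀ N, Measurable (trunc f N) := fun N => (hf.trunc N).1
  calc _ = ∫⁻ y, liminf (fun N => ENNReal.ofReal ((P t (trunc f N) y - P (9 * t) (trunc f N) x) ^ 2)) atTop
        ∂(hm (8 * t) x) := by
        apply lintegral_congr; intro y
        refine (Tendsto.liminf_eq ?_).symm
        exact ENNReal.tendsto_ofReal (((P_trunc_tendsto hf t y).sub (P_trunc_tendsto hf _ x)).pow 2)
    _ ≤ _ := lintegral_liminf_le (fun N => by have := hmt N; fun_prop)

lemma S2_trunc {n : ℕ} {f : En n → ℝ} (hf : BM f) (x : En n) :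
    S2 f x ≤ liminf (fun N => S2 (trunc f N) x) atTop := by
  unfold S2
  have hmt : ∀ N, Measurable (trunc f N) := fun N => (hf.trunc N).1
  exact (lintegral_mono fun t => E2_trunc hf t x).trans
    (lintegral_liminf_le (fun N => by have := hmt N; fun_prop))

lemma sq_main {n : ℕ} (hn : 0 < n) {q : ℝ} (hq : 1 < q) : ∃ C : ℝ≥0∞, C ≠ ⊤ ∧
    ∀ f : En n → ℝ, BM f → ∫⁻ x, S2 f x ^ (q / 2) ≤ C * ∫⁻ x, ENNReal.ofReal |f x| ^ q := by
  rcases le_or_gt q 2 with h2 | h2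
  · exact sq_low hn hq h2
  obtain ⟨C, hC, h⟩ := sq_high_cpt hn h2
  refine ⟨C, hC, fun f hf => ?_⟩
  have hmt : ∀ N, Measurable (trunc f N) := fun N => (hf.trunc N).1
  calc ∫⁻ x, S2 f x ^ (q / 2) ≤ ∫⁻ x, liminf (fun N => S2 (trunc f N) x ^ (q / 2)) atTop := by
        refine lintegral_mono fun x => ?_
        have e1 : liminf (fun N => S2 (trunc f N) x ^ (q / 2)) atTop =
            (liminf (fun N => S2 (trunc f N) x) atTop) ^ (q / 2) :=
          (Monotone.map_liminf_of_continuousAt (f := fun a : ℝ≥0∞ => a ^ (q / 2))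
            (ENNReal.monotone_rpow_of_nonneg (by linarith)) _
            (ENNReal.continuous_rpow_const.continuousAt)).symm
        rw [e1]
        exact ENNReal.rpow_le_rpow (S2_trunc hf x) (by linarith)
    _ ≤ liminf (fun N => ∫⁻ x, S2 (trunc f N) x ^ (q / 2)) atTop :=
        lintegral_liminf_le (fun N => by have := hmt N; fun_prop)
    _ ≤ _ := liminf_le_of_le (by isBoundedDefault) (fun b hb => by
        obtain ⟨k, hk⟩ := hb.exists
        refine (hk.trans (h _ (hf.trunc k) (trunc_supp f k))).trans ?_
        refine mul_le_mul_right (lintegral_mono fun x => ?_) _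
        exact ENNReal.rpow_le_rpow (ENNReal.ofReal_le_ofReal (trunc_abs_le f k x)) (by linarith))

lemma P_pos_eq {n : ℕ} {t : ℝ} (ht : 0 < t) (f : En n → ℝ) (x : En n) :
    P t f x = ∫ y, hk t (x - y) * f y := integral_hm ht x f

lemma BM.int_hk {n : ℕ} {f : En n → ℝ} (hf : BM f) {t : ℝ} (ht : 0 < t) (x : En n) :
    Integrable (fun y => hk t (x - y) * f y) := by
  obtain ⟨M, hM0, hM⟩ := hf.bd
  have := (integrable_hk_sub ht x).mul_const M
  refine this.mono' (by have := hf.1; exact (by fun_prop : Measurable _).aestronglyMeasurable) ?_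
  refine Eventually.of_forall fun y => ?_
  rw [Real.norm_eq_abs, abs_mul, abs_of_pos (hk_pos ht _)]
  exact mul_le_mul_of_nonneg_left (hM y) (hk_pos ht _).le

/-- Lipschitz-type estimate for the heat semigroup. -/
lemma P_lip {n : ℕ} {t : ℝ} (ht : 0 < t) {k : En n → ℝ} (hk' : BM k) (y y' : En n) :
    |P t k y - P t k y'| ≤ (4 * 2 ^ ((n : ℝ) / 2)) * (‖y - y'‖ / √t) *
      (P (2 * t) (fun z => |k z|) y + P (2 * t) (fun z => |k z|) y') := by
  have h2t : 0 < 2 * t := by linarith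
  rw [P_pos_eq ht, P_pos_eq ht, P_pos_eq h2t, P_pos_eq h2t, ← integral_sub (hk'.int_hk ht y) (hk'.int_hk ht y'),
    ← integral_add (hk'.abs.int_hk h2t y) (hk'.abs.int_hk h2t y'), ← integral_const_mul]
  refine (abs_integral_le_integral_abs).trans (integral_mono ?_ ?_ ?_)
  · exact ((hk'.int_hk ht y).sub (hk'.int_hk ht y')).abs
  · exact ((hk'.abs.int_hk h2t y).add (hk'.abs.int_hk h2t y')).const_mul _
  · intro z
    simp only
    rw [← sub_mul, abs_mul]
    have := hk_diff ht (y - z) (y' - z)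
    rw [sub_sub_sub_cancel_right] at this
    calc _ ≤ _ := mul_le_mul_of_nonneg_right this (abs_nonneg _)
      _ = _ := by ring

lemma P_sq_le {n : ℕ} {t : ℝ} {k : En n → ℝ} (hk' : BM k) (y : En n) :
    ENNReal.ofReal ((P t k y) ^ 2) ≤ PE t (fun z => ENNReal.ofReal (k z ^ 2)) y := by
  have h2 : BM (fun z => k z ^ 2) := by simpa [pow_two] using hk'.mul hk'
  rw [PE_ofReal h2 (fun z => by positivity)]
  refine ENNReal.ofReal_le_ofReal ?_
  have hc : BM (fun z => (2 * P t k y) * k z - (P t k y) ^ 2) :=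
    ((BM.const (2 * P t k y)).mul hk').sub (BM.const _)
  have := P_mono hc h2 (fun z => by nlinarith [sq_nonneg (k z - P t k y)]) t y
  have e : P t (fun z => (2 * P t k y) * k z - (P t k y) ^ 2) y = (P t k y) ^ 2 := by
    rw [P_sub ((BM.const _).mul hk') (BM.const _), P_const]
    have : P t (fun z => (2 * P t k y) * k z) y = (2 * P t k y) * P t k y := by
      unfold P; rw [integral_const_mul]
    rw [this]; ring
  linarith

lemma P_shift {n : ℕ} {w : ℝ} (hw : 0 < w) {F : En n → ℝ} (hF : BM F) (m : ℝ) (y : En n) :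
    P w F y - m = P (w / 2) (fun z => P (w / 2) F z - m) y := by
  rw [P_sub (hF.P _) (BM.const _), P_const, P_semigroup (by linarith) (by linarith) hF, add_halves]

lemma sq_lip {n : ℕ} {w : ℝ} (hw : 0 < w) {F : En n → ℝ} (hF : BM F) (m : ℝ) (y y' : En n) :
    ENNReal.ofReal ((P w F y - P w F y') ^ 2) ≤
      ENNReal.ofReal (4 * (4 * 2 ^ ((n : ℝ) / 2)) ^ 2 * ‖y - y'‖ ^ 2 / w) *
      (PE w (fun z => ENNReal.ofReal ((P (w / 2) F z - m) ^ 2)) y +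
       PE w (fun z => ENNReal.ofReal ((P (w / 2) F z - m) ^ 2)) y') := by
  set k : En n → ℝ := fun z => P (w / 2) F z - m with hkd
  have hk' : BM k := (hF.P _).sub (BM.const _)
  have h1 := P_lip (half_pos hw) hk' y y'
  rw [← P_shift hw hF m y, ← P_shift hw hF m y', sub_sub_sub_cancel_right, mul_div_cancel₀ _ (two_ne_zero)] at h1
  have ha := P_sq_le (t := w) hk'.abs y
  have hb := P_sq_le (t := w) hk'.abs y'
  simp only [sq_abs] at ha hb
  refine le_trans ?_ (mul_le_mul_right (add_le_add ha hb) _)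
  rw [← ENNReal.ofReal_add (by positivity) (by positivity), ← ENNReal.ofReal_mul (by positivity)]
  refine ENNReal.ofReal_le_ofReal ?_
  set A := P w (fun z => |k z|) y
  set B := P w (fun z => |k z|) y'
  rw [← sq_abs]
  calc _ ≤ ((4 * 2 ^ ((n : ℝ) / 2)) * (‖y - y'‖ / √(w / 2)) * (A + B)) ^ 2 := by gcongr
    _ = 2 * (4 * 2 ^ ((n : ℝ) / 2)) ^ 2 * ‖y - y'‖ ^ 2 / w * (A + B) ^ 2 := by
        rw [mul_pow, mul_pow, div_pow, Real.sq_sqrt (by linarith)]; field_simp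
    _ ≤ 2 * (4 * 2 ^ ((n : ℝ) / 2)) ^ 2 * ‖y - y'‖ ^ 2 / w * (2 * (A ^ 2 + B ^ 2)) := by
        gcongr; nlinarith [sq_nonneg (A - B)]
    _ = _ := by ring

lemma lintegral_hm_sq {n : ℕ} {u : ℝ} (hu : 0 < u) (y : En n) {φ : En n → ℝ≥0∞} (hφ : Measurable φ) :
    ∫⁻ y', ENNReal.ofReal (‖y' - y‖ ^ 2) * φ y' ∂(hm u y) ≤
      ENNReal.ofReal ((2 * 2 ^ ((n : ℝ) / 2)) * u) * PE (2 * u) φ y := by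
  rw [lintegral_hm hu y (by fun_prop)]
  unfold PE
  rw [lintegral_hm (by linarith) y hφ, ← lintegral_const_mul _ (by fun_prop)]
  refine lintegral_mono fun z => ?_
  rw [← mul_assoc, ← mul_assoc, ← ENNReal.ofReal_mul (hk_pos hu _).le, ← ENNReal.ofReal_mul (by positivity)]
  refine mul_le_mul_left (ENNReal.ofReal_le_ofReal ?_) _
  have := sq_mul_hk_le hu (y - z)
  rw [norm_sub_rev z y]; linarith

lemma lintegral_hm_norm {n : ℕ} {u : ℝ} (hu : 0 < u) (y : En n) {φ : En n → ℝ≥0∞} (hφ : Measurable φ) :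
    ∫⁻ y', ENNReal.ofReal (‖y' - y‖) * φ y' ∂(hm u y) ≤
      ENNReal.ofReal ((3 * 2 ^ ((n : ℝ) / 2)) * √u) * PE (2 * u) φ y := by
  rw [lintegral_hm hu y (by fun_prop)]
  unfold PE
  rw [lintegral_hm (by linarith) y hφ, ← lintegral_const_mul _ (by fun_prop)]
  refine lintegral_mono fun z => ?_
  rw [← mul_assoc, ← mul_assoc, ← ENNReal.ofReal_mul (hk_pos hu _).le, ← ENNReal.ofReal_mul (by positivity)]
  refine mul_le_mul_left (ENNReal.ofReal_le_ofReal ?_) _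
  have := norm_mul_hk_le hu (y - z)
  rw [norm_sub_rev z y]; linarith

/-- basic variance comparison -/
lemma var_base (n : ℕ) : ∃ C : ℝ, 0 < C ∧ ∀ (F : En n → ℝ) (u w m : ℝ) (y : En n), BM F → 0 < u → 0 < w →
    ∫⁻ y', ENNReal.ofReal ((P w F y' - P w F y) ^ 2) ∂(hm u y) ≤
      ENNReal.ofReal (C * (u / w)) *
      (PE (2 * u + w) (fun z => ENNReal.ofReal ((P (w / 2) F z - m) ^ 2)) y +
       PE w (fun z => ENNReal.ofReal ((P (w / 2) F z - m) ^ 2)) y) := by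
  refine ⟨(4 * (4 * 2 ^ ((n : ℝ) / 2)) ^ 2) * (2 * 2 ^ ((n : ℝ) / 2)), by positivity, ?_⟩
  intro F u w m y hF hu hw
  set K : En n → ℝ≥0∞ := fun z => ENNReal.ofReal ((P (w / 2) F z - m) ^ 2) with hKd
  have hFm := hF.1
  have hK : Measurable K := by fun_prop
  set c := (4 * (4 * (2:ℝ) ^ ((n : ℝ) / 2)) ^ 2) with hc
  have hc0 : 0 < c := by positivity
  calc _ ≤ ∫⁻ y', ENNReal.ofReal (c / w) * (ENNReal.ofReal (‖y' - y‖ ^ 2) * (PE w K y' + PE w K y)) ∂(hm u y) := by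
        refine lintegral_mono fun y' => ?_
        refine (sq_lip hw hF m y' y).trans (le_of_eq ?_)
        rw [← mul_assoc, ← ENNReal.ofReal_mul (by positivity)]
        congr 2; ring
    _ = ENNReal.ofReal (c / w) * ∫⁻ y', ENNReal.ofReal (‖y' - y‖ ^ 2) * (PE w K y' + PE w K y) ∂(hm u y) :=
        lintegral_const_mul _ (by fun_prop)
    _ ≤ ENNReal.ofReal (c / w) * (ENNReal.ofReal ((2 * 2 ^ ((n : ℝ) / 2)) * u) *
        PE (2 * u) (fun y' => PE w K y' + PE w K y) y) :=
        mul_le_mul_right (lintegral_hm_sq hu y (by fun_prop)) _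
    _ = _ := by
        rw [← mul_assoc, ← ENNReal.ofReal_mul (by positivity)]
        congr 1
        · congr 1; ring
        · unfold PE
          rw [lintegral_add_right _ (by fun_prop), lintegral_const, measure_univ, mul_one]
          congr 1
          exact PE_semigroup (by linarith) hw.le hK y

lemma E2_eq_PE {n : ℕ} {w : ℝ} (F : En n → ℝ) (x : En n) :
    E2 (w / 2) F x = PE (4 * w) (fun z => ENNReal.ofReal ((P (w / 2) F z - P (9 * (w / 2)) F x) ^ 2)) x := by
  unfold E2 PE
  rw [show 8 * (w / 2) = 4 * w by ring]

lemma PE_le_E2 {n : ℕ} {w t : ℝ} (hw : 0 < w) (ht : w ≤ t) (ht' : t ≤ 4 * w) {F : En n → ℝ} (hF : BM F) (x : En n) :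
    PE t (fun z => ENNReal.ofReal ((P (w / 2) F z - P (9 * (w / 2)) F x) ^ 2)) x ≤
      ENNReal.ofReal (4 ^ ((n : ℝ) / 2)) * E2 (w / 2) F x := by
  have := hF.1
  rw [E2_eq_PE]
  refine (PE_le_PE (by linarith) ht' (by fun_prop) x).trans ?_
  refine mul_le_mul_left (ENNReal.ofReal_le_ofReal ?_) _
  have h0 : 0 < t := by linarith
  refine Real.rpow_le_rpow (by positivity) ?_ (by positivity)
  rw [div_le_iff₀ h0]; linarith

/-- (i) -/
lemma var_E2 (n : ℕ) : ∃ C : ℝ, 0 < C ∧ ∀ (F : En n → ℝ) (u w : ℝ) (y : En n), BM F → 0 < u → u ≤ w →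
    ∫⁻ y', ENNReal.ofReal ((P w F y' - P w F y) ^ 2) ∂(hm u y) ≤
      ENNReal.ofReal (C * (u / w)) * E2 (w / 2) F y := by
  obtain ⟨C, hC, h⟩ := var_base n
  refine ⟨C * (2 * 4 ^ ((n : ℝ) / 2)), by positivity, fun F u w y hF hu huw => ?_⟩
  have hw : 0 < w := by linarith
  refine (h F u w (P (9 * (w / 2)) F y) y hF hu hw).trans ?_
  refine (mul_le_mul_right (add_le_add (PE_le_E2 hw (by linarith) (by linarith) hF y)
    (PE_le_E2 hw le_rfl (by linarith) hF y)) _).trans (le_of_eq ?_)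
  rw [← two_mul, ← mul_assoc, ← mul_assoc, ← ENNReal.ofReal_ofNat 2, ← ENNReal.ofReal_mul (by positivity),
    ← ENNReal.ofReal_mul (by positivity)]
  congr 2; ring

/-- (ii) -/
lemma diff_E2 (n : ℕ) : ∃ C : ℝ, 0 < C ∧ ∀ (F : En n → ℝ) (u r : ℝ) (x : En n), BM F → 0 < u → u ≤ r →
    ∫⁻ y, ENNReal.ofReal ((P r F y - P (r + u) F y) ^ 2) ∂(hm r x) ≤
      ENNReal.ofReal (C * (u / r)) * E2 (r / 2) F x := by
  obtain ⟨C, hC, h⟩ := var_base n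
  refine ⟨C * (2 * 4 ^ ((n : ℝ) / 2)), by positivity, fun F u r x hF hu hur => ?_⟩
  have hr : 0 < r := by linarith
  have hFm := hF.1
  set m := P (9 * (r / 2)) F x with hmd
  set K : En n → ℝ≥0∞ := fun z => ENNReal.ofReal ((P (r / 2) F z - m) ^ 2) with hKd
  have hK : Measurable K := by fun_prop
  calc _ ≤ ∫⁻ y, ENNReal.ofReal (C * (u / r)) * (PE (2 * u + r) K y + PE r K y) ∂(hm r x) := by
        refine lintegral_mono fun y => ?_
        refine le_trans ?_ (h F u r m y hF hu hr)
        have := P_sq_le (t := u) ((hF.P r).sub (BM.const (P r F y))) y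
        rw [P_sub (hF.P _) (BM.const _), P_const, P_semigroup hu.le hr.le hF] at this
        refine le_trans (le_of_eq ?_) this
        congr 1; rw [add_comm u r]; ring
    _ = ENNReal.ofReal (C * (u / r)) * (PE (r + (2 * u + r)) K x + PE (r + r) K x) := by
        rw [lintegral_const_mul _ (by fun_prop), lintegral_add_right _ (by fun_prop),
          ← PE_semigroup hr.le (by linarith) hK, ← PE_semigroup hr.le hr.le hK]; rfl
    _ ≤ _ := mul_le_mul_right (add_le_add (PE_le_E2 hr (by linarith) (by linarith) hF x)
        (PE_le_E2 hr (by linarith) (by linarith) hF x)) _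
    _ = _ := by
      rw [← two_mul, ← mul_assoc, ← mul_assoc, ← ENNReal.ofReal_ofNat 2, ← ENNReal.ofReal_mul (by positivity),
        ← ENNReal.ofReal_mul (by positivity)]
      congr 2; ring

/-- (iii) -/
lemma diff_Mx (n : ℕ) : ∃ C : ℝ, 0 < C ∧ ∀ (F : En n → ℝ) (u v : ℝ) (x : En n), BM F → 0 < u → 0 < v →
    ENNReal.ofReal |P v F x - P (v + u) F x| ≤
      ENNReal.ofReal (C * min 1 √(u / v)) * Mx (fun y => ENNReal.ofReal |F y|) x := by
  refine ⟨(4 * 2 ^ ((n : ℝ) / 2)) * (3 * 2 ^ ((n : ℝ) / 2)) * (2 * 2 ^ ((n : ℝ) / 2)) , by positivity,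
    fun F u v x hF hu hv => ?_⟩
  have hFm := hF.1
  have hc1 : (1:ℝ) ≤ 2 ^ ((n : ℝ) / 2) := Real.one_le_rpow (by norm_num) (by positivity)
  set c : ℝ := 2 ^ ((n : ℝ) / 2) with hc
  set φ : En n → ℝ≥0∞ := fun y => ENNReal.ofReal |F y| with hφd
  have hφ : Measurable φ := by fun_prop
  have hPE : ∀ t, 0 < t → ∀ y, PE t φ y = ENNReal.ofReal (P t (fun z => |F z|) y) := fun t _ y =>
    PE_ofReal hF.abs (fun z => abs_nonneg _) t y
  have hab : ∀ t, 0 < t → ENNReal.ofReal |P t F x| ≤ ENNReal.ofReal c * Mx φ x := by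
    intro t ht
    refine le_trans ?_ (PE_le_Mx hφ ht x)
    have := enorm_P_le F t x
    simpa [← ofReal_norm_eq_enorm] using this
  have hvu : 0 < v + u := by linarith
  have b1 : ENNReal.ofReal |P v F x - P (v + u) F x| ≤ ENNReal.ofReal (2 * c) * Mx φ x := by
    calc _ ≤ ENNReal.ofReal (|P v F x| + |P (v + u) F x|) := ENNReal.ofReal_le_ofReal (abs_sub _ _)
      _ ≤ _ := by
        rw [ENNReal.ofReal_add (by positivity) (by positivity)]
        refine (add_le_add (hab v hv) (hab _ hvu)).trans (le_of_eq ?_)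
        rw [← two_mul, ← mul_assoc, ← ENNReal.ofReal_ofNat 2, ← ENNReal.ofReal_mul (by positivity)]
  have b2 : ENNReal.ofReal |P v F x - P (v + u) F x| ≤
      ENNReal.ofReal ((4 * c) * (3 * c) * (2 * c) * √(u / v)) * Mx φ x := by
    have e : P v F x - P (v + u) F x = - ∫ y, (P v F y - P v F x) ∂(hm u x) := by
      have := P_sub (hF.P v) (BM.const (P v F x)) u x
      rw [P_const, P_semigroup hu.le hv.le hF] at this
      unfold P at this ⊢
      rw [this, add_comm u v]; ring
    have hlip : ∀ y, ENNReal.ofReal |P v F y - P v F x| ≤ ENNReal.ofReal (4 * c / √v) *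
        (ENNReal.ofReal ‖y - x‖ * (PE (2 * v) φ y + PE (2 * v) φ x)) := by
      intro y
      rw [hPE _ (by linarith), hPE _ (by linarith)]
      have h0 : ∀ y, 0 ≤ P (2 * v) (fun z => |F z|) y := fun y => integral_nonneg fun z => abs_nonneg _
      rw [← ENNReal.ofReal_add (h0 _) (h0 _), ← ENNReal.ofReal_mul (by positivity), ← ENNReal.ofReal_mul (by positivity)]
      refine ENNReal.ofReal_le_ofReal ((P_lip hv hF y x).trans (le_of_eq ?_))
      ring
    rw [e, abs_neg, ← Real.norm_eq_abs, ofReal_norm_eq_enorm]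
    refine (enorm_integral_le_lintegral_enorm _).trans ?_
    calc _ ≤ ∫⁻ y, ENNReal.ofReal (4 * c / √v) *
        (ENNReal.ofReal ‖y - x‖ * (PE (2 * v) φ y + PE (2 * v) φ x)) ∂(hm u x) := by
          refine lintegral_mono fun y => ?_
          have := hlip y
          rwa [← Real.norm_eq_abs, ofReal_norm_eq_enorm] at this
      _ ≤ ENNReal.ofReal (4 * c / √v) * (ENNReal.ofReal ((3 * c) * √u) *
          PE (2 * u) (fun y => PE (2 * v) φ y + PE (2 * v) φ x) x) := by
          rw [lintegral_const_mul _ (by fun_prop)]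
          exact mul_le_mul_right (lintegral_hm_norm hu x (by fun_prop)) _
      _ = ENNReal.ofReal (4 * c / √v) * (ENNReal.ofReal ((3 * c) * √u) *
          (PE (2 * u + 2 * v) φ x + PE (2 * v) φ x)) := by
          congr 2
          rw [← PE_semigroup (by linarith) (by linarith) hφ]
          unfold PE
          rw [lintegral_add_right _ (by fun_prop), lintegral_const, measure_univ, mul_one]
      _ ≤ ENNReal.ofReal (4 * c / √v) * (ENNReal.ofReal ((3 * c) * √u) *
          (ENNReal.ofReal c * Mx φ x + ENNReal.ofReal c * Mx φ x)) := by
          refine mul_le_mul_right (mul_le_mul_right (add_le_add ?_ ?_) _) _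
          · exact PE_le_Mx hφ (by linarith) x
          · exact PE_le_Mx hφ (by linarith) x
      _ = _ := by
          rw [← two_mul, ← ENNReal.ofReal_ofNat 2]
          simp only [← mul_assoc]
          rw [← ENNReal.ofReal_mul (by positivity), ← ENNReal.ofReal_mul (by positivity),
            ← ENNReal.ofReal_mul (by positivity)]
          congr 2
          rw [Real.sqrt_div hu.le]; field_simp
  rcases le_total 1 √(u / v) with h | h
  · rw [min_eq_left h, mul_one]
    refine b1.trans (mul_le_mul_left (ENNReal.ofReal_le_ofReal ?_) _)
    nlinarith [mul_pos (show 0 < c by positivity) (show 0 < c by positivity),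
      mul_le_mul hc1 hc1 (by norm_num) (by positivity)]
  · rw [min_eq_right h]; exact b2

lemma cs_lintegral {α : Type*} [MeasurableSpace α] (μ : Measure α) {φ ψ : α → ℝ≥0∞}
    (hφ : Measurable φ) (hψ : Measurable ψ) :
    ∫⁻ y, φ y * ψ y ∂μ ≤ (∫⁻ y, φ y ^ 2 ∂μ) ^ (1 / 2 : ℝ) * (∫⁻ y, ψ y ^ 2 ∂μ) ^ (1 / 2 : ℝ) := by
  have := ENNReal.lintegral_mul_le_Lp_mul_Lq μ (p := 2) (q := 2) (by constructor <;> norm_num) hφ.aemeasurable hψ.aemeasurable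
  simpa using this

lemma mink {α β : Type*} [MeasurableSpace α] [MeasurableSpace β] (μ : Measure α) (ν : Measure β)
    [SFinite μ] [SFinite ν] {Z : β → α → ℝ≥0∞} (hZ : Measurable (Function.uncurry Z)) :
    (∫⁻ y, (∫⁻ v, Z v y ∂ν) ^ 2 ∂μ) ^ (1 / 2 : ℝ) ≤ ∫⁻ v, (∫⁻ y, Z v y ^ 2 ∂μ) ^ (1 / 2 : ℝ) ∂ν := by
  have hZ1 : ∀ v, Measurable (Z v) := fun v => hZ.of_uncurry_left
  have hZ2 : ∀ y, Measurable (fun v => Z v y) := fun y => hZ.of_uncurry_right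
  have hZ3 : Measurable (fun q : β × α => Z q.1 q.2) := hZ
  set N : β → ℝ≥0∞ := fun v => (∫⁻ y, Z v y ^ 2 ∂μ) ^ (1 / 2 : ℝ) with hN
  have hNm : Measurable N := by
    have : Measurable fun v => ∫⁻ y, Z v y ^ 2 ∂μ := (hZ3.pow_const 2).lintegral_prod_right'
    exact this.pow_const _
  have key : ∫⁻ y, (∫⁻ v, Z v y ∂ν) ^ 2 ∂μ ≤ (∫⁻ v, N v ∂ν) ^ 2 := by
    calc ∫⁻ y, (∫⁻ v, Z v y ∂ν) ^ 2 ∂μ = ∫⁻ y, ∫⁻ v, Z v y * ∫⁻ v', Z v' y ∂ν ∂ν ∂μ := by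
          refine lintegral_congr fun y => ?_
          rw [pow_two, lintegral_mul_const _ (hZ2 y)]
      _ = ∫⁻ v, ∫⁻ y, Z v y * ∫⁻ v', Z v' y ∂ν ∂μ ∂ν := by
          rw [lintegral_lintegral_swap]
          refine Measurable.aemeasurable ?_
          refine Measurable.mul (hZ3.comp measurable_swap) ?_
          have : Measurable fun y => ∫⁻ v', Z v' y ∂ν := (hZ3).lintegral_prod_left'
          exact this.comp measurable_fst
      _ = ∫⁻ v, ∫⁻ v', ∫⁻ y, Z v y * Z v' y ∂μ ∂ν ∂ν := by
          refine lintegral_congr fun v => ?_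
          rw [lintegral_lintegral_swap]
          · refine lintegral_congr fun y => ?_
            rw [lintegral_const_mul _ (hZ2 y)]
          · refine Measurable.aemeasurable ?_
            exact Measurable.mul ((hZ1 v).comp measurable_snd) hZ3
      _ ≤ ∫⁻ v, ∫⁻ v', N v * N v' ∂ν ∂ν :=
          lintegral_mono fun v => lintegral_mono fun v' => cs_lintegral μ (hZ1 v) (hZ1 v')
      _ = (∫⁻ v, N v ∂ν) ^ 2 := by
          simp_rw [lintegral_const_mul _ hNm]
          rw [lintegral_mul_const _ hNm, pow_two]
  calc _ ≤ ((∫⁻ v, N v ∂ν) ^ 2) ^ (1 / 2 : ℝ) := ENNReal.rpow_le_rpow key (by norm_num)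
    _ = _ := by rw [← ENNReal.rpow_natCast, ← ENNReal.rpow_mul]; norm_num

lemma mink_add {α : Type*} [MeasurableSpace α] (μ : Measure α) {φ ψ : α → ℝ≥0∞} (hφ : Measurable φ) (hψ : Measurable ψ) :
    (∫⁻ y, (φ y + ψ y) ^ 2 ∂μ) ^ (1 / 2 : ℝ) ≤ (∫⁻ y, φ y ^ 2 ∂μ) ^ (1 / 2 : ℝ) + (∫⁻ y, ψ y ^ 2 ∂μ) ^ (1 / 2 : ℝ) := by
  have := ENNReal.lintegral_Lp_add_le (μ := μ) (p := 2) hφ.aemeasurable hψ.aemeasurable (by norm_num)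
  simpa using this

/-- weight -/
def wt (a u : ℝ) : ℝ := min 1 √u * u ^ (-1 - a)

lemma wt_int {a : ℝ} (h0 : 0 < a) (h1 : a < 1 / 2) : ∫⁻ u in Set.Ioi 0, ENNReal.ofReal (wt a u) ≠ ⊤ := by
  have hm' : Measurable (wt a) := by unfold wt; fun_prop
  have hI : IntegrableOn (wt a) (Set.Ioi 0) := by
    rw [← Set.Ioc_union_Ioi_eq_Ioi (zero_le_one' ℝ)]
    refine IntegrableOn.union ?_ ?_
    · have : IntegrableOn (fun u : ℝ => u ^ (-1/2 - a)) (Set.Ioc 0 1) := by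
        rw [← intervalIntegrable_iff_integrableOn_Ioc_of_le zero_le_one]
        exact intervalIntegral.intervalIntegrable_rpow' (by linarith)
      refine Integrable.mono' this hm'.aestronglyMeasurable ?_
      refine (ae_restrict_mem measurableSet_Ioc).mono fun u hu => ?_
      have hu0 := hu.1
      rw [Real.norm_of_nonneg (by unfold wt; positivity)]
      unfold wt
      calc _ ≤ √u * u ^ (-1 - a) := by gcongr; exact min_le_right _ _
        _ = _ := by rw [Real.sqrt_eq_rpow, ← Real.rpow_add hu0]; congr 1; ring
    · have : IntegrableOn (fun u : ℝ => u ^ (-1 - a)) (Set.Ioi 1) :=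
        integrableOn_Ioi_rpow_of_lt (by linarith) one_pos
      refine Integrable.mono' this hm'.aestronglyMeasurable ?_
      refine (ae_restrict_mem measurableSet_Ioi).mono fun u hu => ?_
      have hu0 : (0:ℝ) < u := one_pos.trans hu
      rw [Real.norm_of_nonneg (by unfold wt; positivity)]
      unfold wt
      calc _ ≤ 1 * u ^ (-1 - a) := by gcongr; exact min_le_left _ _
        _ = _ := one_mul _
  exact hI.lintegral_lt_top.ne

@[fun_prop]
lemma measurable_wt (a : ℝ) : Measurable (wt a) := by unfold wt; fun_prop

lemma wt_scale {a v : ℝ} (hv : 0 < v) : ∫⁻ u in Set.Ioi 0, ENNReal.ofReal (min 1 √(u / v) * u ^ (-1 - a)) =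
    ENNReal.ofReal (v ^ (-a)) * ∫⁻ u in Set.Ioi 0, ENNReal.ofReal (wt a u) := by
  rw [lintegral_vol_scale (c := v) (by fun_prop) hv, ← lintegral_const_mul _ (by fun_prop), ← lintegral_const_mul _ (by fun_prop)]
  refine setLIntegral_congr_fun measurableSet_Ioi fun u hu => ?_
  have hu0 : 0 < u := hu
  rw [← ENNReal.ofReal_mul hv.le, ← ENNReal.ofReal_mul (by positivity)]
  congr 1
  unfold wt
  rw [mul_div_cancel_left₀ _ hv.ne', Real.mul_rpow hv.le hu0.le]
  have : v ^ (-a) = v * v ^ (-1 - a) := by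
    rw [show -a = 1 + (-1 - a) by ring, Real.rpow_add hv, Real.rpow_one]
  rw [this]; ring

lemma wt2_int {a : ℝ} (h0 : 0 < a) (h1 : a < 1 / 2) :
    ∫⁻ u in Set.Ioi 0, ENNReal.ofReal (u ^ (a - 1) * (1 + u) ^ (-(1 / 2) : ℝ)) ≠ ⊤ := by
  have hI : IntegrableOn (fun u : ℝ => u ^ (a - 1) * (1 + u) ^ (-(1 / 2) : ℝ)) (Set.Ioi 0) := by
    have hm' : Measurable (fun u : ℝ => u ^ (a - 1) * (1 + u) ^ (-(1 / 2) : ℝ)) := by fun_prop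
    rw [← Set.Ioc_union_Ioi_eq_Ioi (zero_le_one' ℝ)]
    refine IntegrableOn.union ?_ ?_
    · have : IntegrableOn (fun u : ℝ => u ^ (a - 1)) (Set.Ioc 0 1) := by
        rw [← intervalIntegrable_iff_integrableOn_Ioc_of_le zero_le_one]
        exact intervalIntegral.intervalIntegrable_rpow' (by linarith)
      refine Integrable.mono' this hm'.aestronglyMeasurable ?_
      refine (ae_restrict_mem measurableSet_Ioc).mono fun u hu => ?_
      have hu0 := hu.1
      rw [Real.norm_of_nonneg (by positivity)]
      have : (1 + u) ^ (-(1 / 2) : ℝ) ≤ 1 := Real.rpow_le_one_of_one_le_of_nonpos (by linarith) (by norm_num)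
      nlinarith [Real.rpow_pos_of_pos hu0 (a - 1)]
    · have : IntegrableOn (fun u : ℝ => u ^ (a - 1 - 1/2)) (Set.Ioi 1) :=
        integrableOn_Ioi_rpow_of_lt (by linarith) one_pos
      refine Integrable.mono' this hm'.aestronglyMeasurable ?_
      refine (ae_restrict_mem measurableSet_Ioi).mono fun u hu => ?_
      have hu0 : (0:ℝ) < u := one_pos.trans hu
      rw [Real.norm_of_nonneg (by positivity)]
      have : (1 + u) ^ (-(1 / 2) : ℝ) ≤ u ^ (-(1 / 2) : ℝ) :=
        Real.rpow_le_rpow_of_nonpos hu0 (by linarith) (by norm_num)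
      calc _ ≤ u ^ (a - 1) * u ^ (-(1 / 2) : ℝ) := by gcongr
        _ = _ := by rw [← Real.rpow_add hu0]; congr 1
  exact hI.lintegral_lt_top.ne

/-- variance of `P r g` under `hm r x` -/
def sg {n : ℕ} (r : ℝ) (g : En n → ℝ) (x : En n) : ℝ≥0∞ :=
  ∫⁻ y, ENNReal.ofReal ((P r g y - P (2 * r) g x) ^ 2) ∂(hm r x)

@[fun_prop]
lemma measurable_sg {n : ℕ} {α : Type*} [MeasurableSpace α] {T : α → ℝ} {X : α → En n}
    {f : En n → ℝ} (hf : Measurable f) (hT : Measurable T) (hX : Measurable X) :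
    Measurable fun a => sg (T a) f (X a) := by
  unfold sg
  refine measurable_lintegral_hm hT hX ?_
  unfold Function.uncurry
  fun_prop

lemma sg_le {n : ℕ} {r : ℝ} (hr : 0 ≤ r) {g : En n → ℝ} (hg : BM g) (x : En n) (a : ℝ) :
    sg r g x ≤ ∫⁻ y, ENNReal.ofReal ((P r g y - a) ^ 2) ∂(hm r x) := by
  have := variance_le (hm r x) (hg.P r) a
  have e : ∫ z, P r g z ∂(hm r x) = P (2 * r) g x := by
    rw [two_mul, ← P_semigroup hr hr hg]; rfl
  rw [e] at this
  exact this

lemma ofReal_sq_eq (a : ℝ) : ENNReal.ofReal (a ^ 2) = ENNReal.ofReal |a| ^ 2 := by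
  rw [← ENNReal.ofReal_pow (abs_nonneg _), sq_abs]

lemma sg_mink {n : ℕ} {r : ℝ} (hr : 0 ≤ r) {g : En n → ℝ} (hg : BM g) (x : En n) (a : ℝ)
    {β : Type*} [MeasurableSpace β] (ν : Measure β) [SFinite ν] {Z : β → En n → ℝ≥0∞}
    (hZ : Measurable (Function.uncurry Z)) (h : ∀ y, ENNReal.ofReal |P r g y - a| ≤ ∫⁻ v, Z v y ∂ν) :
    sg r g x ^ (1 / 2 : ℝ) ≤ ∫⁻ v, (∫⁻ y, Z v y ^ 2 ∂(hm r x)) ^ (1 / 2 : ℝ) ∂ν := by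
  refine le_trans (ENNReal.rpow_le_rpow ((sg_le hr hg x a).trans ?_) (by norm_num)) (mink (hm r x) ν hZ)
  refine lintegral_mono fun y => ?_
  rw [ofReal_sq_eq]
  exact pow_le_pow_left' (h y) 2

/-- final square function estimate -/
lemma sq_from_sg {n : ℕ} {F : En n → ℝ} (hF : BM F) {g : En n → ℝ} (hg : BM g) {γ : ℝ} {C : ℝ≥0∞}
    {w : ℝ → ℝ≥0∞} (hw : Measurable w) (x : En n)
    (h : ∀ r, 0 < r → sg r g x ^ (1 / 2 : ℝ) ≤ C * ENNReal.ofReal (r ^ γ) *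
      ∫⁻ y in Set.Ioi 0, w y * (E2 (r / 2) F x ^ (1 / 2 : ℝ) + E2 (r * (1 + y) / 2) F x ^ (1 / 2 : ℝ))) :
    ∫⁻ r, ENNReal.ofReal (r ^ (-(2 * γ))) * sg r g x ∂mdt ≤
      (C * (2 * ∫⁻ y in Set.Ioi 0, w y)) ^ 2 * S2 F x := by
  have hFm := hF.1
  have hgm := hg.1
  set Z : ℝ → ℝ → ℝ≥0∞ := fun y r => C * w y * (E2 (r / 2) F x ^ (1 / 2 : ℝ) + E2 (r * (1 + y) / 2) F x ^ (1 / 2 : ℝ)) with hZd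
  have hZ : Measurable (Function.uncurry Z) := by
    simp only [hZd, Function.uncurry_def]; fun_prop
  have h1 : ∫⁻ r, ENNReal.ofReal (r ^ (-(2 * γ))) * sg r g x ∂mdt ≤
      ∫⁻ r, (∫⁻ y in Set.Ioi 0, Z y r) ^ 2 ∂mdt := by
    refine lintegral_mono_ae (ae_mdt_pos.mono fun r hr => ?_)
    have e : sg r g x = (sg r g x ^ (1 / 2 : ℝ)) ^ 2 := by
      rw [← ENNReal.rpow_natCast, ← ENNReal.rpow_mul]; norm_num
    rw [e]
    refine (mul_le_mul_right (pow_le_pow_left' (h r hr) 2) _).trans (le_of_eq ?_)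
    simp only [hZd, mul_assoc]
    rw [lintegral_const_mul _ (by fun_prop)]
    have e2 : ENNReal.ofReal (r ^ (-(2 * γ))) * ENNReal.ofReal (r ^ γ) ^ 2 = 1 := by
      rw [← ENNReal.ofReal_pow (by positivity), ← ENNReal.ofReal_mul (by positivity), ← Real.rpow_natCast,
        ← Real.rpow_mul hr.le, ← Real.rpow_add hr]
      norm_num
      rw [show -(2 * γ) + γ * 2 = 0 by ring]; simp
    rw [mul_pow, mul_pow, mul_pow, mul_left_comm, ← mul_assoc (ENNReal.ofReal _), e2, one_mul]
  have h2 := mink mdt (volume.restrict (Set.Ioi (0:ℝ))) hZ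
  have h3 : ∀ y, 0 < y → (∫⁻ r, Z y r ^ 2 ∂mdt) ^ (1 / 2 : ℝ) ≤ C * w y * (2 * S2 F x ^ (1 / 2 : ℝ)) := by
    intro y hy
    have hs : ∀ c, 0 < c → ∫⁻ r, (E2 (c * r) F x ^ (1 / 2 : ℝ)) ^ 2 ∂mdt = S2 F x := by
      intro c hc
      have : ∀ r, (E2 (c * r) F x ^ (1 / 2 : ℝ)) ^ 2 = E2 (c * r) F x := by
        intro r; rw [← ENNReal.rpow_natCast, ← ENNReal.rpow_mul]; norm_num
      simp_rw [this]
      exact lintegral_mdt_scale (φ := fun r => E2 r F x) (by fun_prop) hc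
    have e1 : ∫⁻ r, Z y r ^ 2 ∂mdt = (C * w y) ^ 2 * ∫⁻ r, (E2 (1 / 2 * r) F x ^ (1 / 2 : ℝ) + E2 ((1 + y) / 2 * r) F x ^ (1 / 2 : ℝ)) ^ 2 ∂mdt := by
      rw [← lintegral_const_mul _ (by fun_prop)]
      refine lintegral_congr fun r => ?_
      simp only [hZd]; rw [mul_pow]
      congr 6 <;> ring
    rw [e1, ENNReal.mul_rpow_of_nonneg _ _ (by norm_num), ← ENNReal.rpow_natCast, ← ENNReal.rpow_mul]
    norm_num only [Nat.cast_ofNat]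
    rw [ENNReal.rpow_one]
    refine mul_le_mul_right ((mink_add mdt (by fun_prop) (by fun_prop)).trans ?_) _
    rw [hs _ (by norm_num), hs _ (by positivity), two_mul]
  have h4 : ∫⁻ y in Set.Ioi 0, (∫⁻ r, Z y r ^ 2 ∂mdt) ^ (1 / 2 : ℝ) ≤
      (C * (2 * ∫⁻ y in Set.Ioi 0, w y)) * S2 F x ^ (1 / 2 : ℝ) := by
    refine (setLIntegral_mono' measurableSet_Ioi h3).trans (le_of_eq ?_)
    rw [lintegral_mul_const _ (by fun_prop), lintegral_const_mul _ hw]; ring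
  have h5 := h2.trans h4
  calc _ ≤ _ := h1
    _ = ((∫⁻ r, (∫⁻ y in Set.Ioi 0, Z y r) ^ 2 ∂mdt) ^ (1 / 2 : ℝ)) ^ 2 := by
      rw [← ENNReal.rpow_natCast, ← ENNReal.rpow_mul]; norm_num
    _ ≤ _ := pow_le_pow_left' h5 2
    _ = _ := by
      rw [mul_pow]; congr 1
      rw [← ENNReal.rpow_natCast, ← ENNReal.rpow_mul]; norm_num

/-- decay hypotheses for the double integral lemma -/
structure Dec (C : ℝ) (φ : ℝ → ℝ) : Prop where
  meas : Measurable φ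
  bd : ∀ v, 0 ≤ v → |φ v| ≤ C
  dec : ∀ v, 0 < v → |φ v| ≤ C * v ^ (-(1/2) : ℝ)
  d1 : ∀ u v, 0 < u → 0 ≤ v → |φ v - φ (v + u)| ≤ C * min 1 √u
  d2 : ∀ u v, 0 < u → 0 < v → |φ v - φ (v + u)| ≤ C * min 1 √(u / v) * v ^ (-(1/2) : ℝ)

lemma Dec.C_nonneg {C : ℝ} {φ : ℝ → ℝ} (h : Dec C φ) : 0 ≤ C := (abs_nonneg _).trans (h.bd 0 le_rfl)

/-- the double integral is absolutely convergent -/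
lemma Dec.fin {C a : ℝ} {φ : ℝ → ℝ} (h : Dec C φ) (h0 : 0 < a) (h1 : a < 1 / 2) :
    ∫⁻ v in Set.Ioi 0, ∫⁻ u in Set.Ioi 0,
      ENNReal.ofReal (|φ v - φ (v + u)| * v ^ (a - 1) * u ^ (-1 - a)) ≠ ⊤ := by
  have hφ := h.meas
  have hC := h.C_nonneg
  set K := ∫⁻ u in Set.Ioi 0, ENNReal.ofReal (wt a u) with hK
  have hKt : K ≠ ⊤ := wt_int h0 h1
  have b1 : ∀ v, 0 < v → ∫⁻ u in Set.Ioi 0,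
      ENNReal.ofReal (|φ v - φ (v + u)| * v ^ (a - 1) * u ^ (-1 - a)) ≤
      ENNReal.ofReal (C * v ^ (a - 1)) * K := by
    intro v hv
    rw [hK, ← lintegral_const_mul _ (by fun_prop)]
    refine setLIntegral_mono' measurableSet_Ioi fun u (hu : 0 < u) => ?_
    rw [← ENNReal.ofReal_mul (by positivity)]
    refine ENNReal.ofReal_le_ofReal ?_
    unfold wt
    have := h.d1 u v hu hv.le
    calc _ ≤ (C * min 1 √u) * v ^ (a - 1) * u ^ (-1 - a) := by gcongr
      _ = _ := by ring
  have b2 : ∀ v, 0 < v → ∫⁻ u in Set.Ioi 0,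
      ENNReal.ofReal (|φ v - φ (v + u)| * v ^ (a - 1) * u ^ (-1 - a)) ≤
      ENNReal.ofReal (C * v ^ (-(3/2) : ℝ)) * K := by
    intro v hv
    have e : v ^ (-(3/2) : ℝ) = v ^ (-(1/2) : ℝ) * v ^ (a - 1) * v ^ (-a) := by
      rw [← Real.rpow_add hv, ← Real.rpow_add hv]; congr 1; ring
    rw [e, show C * (v ^ (-(1/2) : ℝ) * v ^ (a - 1) * v ^ (-a)) = (C * v ^ (-(1/2) : ℝ) * v ^ (a - 1)) * v ^ (-a) by ring,
      ENNReal.ofReal_mul (by positivity), mul_assoc, hK, ← wt_scale hv, ← lintegral_const_mul _ (by fun_prop)]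
    refine setLIntegral_mono' measurableSet_Ioi fun u (hu : 0 < u) => ?_
    rw [← ENNReal.ofReal_mul (by positivity)]
    refine ENNReal.ofReal_le_ofReal ?_
    have := h.d2 u v hu hv
    calc _ ≤ (C * min 1 √(u / v) * v ^ (-(1/2) : ℝ)) * v ^ (a - 1) * u ^ (-1 - a) := by gcongr
      _ = _ := by ring
  have I1 : IntegrableOn (fun u : ℝ => C * u ^ (a - 1)) (Set.Ioc 0 1) := by
    rw [← intervalIntegrable_iff_integrableOn_Ioc_of_le zero_le_one]
    exact (intervalIntegral.intervalIntegrable_rpow' (by linarith)).const_mul _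
  have I2 : IntegrableOn (fun u : ℝ => C * u ^ (-(3/2) : ℝ)) (Set.Ioi 1) :=
    (integrableOn_Ioi_rpow_of_lt (by norm_num) one_pos).const_mul _
  generalize hψ : (fun v : ℝ => ∫⁻ u in Set.Ioi (0:ℝ),
      ENNReal.ofReal (|φ v - φ (v + u)| * v ^ (a - 1) * u ^ (-1 - a))) = ψ at *
  have b1' : ∀ v, 0 < v → ψ v ≤ ENNReal.ofReal (C * v ^ (a - 1)) * K := by rw [← hψ]; exact b1
  have b2' : ∀ v, 0 < v → ψ v ≤ ENNReal.ofReal (C * v ^ (-(3/2) : ℝ)) * K := by rw [← hψ]; exact b2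
  rw [← Set.Ioc_union_Ioi_eq_Ioi (zero_le_one' ℝ)]
  refine ne_top_of_le_ne_top ?_ (lintegral_union_le _ _ _)
  refine ENNReal.add_ne_top.2 ⟨?_, ?_⟩
  · refine ne_top_of_le_ne_top ?_ (setLIntegral_mono' measurableSet_Ioc fun v hv => b1' v hv.1)
    rw [lintegral_mul_const _ (by fun_prop)]
    exact ENNReal.mul_ne_top I1.lintegral_lt_top.ne hKt
  · refine ne_top_of_le_ne_top ?_ (setLIntegral_mono' measurableSet_Ioi fun v (hv : 1 < v) => b2' v (one_pos.trans hv))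
    rw [lintegral_mul_const _ (by fun_prop)]
    exact ENNReal.mul_ne_top I2.lintegral_lt_top.ne hKt

lemma Dec.integrable {C a : ℝ} {φ : ℝ → ℝ} (h : Dec C φ) (h0 : 0 < a) (h1 : a < 1 / 2) :
    Integrable (fun q : ℝ × ℝ => (φ q.1 - φ (q.1 + q.2)) * q.1 ^ (a - 1) * q.2 ^ (-1 - a))
      ((volume.restrict (Set.Ioi 0)).prod (volume.restrict (Set.Ioi 0))) := by
  have hφ := h.meas
  have hme : Measurable (fun q : ℝ × ℝ => (φ q.1 - φ (q.1 + q.2)) * q.1 ^ (a - 1) * q.2 ^ (-1 - a)) := by fun_prop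
  refine ⟨hme.aestronglyMeasurable, ?_⟩
  unfold HasFiniteIntegral
  rw [lintegral_prod _ (by fun_prop)]
  refine lt_of_le_of_lt (le_of_eq ?_) (h.fin h0 h1).lt_top
  refine setLIntegral_congr_fun measurableSet_Ioi fun v (hv : 0 < v) => ?_
  refine setLIntegral_congr_fun measurableSet_Ioi fun u (hu : 0 < u) => ?_
  simp only
  rw [← ofReal_norm_eq_enorm, Real.norm_eq_abs, abs_mul, abs_mul, abs_of_pos (Real.rpow_pos_of_pos hv _),
    abs_of_pos (Real.rpow_pos_of_pos hu _)]

/-- scaled version -/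
lemma Dec.integrable' {C a : ℝ} {φ : ℝ → ℝ} (h : Dec C φ) (h0 : 0 < a) (h1 : a < 1 / 2) :
    Integrable (fun q : ℝ × ℝ => q.2 ^ (-1 - a) * (q.1⁻¹ * (φ (1 * q.1) - φ ((1 + q.2) * q.1))))
      ((volume.restrict (Set.Ioi 0)).prod (volume.restrict (Set.Ioi 0))) := by
  have hφ := h.meas
  have hme : Measurable (fun q : ℝ × ℝ => q.2 ^ (-1 - a) * (q.1⁻¹ * (φ (1 * q.1) - φ ((1 + q.2) * q.1)))) := by fun_prop
  refine ⟨hme.aestronglyMeasurable, ?_⟩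
  unfold HasFiniteIntegral
  rw [lintegral_prod _ (by fun_prop)]
  refine lt_of_le_of_lt (le_of_eq ?_) (h.fin h0 h1).lt_top
  refine setLIntegral_congr_fun measurableSet_Ioi fun v (hv : 0 < v) => ?_
  simp only
  rw [lintegral_vol_scale (c := v) (φ := fun u => ENNReal.ofReal (|φ v - φ (v + u)| * v ^ (a - 1) * u ^ (-1 - a))) (by fun_prop) hv,
    ← lintegral_const_mul _ (by fun_prop)]
  refine setLIntegral_congr_fun measurableSet_Ioi fun u (hu : 0 < u) => ?_
  rw [← ofReal_norm_eq_enorm, Real.norm_eq_abs, abs_mul, abs_mul, abs_of_pos (Real.rpow_pos_of_pos hu _),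
    abs_of_pos (inv_pos.2 hv), ← ENNReal.ofReal_mul hv.le, one_mul, show (1 + u) * v = v + v * u by ring,
    Real.mul_rpow hv.le hu.le]
  congr 1
  have : v * v ^ (a - 1) * v ^ (-1 - a) = v⁻¹ := by
    rw [mul_assoc, ← Real.rpow_add hv, show a - 1 + (-1 - a) = -2 by ring, Real.rpow_neg hv.le]
    norm_num; field_simp
  rw [← this]; ring

/-- constant -/
def Ca (a : ℝ) : ℝ := ∫ y in Set.Ioi 0, y ^ (-1 - a) * Real.log (1 + y)

lemma Ca_pos {a : ℝ} (h0 : 0 < a) (h1 : a < 1 / 2) : 0 < Ca a := by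
  have hm' : Measurable (fun y : ℝ => y ^ (-1 - a) * Real.log (1 + y)) := by fun_prop
  have hnn : ∀ y : ℝ, 0 < y → 0 < y ^ (-1 - a) * Real.log (1 + y) := fun y hy =>
    mul_pos (Real.rpow_pos_of_pos hy _) (Real.log_pos (by linarith))
  have hI : IntegrableOn (fun y : ℝ => y ^ (-1 - a) * Real.log (1 + y)) (Set.Ioi 0) := by
    rw [← Set.Ioc_union_Ioi_eq_Ioi (zero_le_one' ℝ)]
    refine IntegrableOn.union ?_ ?_
    · have : IntegrableOn (fun u : ℝ => u ^ (- a)) (Set.Ioc 0 1) := by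
        rw [← intervalIntegrable_iff_integrableOn_Ioc_of_le zero_le_one]
        exact intervalIntegral.intervalIntegrable_rpow' (by linarith)
      refine Integrable.mono' this hm'.aestronglyMeasurable ?_
      refine (ae_restrict_mem measurableSet_Ioc).mono fun u hu => ?_
      have hu0 := hu.1
      rw [Real.norm_of_nonneg (hnn u hu0).le]
      have : Real.log (1 + u) ≤ u := by
        have := Real.log_le_sub_one_of_pos (show 0 < 1 + u by linarith); linarith
      calc _ ≤ u ^ (-1 - a) * u := by gcongr
        _ = _ := by rw [← Real.rpow_add_one hu0.ne']; congr 1; ring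
    · have : IntegrableOn (fun u : ℝ => (2 ^ (a / 2) / (a / 2)) * u ^ (-1 - a / 2)) (Set.Ioi 1) :=
        (integrableOn_Ioi_rpow_of_lt (by linarith) one_pos).const_mul _
      refine Integrable.mono' this hm'.aestronglyMeasurable ?_
      refine (ae_restrict_mem measurableSet_Ioi).mono fun u (hu : 1 < u) => ?_
      have hu0 : (0:ℝ) < u := one_pos.trans hu
      rw [Real.norm_of_nonneg (hnn u hu0).le]
      have : Real.log (1 + u) ≤ (2 * u) ^ (a / 2) / (a / 2) :=
        (Real.log_le_log (by linarith) (by linarith)).trans (Real.log_le_rpow_div (by linarith) (by linarith))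
      calc _ ≤ u ^ (-1 - a) * ((2 * u) ^ (a / 2) / (a / 2)) := by gcongr
        _ = (2 ^ (a / 2) / (a / 2)) * (u ^ (-1 - a) * u ^ (a / 2)) := by
            rw [Real.mul_rpow (by norm_num) hu0.le]; ring
        _ = _ := by rw [← Real.rpow_add hu0]; congr 2; ring
  unfold Ca
  rw [setIntegral_pos_iff_support_of_nonneg_ae]
  · have : Function.support (fun y : ℝ => y ^ (-1 - a) * Real.log (1 + y)) ∩ Set.Ioi 0 = Set.Ioi 0 := by
      refine Set.inter_eq_right.2 fun y hy => (hnn y hy).ne'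
    rw [this]; simp
  · exact (ae_restrict_mem measurableSet_Ioi).mono fun u hu => (hnn u hu).le
  · exact hI

lemma Dec.evalEq {C a : ℝ} {φ : ℝ → ℝ} (h : Dec C φ) (h0 : 0 < a) (h1 : a < 1 / 2) :
    ∫ v in Set.Ioi 0, ∫ u in Set.Ioi 0, (φ v - φ (v + u)) * v ^ (a - 1) * u ^ (-1 - a) = Ca a * φ 0 := by
  have hφ := h.meas
  have hC := h.C_nonneg
  have hI := h.integrable' h0 h1
  calc _ = ∫ v in Set.Ioi 0, ∫ y in Set.Ioi 0, y ^ (-1 - a) * (v⁻¹ * (φ (1 * v) - φ ((1 + y) * v))) := by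
        refine setIntegral_congr_fun measurableSet_Ioi fun v (hv : 0 < v) => ?_
        have := integral_comp_mul_left_Ioi (fun u => (φ v - φ (v + u)) * v ^ (a - 1) * u ^ (-1 - a)) 0 hv
        rw [mul_zero, smul_eq_mul, eq_comm, inv_mul_eq_iff_eq_mul₀ hv.ne'] at this
        rw [this, ← integral_const_mul]
        refine setIntegral_congr_fun measurableSet_Ioi fun u (hu : 0 < u) => ?_
        rw [one_mul, show (1 + u) * v = v + v * u by ring, Real.mul_rpow hv.le hu.le]
        have : v * v ^ (a - 1) * v ^ (-1 - a) = v⁻¹ := by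
          rw [mul_assoc, ← Real.rpow_add hv, show a - 1 + (-1 - a) = -2 by ring, Real.rpow_neg hv.le]
          norm_num; field_simp
        rw [← this]; ring
    _ = ∫ y in Set.Ioi 0, ∫ v in Set.Ioi 0, y ^ (-1 - a) * (v⁻¹ * (φ (1 * v) - φ ((1 + y) * v))) :=
        integral_integral_swap hI
    _ = ∫ y in Set.Ioi 0, (y ^ (-1 - a) * Real.log (1 + y)) * φ 0 := by
        have hae := hI.prod_left_ae
        refine integral_congr_ae ?_
        filter_upwards [hae, ae_restrict_mem measurableSet_Ioi] with y hy (hy0 : 0 < y)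
        rw [integral_const_mul]
        have hinteg : IntegrableOn (fun v => v⁻¹ • (φ (1 * v) - φ ((1 + y) * v))) (Set.Ioi 0) := by
          have := hy.const_mul ((y ^ (-1 - a))⁻¹)
          refine this.congr (Eventually.of_forall fun v => ?_)
          simp only
          rw [← mul_assoc, inv_mul_cancel₀ (Real.rpow_pos_of_pos hy0 _).ne', one_mul, smul_eq_mul]
        have hloc : LocallyIntegrableOn φ (Set.Ioi 0) := by
          have : LocallyIntegrableOn ((Set.Ici 0).indicator φ) (Set.Ioi 0) := by
            refine LocallyIntegrable.locallyIntegrableOn ?_ _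
            refine (locallyIntegrable_const C).mono (hφ.indicator measurableSet_Ici).aestronglyMeasurable ?_
            refine Eventually.of_forall fun v => ?_
            rw [Real.norm_eq_abs, Real.norm_eq_abs, abs_of_nonneg hC]
            by_cases hv : v ∈ Set.Ici (0:ℝ)
            · rw [Set.indicator_of_mem hv]; exact h.bd v hv
            · rw [Set.indicator_of_notMem hv]; simpa using hC
          intro v hv
          obtain ⟨s, hs, hs'⟩ := this v hv
          refine ⟨s ∩ Set.Ioi 0, inter_mem hs self_mem_nhdsWithin, ?_⟩
          refine (hs'.mono_set Set.inter_subset_left).congr ?_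
          have hset : ∀ᵐ w ∂(volume.restrict (s ∩ Set.Ioi (0:ℝ))), w ∈ Set.Ioi (0:ℝ) := by
            refine ae_mono (Measure.restrict_mono Set.inter_subset_right le_rfl) (ae_restrict_mem measurableSet_Ioi)
          filter_upwards [hset] with w hw
          rw [Set.indicator_of_mem (Set.mem_Ici.2 (le_of_lt hw))]
        have hL : Tendsto φ (𝓝[>] 0) (𝓝 (φ 0)) := by
          rw [tendsto_iff_dist_tendsto_zero]
          have hs : Tendsto (fun u : ℝ => C * √u) (𝓝[>] 0) (𝓝 0) := by
            have : Continuous (fun u : ℝ => C * √u) := by fun_prop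
            simpa using (this.tendsto 0).mono_left nhdsWithin_le_nhds
          refine squeeze_zero' (Eventually.of_forall fun _ => dist_nonneg) ?_ hs
          filter_upwards [self_mem_nhdsWithin] with u (hu : 0 < u)
          have := h.d1 u 0 hu le_rfl
          rw [zero_add] at this
          rw [Real.dist_eq, abs_sub_comm]
          exact this.trans (mul_le_mul_of_nonneg_left (min_le_right _ _) hC)
        have hR : Tendsto φ atTop (𝓝 0) := by
          have hs : Tendsto (fun u : ℝ => C * u ^ (-(1/2) : ℝ)) atTop (𝓝 0) := by
            simpa using (tendsto_rpow_neg_atTop (show (0:ℝ) < 1/2 by norm_num)).const_mul C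
          refine squeeze_zero_norm' ?_ hs
          filter_upwards [eventually_gt_atTop 0] with v hv
          exact h.dec v hv
        have := Frullani.integral_Ioi_eq hloc one_pos (show 0 < 1 + y by linarith) hL hR hinteg
        simp only [smul_eq_mul, sub_zero, div_one] at this
        rw [this]; ring
    _ = _ := by rw [integral_mul_const]; rfl

lemma BM_int {n : ℕ} {K : ℝ → En n → ℝ} (hK : Measurable (Function.uncurry K)) {B : ℝ → ℝ}
    (hB : IntegrableOn B (Set.Ioi 0)) (h : ∀ u, 0 < u → ∀ x, |K u x| ≤ B u) :
    BM (fun x => ∫ u in Set.Ioi 0, K u x) := by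
  refine ⟨?_, ∫ u in Set.Ioi 0, B u, fun x => ?_⟩
  · have : StronglyMeasurable (fun q : En n × ℝ => K q.2 q.1) :=
      (hK.comp measurable_swap).stronglyMeasurable
    exact this.integral_prod_right'.measurable
  · rw [← Real.norm_eq_abs]; refine norm_integral_le_of_norm_le hB ?_
    exact (ae_restrict_mem measurableSet_Ioi).mono fun u hu => h u hu x

lemma P_int {n : ℕ} {K : ℝ → En n → ℝ} (hK : Measurable (Function.uncurry K)) {B : ℝ → ℝ}
    (hB : IntegrableOn B (Set.Ioi 0)) (h : ∀ u, 0 < u → ∀ x, |K u x| ≤ B u) (t : ℝ) (x : En n) :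
    P t (fun x => ∫ u in Set.Ioi 0, K u x) x = ∫ u in Set.Ioi 0, P t (K u) x := by
  unfold P
  refine integral_integral_swap ?_
  have hB' : Integrable (fun q : En n × ℝ => B q.2) ((hm t x).prod (volume.restrict (Set.Ioi 0))) :=
    hB.comp_snd (hm t x)
  refine hB'.mono' (hK.comp measurable_swap).aestronglyMeasurable ?_
  have : ∀ᵐ q : En n × ℝ ∂((hm t x).prod (volume.restrict (Set.Ioi 0))), 0 < q.2 := by
    have h0 := ae_restrict_mem (μ := (volume : Measure ℝ)) (measurableSet_Ioi (a := (0:ℝ)))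
    exact Measure.quasiMeasurePreserving_snd.ae h0
  exact this.mono fun q hq => h q.2 hq q.1

/-- nice functions: bounded, Lipschitz, integrable -/
structure Nice {n : ℕ} (f : En n → ℝ) : Prop where
  bm : BM f
  lip : ∃ L, 0 ≤ L ∧ ∀ x y, |f x - f y| ≤ L * ‖x - y‖
  int : Integrable f

lemma P_dist {n : ℕ} {f : En n → ℝ} (hf : BM f) {L : ℝ} (hL : 0 ≤ L) (h : ∀ x y, |f x - f y| ≤ L * ‖x - y‖)
    {u : ℝ} (hu : 0 < u) (x : En n) : |f x - P u f x| ≤ L * (3 * 2 ^ ((n : ℝ) / 2)) * √u := by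
  have e : f x - P u f x = - ∫ y, (f y - f x) ∂(hm u x) := by
    have := P_sub hf (BM.const (f x)) u x
    rw [P_const] at this
    unfold P at this ⊢
    rw [this]; ring
  rw [← ENNReal.ofReal_le_ofReal_iff (by positivity), e, abs_neg, ← Real.norm_eq_abs, ofReal_norm_eq_enorm]
  refine (enorm_integral_le_lintegral_enorm _).trans ?_
  calc _ ≤ ∫⁻ y, ENNReal.ofReal L * (ENNReal.ofReal ‖y - x‖ * 1) ∂(hm u x) := by
        refine lintegral_mono fun y => ?_
        rw [← ofReal_norm_eq_enorm, mul_one, ← ENNReal.ofReal_mul hL]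
        exact ENNReal.ofReal_le_ofReal (h y x)
    _ ≤ ENNReal.ofReal L * (ENNReal.ofReal ((3 * 2 ^ ((n : ℝ) / 2)) * √u) * PE (2 * u) (fun _ => 1) x) := by
        rw [lintegral_const_mul _ (by fun_prop)]
        exact mul_le_mul_right (lintegral_hm_norm hu x (by fun_prop)) _
    _ = _ := by
        rw [PE_const, mul_one, ← ENNReal.ofReal_mul hL]; congr 1; ring

lemma hk_le_rpow {n : ℕ} {t : ℝ} (ht : 0 < t) (z : En n) : hk t z ≤ t ^ (-(n : ℝ) / 2) := by
  unfold hk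
  have : Real.exp (-(π / t) * ‖z‖ ^ 2) ≤ 1 := by
    rw [Real.exp_le_one_iff]
    have : 0 ≤ π / t * ‖z‖ ^ 2 := by positivity
    linarith
  calc _ ≤ t ^ (-(n : ℝ) / 2) * 1 := by gcongr
    _ = _ := mul_one _

lemma P_decay {n : ℕ} (hn : 0 < n) {f : En n → ℝ} (hf : Nice f) : ∃ C, 0 ≤ C ∧ ∀ t, 0 < t → ∀ x,
    |P t f x| ≤ C * t ^ (-(1/2) : ℝ) := by
  obtain ⟨M, hM0, hM⟩ := hf.bm.bd
  have hI0 : 0 ≤ ∫ y, |f y| := integral_nonneg fun _ => abs_nonneg _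
  refine ⟨M + ∫ y, |f y|, by positivity, fun t ht x => ?_⟩
  rcases le_or_gt t 1 with h1 | h1
  · have h3 : 1 ≤ t ^ (-(1/2) : ℝ) := Real.one_le_rpow_of_pos_of_le_one_of_nonpos ht h1 (by norm_num)
    calc _ ≤ M := P_abs_le hM t x
      _ ≤ (M + ∫ y, |f y|) * 1 := by linarith
      _ ≤ _ := by gcongr
  · have h3 : t ^ (-(n : ℝ) / 2) ≤ t ^ (-(1/2) : ℝ) := by
      refine Real.rpow_le_rpow_of_exponent_le h1.le ?_
      have : (1:ℝ) ≤ n := by exact_mod_cast hn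
      linarith
    rw [P_pos_eq ht]
    calc _ ≤ ∫ y, |hk t (x - y) * f y| := abs_integral_le_integral_abs
      _ ≤ ∫ y, t ^ (-(1/2) : ℝ) * |f y| := by
        refine integral_mono (hf.bm.int_hk ht x).abs (hf.int.abs.const_mul _) fun y => ?_
        simp only
        rw [abs_mul, abs_of_pos (hk_pos ht _)]
        exact mul_le_mul_of_nonneg_right ((hk_le_rpow ht _).trans h3) (abs_nonneg _)
      _ = t ^ (-(1/2) : ℝ) * ∫ y, |f y| := integral_const_mul _ _
      _ ≤ _ := by nlinarith [Real.rpow_pos_of_pos ht (-(1/2))]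

lemma Nice.dec {n : ℕ} (hn : 0 < n) {f : En n → ℝ} (hf : Nice f) : ∃ C, 0 ≤ C ∧ ∀ r, 0 ≤ r → ∀ x,
    Dec C (fun w => P (r + w) f x) := by
  obtain ⟨M, hM0, hM⟩ := hf.bm.bd
  obtain ⟨L, hL0, hL⟩ := hf.lip
  obtain ⟨C1, hC1, h1⟩ := P_decay hn hf
  obtain ⟨C2, hC2, h2⟩ := diff_Mx n
  set c := L * (3 * 2 ^ ((n : ℝ) / 2)) with hc
  have hc0 : 0 ≤ c := by positivity
  have hfm := hf.bm.1
  refine ⟨2 * M + C1 + c + C2 * C1 * 2, by positivity, fun r hr x => ⟨by fun_prop, ?_, ?_, ?_, ?_⟩⟩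
  · intro v hv
    refine (P_abs_le hM _ x).trans ?_
    have : 0 ≤ C2 * C1 * 2 := by positivity
    linarith
  · intro v hv
    calc _ ≤ C1 * (r + v) ^ (-(1/2) : ℝ) := h1 _ (by linarith) x
      _ ≤ C1 * v ^ (-(1/2) : ℝ) := by
        gcongr C1 * ?_
        exact Real.rpow_le_rpow_of_nonpos hv (by linarith) (by norm_num)
      _ ≤ _ := by
        gcongr
        have : 0 ≤ C2 * C1 * 2 := by positivity
        linarith
  · intro u v hu hv
    have a1 : |P (r + v) f x - P (r + (v + u)) f x| ≤ 2 * M := by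
      have := abs_sub (P (r + v) f x) (P (r + (v + u)) f x)
      linarith [P_abs_le hM (r + v) x, P_abs_le hM (r + (v + u)) x]
    have a2 : |P (r + v) f x - P (r + (v + u)) f x| ≤ c * √u := by
      rw [← add_assoc, ← P_semigroup (by linarith) hu.le hf.bm, ← P_sub hf.bm (hf.bm.P u)]
      exact P_abs_le (fun y => P_dist hf.bm hL0 hL hu y) _ _
    have hpos : 0 ≤ C1 + C2 * C1 * 2 := by positivity
    rcases le_total 1 √u with h | h
    · rw [min_eq_left h]; linarith
    · rw [min_eq_right h]
      refine a2.trans ?_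
      gcongr; linarith
  · intro u v hu hv
    have hk' := hf.bm.P (r + v / 2)
    have a := h2 (P (r + v / 2) f) u (v / 2) x hk' hu (by linarith)
    rw [P_semigroup (by linarith) (by linarith) hf.bm, P_semigroup (by linarith) (by linarith) hf.bm,
      show v / 2 + (r + v / 2) = r + v by ring, show v / 2 + u + (r + v / 2) = r + (v + u) by ring] at a
    have hb : ∀ y, |P (r + v / 2) f y| ≤ C1 * (√2 * v ^ (-(1/2) : ℝ)) := by
      intro y
      refine (h1 _ (by linarith) y).trans ?_
      gcongr C1 * ?_
      calc (r + v / 2) ^ (-(1/2) : ℝ) ≤ (v / 2) ^ (-(1/2) : ℝ) :=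
            Real.rpow_le_rpow_of_nonpos (by linarith) (by linarith) (by norm_num)
        _ = _ := by
            rw [div_eq_mul_inv, Real.mul_rpow hv.le (by norm_num), Real.inv_rpow (by norm_num), ← Real.rpow_neg (by norm_num),
              neg_neg, Real.sqrt_eq_rpow, mul_comm]
    have b := a.trans (mul_le_mul_right (Mx_le_const (fun y => ENNReal.ofReal_le_ofReal (hb y)) x) _)
    rw [← ENNReal.ofReal_mul (by positivity), ENNReal.ofReal_le_ofReal_iff (by positivity)] at b
    refine b.trans ?_
    have hmin : min 1 √(u / (v / 2)) ≤ √2 * min 1 √(u / v) := by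
      have h2' : (1:ℝ) ≤ √2 := Real.one_le_sqrt.2 (by norm_num)
      rw [show u / (v / 2) = 2 * (u / v) by field_simp, Real.sqrt_mul (by norm_num),
        mul_min_of_nonneg _ _ (by positivity)]
      exact min_le_min (by linarith) le_rfl
    calc _ ≤ C2 * (√2 * min 1 √(u / v)) * (C1 * (√2 * v ^ (-(1/2) : ℝ))) := by gcongr
      _ = (C2 * C1 * (√2 * √2)) * min 1 √(u / v) * v ^ (-(1/2) : ℝ) := by ring
      _ = (C2 * C1 * 2) * min 1 √(u / v) * v ^ (-(1/2) : ℝ) := by rw [Real.mul_self_sqrt (by norm_num)]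
      _ ≤ _ := by gcongr; linarith

def G0 {n : ℕ} (a : ℝ) (g : En n → ℝ) (x : En n) : ℝ := ∫ u in Set.Ioi 0, (g x - P u g x) * u ^ (-1 - a)
def F0 {n : ℕ} (b : ℝ) (f : En n → ℝ) (x : En n) : ℝ := ∫ v in Set.Ioi 0, P v f x * v ^ (b - 1)

lemma wt_integrable {a : ℝ} (h0 : 0 < a) (h1 : a < 1 / 2) : IntegrableOn (wt a) (Set.Ioi 0) := by
  refine ⟨(measurable_wt a).aestronglyMeasurable, ?_⟩
  unfold HasFiniteIntegral
  refine lt_of_le_of_lt (le_of_eq ?_) (wt_int h0 h1).lt_top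
  refine setLIntegral_congr_fun measurableSet_Ioi fun u (hu : 0 < u) => ?_
  rw [← ofReal_norm_eq_enorm, Real.norm_of_nonneg (by unfold wt; positivity)]

lemma wt3_integrable {b : ℝ} (h0 : 0 < b) (h1 : b < 1 / 2) :
    IntegrableOn (fun v : ℝ => min 1 (v ^ (-(1/2) : ℝ)) * v ^ (b - 1)) (Set.Ioi 0) := by
  have hm' : Measurable (fun v : ℝ => min 1 (v ^ (-(1/2) : ℝ)) * v ^ (b - 1)) := by fun_prop
  rw [← Set.Ioc_union_Ioi_eq_Ioi (zero_le_one' ℝ)]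
  refine IntegrableOn.union ?_ ?_
  · have : IntegrableOn (fun u : ℝ => u ^ (b - 1)) (Set.Ioc 0 1) := by
      rw [← intervalIntegrable_iff_integrableOn_Ioc_of_le zero_le_one]
      exact intervalIntegral.intervalIntegrable_rpow' (by linarith)
    refine Integrable.mono' this hm'.aestronglyMeasurable ?_
    refine (ae_restrict_mem measurableSet_Ioc).mono fun u hu => ?_
    have hu0 := hu.1
    rw [Real.norm_of_nonneg (by positivity)]
    calc _ ≤ 1 * u ^ (b - 1) := by gcongr; exact min_le_left _ _
      _ = _ := one_mul _
  · have : IntegrableOn (fun u : ℝ => u ^ (-(1/2) + (b - 1))) (Set.Ioi 1) :=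
      integrableOn_Ioi_rpow_of_lt (by linarith) one_pos
    refine Integrable.mono' this hm'.aestronglyMeasurable ?_
    refine (ae_restrict_mem measurableSet_Ioi).mono fun u (hu : 1 < u) => ?_
    have hu0 : (0:ℝ) < u := one_pos.trans hu
    rw [Real.norm_of_nonneg (by positivity)]
    calc _ ≤ u ^ (-(1/2) : ℝ) * u ^ (b - 1) := by gcongr; exact min_le_right _ _
      _ = _ := by rw [← Real.rpow_add hu0]

section
variable {n : ℕ} {g : En n → ℝ} {a : ℝ}

lemma G0_bound (hn : 0 < n) (hg : Nice g) : ∃ C, 0 ≤ C ∧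
    ∀ u, 0 < u → ∀ x, |(g x - P u g x) * u ^ (-1 - a)| ≤ C * wt a u := by
  obtain ⟨C, hC, h⟩ := hg.dec hn
  refine ⟨C, hC, fun u hu x => ?_⟩
  have := (h 0 le_rfl x).d1 u 0 hu le_rfl
  simp only [zero_add, P_zero] at this
  unfold wt
  rw [abs_mul, abs_of_pos (Real.rpow_pos_of_pos hu _), ← mul_assoc]
  gcongr

lemma G0_BM (hn : 0 < n) (hg : Nice g) (h0 : 0 < a) (h1 : a < 1 / 2) : BM (G0 a g) := by
  obtain ⟨C, hC, h⟩ := G0_bound (a := a) hn hg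
  have := hg.bm.1
  exact BM_int (K := fun u x => (g x - P u g x) * u ^ (-1 - a)) (by unfold Function.uncurry; fun_prop)
    ((wt_integrable h0 h1).const_mul C) h

lemma P_G0 (hn : 0 < n) (hg : Nice g) (h0 : 0 < a) (h1 : a < 1 / 2) {t : ℝ} (ht : 0 ≤ t) (x : En n) :
    P t (G0 a g) x = ∫ u in Set.Ioi 0, (P t g x - P (t + u) g x) * u ^ (-1 - a) := by
  obtain ⟨C, hC, h⟩ := G0_bound (a := a) hn hg
  have := hg.bm.1
  have e := P_int (K := fun u x => (g x - P u g x) * u ^ (-1 - a)) (by unfold Function.uncurry; fun_prop)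
    ((wt_integrable h0 h1).const_mul C) h t x
  refine e.trans (setIntegral_congr_fun measurableSet_Ioi fun u (hu : 0 < u) => ?_)
  rw [← P_semigroup ht hu.le hg.bm, ← P_sub hg.bm (hg.bm.P u)]
  unfold P
  rw [integral_mul_const]

lemma F0_bound (hn : 0 < n) (hg : Nice g) : ∃ C, 0 ≤ C ∧
    ∀ u, 0 < u → ∀ x, |P u g x * u ^ (a - 1)| ≤ C * (min 1 (u ^ (-(1/2) : ℝ)) * u ^ (a - 1)) := by
  obtain ⟨C, hC, h⟩ := hg.dec hn
  refine ⟨C, hC, fun u hu x => ?_⟩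
  have i1 := (h 0 le_rfl x).bd u hu.le
  have i2 := (h 0 le_rfl x).dec u hu
  simp only [zero_add] at i1 i2
  rw [abs_mul, abs_of_pos (Real.rpow_pos_of_pos hu _), ← mul_assoc]
  gcongr
  rw [mul_min_of_nonneg _ _ hC, mul_one]
  exact le_min i1 i2

lemma F0_BM (hn : 0 < n) (hg : Nice g) (h0 : 0 < a) (h1 : a < 1 / 2) : BM (F0 a g) := by
  obtain ⟨C, hC, h⟩ := F0_bound (a := a) hn hg
  have := hg.bm.1
  exact BM_int (K := fun u x => P u g x * u ^ (a - 1)) (by unfold Function.uncurry; fun_prop)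
    ((wt3_integrable h0 h1).const_mul C) h

lemma P_F0 (hn : 0 < n) (hg : Nice g) (h0 : 0 < a) (h1 : a < 1 / 2) {t : ℝ} (ht : 0 ≤ t) (x : En n) :
    P t (F0 a g) x = ∫ u in Set.Ioi 0, P (t + u) g x * u ^ (a - 1) ∧
    IntegrableOn (fun u => P (t + u) g x * u ^ (a - 1)) (Set.Ioi 0) := by
  obtain ⟨C, hC, h⟩ := F0_bound (a := a) hn hg
  have := hg.bm.1
  have e := P_int (K := fun u x => P u g x * u ^ (a - 1)) (by unfold Function.uncurry; fun_prop)
    ((wt3_integrable h0 h1).const_mul C) h t x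
  constructor
  · refine e.trans (setIntegral_congr_fun measurableSet_Ioi fun u (hu : 0 < u) => ?_)
    rw [← P_semigroup ht hu.le hg.bm]
    unfold P
    rw [integral_mul_const]
  · obtain ⟨C, hC, h⟩ := hg.dec hn
    refine Integrable.mono' ((wt3_integrable h0 h1).const_mul C)
      (by fun_prop : Measurable fun u => P (t + u) g x * u ^ (a - 1)).aestronglyMeasurable ?_
    refine (ae_restrict_mem measurableSet_Ioi).mono fun u (hu : 0 < u) => ?_
    have i1 := (h t ht x).bd u hu.le
    have i2 := (h t ht x).dec u hu
    rw [Real.norm_eq_abs, abs_mul, abs_of_pos (Real.rpow_pos_of_pos hu _), ← mul_assoc]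
    gcongr
    rw [mul_min_of_nonneg _ _ hC, mul_one]
    exact le_min i1 i2

lemma repr_A (hn : 0 < n) (hg : Nice g) (h0 : 0 < a) (h1 : a < 1 / 2) {r : ℝ} (hr : 0 ≤ r) (y : En n) :
    Ca a * P r g y = ∫ v in Set.Ioi 0, P (r + v) (G0 a g) y * v ^ (a - 1) ∧
    IntegrableOn (fun v => P (r + v) (G0 a g) y * v ^ (a - 1)) (Set.Ioi 0) := by
  obtain ⟨C, hC, h⟩ := hg.dec hn
  have e := (h r hr y).evalEq h0 h1
  have i := ((h r hr y).integrable h0 h1).integral_prod_left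
  simp only [add_zero] at e
  have key : ∀ v, 0 < v → ∫ u in Set.Ioi 0, (P (r + v) g y - P (r + (v + u)) g y) * v ^ (a - 1) * u ^ (-1 - a) =
      P (r + v) (G0 a g) y * v ^ (a - 1) := by
    intro v hv
    rw [P_G0 hn hg h0 h1 (by linarith), ← integral_mul_const]
    refine setIntegral_congr_fun measurableSet_Ioi fun u (hu : 0 < u) => ?_
    rw [add_assoc]; ring
  constructor
  · rw [← e]
    exact setIntegral_congr_fun measurableSet_Ioi fun v hv => key v hv
  · refine Integrable.congr i ?_
    exact (ae_restrict_mem measurableSet_Ioi).mono fun v hv => key v hv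

lemma repr_B (hn : 0 < n) (hg : Nice g) (h0 : 0 < a) (h1 : a < 1 / 2) {r : ℝ} (hr : 0 ≤ r) (y : En n) :
    Ca a * P r g y = ∫ u in Set.Ioi 0, (P r (F0 a g) y - P (r + u) (F0 a g) y) * u ^ (-1 - a) ∧
    IntegrableOn (fun u => (P r (F0 a g) y - P (r + u) (F0 a g) y) * u ^ (-1 - a)) (Set.Ioi 0) := by
  obtain ⟨C, hC, h⟩ := hg.dec hn
  have e := (h r hr y).evalEq h0 h1
  have i0 := (h r hr y).integrable h0 h1
  have i := i0.swap.integral_prod_left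
  rw [integral_integral_swap i0] at e
  simp only [add_zero] at e
  have key : ∀ u, 0 < u → ∫ v in Set.Ioi 0, (P (r + v) g y - P (r + (v + u)) g y) * v ^ (a - 1) * u ^ (-1 - a) =
      (P r (F0 a g) y - P (r + u) (F0 a g) y) * u ^ (-1 - a) := by
    intro u hu
    obtain ⟨p1, p2⟩ := P_F0 hn hg h0 h1 hr y
    obtain ⟨p3, p4⟩ := P_F0 hn hg h0 h1 (show 0 ≤ r + u by linarith) y
    rw [p1, p3, ← integral_sub p2 p4, ← integral_mul_const]
    refine setIntegral_congr_fun measurableSet_Ioi fun v (hv : 0 < v) => ?_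
    rw [show r + u + v = r + (v + u) by ring]; ring
  constructor
  · rw [← e]
    exact setIntegral_congr_fun measurableSet_Ioi fun v hv => key v hv
  · refine Integrable.congr i ?_
    exact (ae_restrict_mem measurableSet_Ioi).mono fun v hv => key v hv

end

lemma sqrt_const {α : Type*} [MeasurableSpace α] (μ : Measure α) {c : ℝ} (hc : 0 ≤ c) {D : α → ℝ} (hD : Measurable D) :
    (∫⁻ y, (ENNReal.ofReal (c * |D y|)) ^ 2 ∂μ) ^ (1 / 2 : ℝ) =
      ENNReal.ofReal c * (∫⁻ y, ENNReal.ofReal (D y ^ 2) ∂μ) ^ (1 / 2 : ℝ) := by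
  have : ∀ y, (ENNReal.ofReal (c * |D y|)) ^ 2 = ENNReal.ofReal c ^ 2 * ENNReal.ofReal (D y ^ 2) := fun y => by
    rw [ENNReal.ofReal_mul hc, mul_pow, ← ofReal_sq_eq]
  simp_rw [this]
  rw [lintegral_const_mul _ (by fun_prop), ENNReal.mul_rpow_of_nonneg _ _ (by norm_num), ← ENNReal.rpow_natCast,
    ← ENNReal.rpow_mul]
  norm_num

lemma sqrt_mul_E {c : ℝ} (hc : 0 ≤ c) (E : ℝ≥0∞) :
    (ENNReal.ofReal c * E) ^ (1 / 2 : ℝ) = ENNReal.ofReal √c * E ^ (1 / 2 : ℝ) := by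
  rw [ENNReal.mul_rpow_of_nonneg _ _ (by norm_num), ENNReal.ofReal_rpow_of_nonneg hc (by norm_num), Real.sqrt_eq_rpow]

lemma Sh_bound (n : ℕ) : ∃ C : ℝ≥0∞, C ≠ ⊤ ∧ ∀ h : En n → ℝ, BM h → ∀ x,
    ∫⁻ r, sg r h x ∂mdt ≤ C * S2 h x := by
  obtain ⟨C, hC, hv⟩ := var_E2 n
  refine ⟨ENNReal.ofReal C, ENNReal.ofReal_ne_top, fun h hh x => ?_⟩
  have hhm := hh.1
  calc _ ≤ ∫⁻ r, ENNReal.ofReal C * E2 (1 / 2 * r) h x ∂mdt := by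
        refine lintegral_mono_ae (ae_mdt_pos.mono fun r hr => ?_)
        refine ((sg_le hr.le hh x _).trans (hv h r r x hh hr le_rfl)).trans (le_of_eq ?_)
        rw [div_self hr.ne', mul_one, show r / 2 = 1 / 2 * r by ring]
    _ = _ := by
        rw [lintegral_const_mul _ (by fun_prop), lintegral_mdt_scale (φ := fun r => E2 r h x) (by fun_prop) (by norm_num)]
        rfl

lemma Sg_bound {n : ℕ} (hn : 0 < n) {a : ℝ} (h0 : 0 < a) (h1 : a < 1 / 2) : ∃ C : ℝ≥0∞, C ≠ ⊤ ∧
    ∀ g : En n → ℝ, Nice g → ∀ x,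
    ∫⁻ r, ENNReal.ofReal (r ^ (-(2 * a))) * sg r g x ∂mdt ≤ C * S2 (G0 a g) x := by
  obtain ⟨C, hC, hv⟩ := var_E2 n
  have hCa := Ca_pos h0 h1
  set w : ℝ → ℝ≥0∞ := fun u => ENNReal.ofReal (u ^ (a - 1) * (1 + u) ^ (-(1 / 2) : ℝ)) with hw
  set c : ℝ := (Ca a)⁻¹ with hc
  have hc0 : 0 < c := inv_pos.2 hCa
  refine ⟨(ENNReal.ofReal (c * √C) * (2 * ∫⁻ y in Set.Ioi 0, w y)) ^ 2,
    ENNReal.pow_ne_top (ENNReal.mul_ne_top ENNReal.ofReal_ne_top (ENNReal.mul_ne_top (by norm_num) (wt2_int h0 h1))),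
    fun g hg x => ?_⟩
  have hG := G0_BM hn hg h0 h1
  have hGm := hG.1
  have hgm := hg.bm.1
  refine sq_from_sg hG hg.bm (by fun_prop) x fun r hr => ?_
  set D : ℝ → En n → ℝ := fun v y => P (r + v) (G0 a g) y - P (r + v) (G0 a g) x with hD
  have hDm : ∀ v, Measurable (D v) := fun v => by simp only [hD]; fun_prop
  set Z : ℝ → En n → ℝ≥0∞ := fun v y => ENNReal.ofReal (c * v ^ (a - 1) * |D v y|) with hZ
  have hZm : Measurable (Function.uncurry Z) := by
    simp only [hZ, hD, Function.uncurry_def]; fun_prop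
  have hmain : ∀ y, ENNReal.ofReal |P r g y - P r g x| ≤ ∫⁻ v in Set.Ioi 0, Z v y := by
    intro y
    obtain ⟨p1, p2⟩ := repr_A hn hg h0 h1 hr.le y
    obtain ⟨p3, p4⟩ := repr_A hn hg h0 h1 hr.le x
    have e : P r g y - P r g x = ∫ v in Set.Ioi 0, c * (D v y * v ^ (a - 1)) := by
      rw [integral_const_mul]
      have : ∫ v in Set.Ioi 0, D v y * v ^ (a - 1) = Ca a * P r g y - Ca a * P r g x := by
        rw [p1, p3, ← integral_sub p2 p4]
        refine integral_congr_ae (Eventually.of_forall fun v => ?_)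
        simp only [hD]; ring
      rw [this, hc]; field_simp
    rw [e, ← Real.norm_eq_abs, ofReal_norm_eq_enorm]
    refine (enorm_integral_le_lintegral_enorm _).trans ?_
    refine setLIntegral_mono' measurableSet_Ioi fun v (hv : 0 < v) => ?_
    rw [← ofReal_norm_eq_enorm, Real.norm_eq_abs, abs_mul, abs_mul, abs_of_pos hc0, abs_of_pos (Real.rpow_pos_of_pos hv _)]
    exact ENNReal.ofReal_le_ofReal (le_of_eq (by ring))
  refine (sg_mink hr.le hg.bm x _ (volume.restrict (Set.Ioi 0)) hZm hmain).trans ?_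
  calc _ ≤ ∫⁻ v in Set.Ioi 0, ENNReal.ofReal (c * v ^ (a - 1) * √(C * (r / (r + v)))) * E2 ((r + v) / 2) (G0 a g) x ^ (1 / 2 : ℝ) := by
        refine setLIntegral_mono' measurableSet_Ioi fun v (hv0 : 0 < v) => ?_
        simp only [hZ]
        rw [sqrt_const _ (by positivity) (hDm v), ENNReal.ofReal_mul (p := c * v ^ (a - 1)) (q := √(C * (r / (r + v)))) (by positivity), mul_assoc]
        refine mul_le_mul_right ?_ _
        rw [← sqrt_mul_E (by positivity)]
        exact ENNReal.rpow_le_rpow (hv (G0 a g) r (r + v) x hG hr (by linarith)) (by norm_num)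
    _ = ENNReal.ofReal r * ∫⁻ y in Set.Ioi 0, ENNReal.ofReal (c * (r * y) ^ (a - 1) * √(C * (r / (r + r * y)))) *
          E2 ((r + r * y) / 2) (G0 a g) x ^ (1 / 2 : ℝ) :=
        lintegral_vol_scale (φ := fun v => ENNReal.ofReal (c * v ^ (a - 1) * √(C * (r / (r + v)))) * E2 ((r + v) / 2) (G0 a g) x ^ (1 / 2 : ℝ))
          (by fun_prop) hr
    _ = ENNReal.ofReal (c * √C) * ENNReal.ofReal (r ^ a) *
        ∫⁻ y in Set.Ioi 0, w y * E2 (r * (1 + y) / 2) (G0 a g) x ^ (1 / 2 : ℝ) := by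
        rw [← lintegral_const_mul _ (by fun_prop), ← lintegral_const_mul _ (by fun_prop)]
        refine setLIntegral_congr_fun measurableSet_Ioi fun y (hy : 0 < y) => ?_
        simp only [hw]
        rw [← mul_assoc, ← mul_assoc, ← ENNReal.ofReal_mul hr.le, ← ENNReal.ofReal_mul (by positivity),
          ← ENNReal.ofReal_mul (by positivity), show r + r * y = r * (1 + y) by ring]
        congr 2
        have e1 : √(C * (r / (r * (1 + y)))) = √C * (1 + y) ^ (-(1/2) : ℝ) := by
          rw [show r / (r * (1 + y)) = (1 + y)⁻¹ by field_simp, Real.sqrt_mul hC.le, Real.sqrt_inv, Real.sqrt_eq_rpow (1 + y),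
            ← Real.rpow_neg (by positivity)]
        have e2 : r ^ a = r * r ^ (a - 1) := by
          rw [Real.rpow_sub_one hr.ne']; field_simp
        rw [e1, e2, Real.mul_rpow hr.le hy.le]; ring
    _ ≤ _ := by
        refine mul_le_mul_right (lintegral_mono fun y => mul_le_mul_right ?_ _) _
        exact le_add_self

lemma Dmeas {n : ℕ} {F : En n → ℝ} (hFm : Measurable F) (r : ℝ) (x : En n) :
    Measurable (fun q : ℝ × En n => (P r F q.2 - P (r + q.1) F q.2) -
      (Set.Ioi r).indicator (fun u => P r F x - P (r + u) F x) q.1) := by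
  refine Measurable.sub (by fun_prop) ?_
  have : Measurable ((Set.Ioi r).indicator (fun u => P r F x - P (r + u) F x)) :=
    Measurable.indicator (by fun_prop) measurableSet_Ioi
  exact this.comp measurable_fst

lemma Zmeas {n : ℕ} {D : ℝ → En n → ℝ} (hD : Measurable (fun q : ℝ × En n => D q.1 q.2)) (c b : ℝ) :
    Measurable (Function.uncurry fun u y => ENNReal.ofReal (c * u ^ (-1 - b) * |D u y|)) := by
  simp only [Function.uncurry_def]
  have := hD.abs
  fun_prop


lemma Sf_bound {n : ℕ} (hn : 0 < n) {b : ℝ} (h0 : 0 < b) (h1 : b < 1 / 2) : ∃ C : ℝ≥0∞, C ≠ ⊤ ∧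
    ∀ f : En n → ℝ, Nice f → ∀ x,
    ∫⁻ r, ENNReal.ofReal (r ^ (2 * b)) * sg r f x ∂mdt ≤ C * S2 (F0 b f) x := by
  obtain ⟨C1, hC1, hv1⟩ := var_E2 n
  obtain ⟨C2, hC2, hv2⟩ := diff_E2 n
  have hCa := Ca_pos h0 h1
  set c : ℝ := (Ca b)⁻¹ with hc
  set A : ℝ := √(C1 + C2) with hA
  have hA0 : 0 ≤ A := Real.sqrt_nonneg _
  have hc0 : 0 < c := inv_pos.2 hCa
  set w : ℝ → ℝ≥0∞ := fun u => ENNReal.ofReal (wt b u) with hw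
  refine ⟨(ENNReal.ofReal (c * A) * (2 * ∫⁻ y in Set.Ioi 0, w y)) ^ 2,
    ENNReal.pow_ne_top (ENNReal.mul_ne_top ENNReal.ofReal_ne_top (ENNReal.mul_ne_top (by norm_num) (wt_int h0 h1))),
    fun f hf x => ?_⟩
  set F := F0 b f with hFd
  have hF : BM F := F0_BM hn hf h0 h1
  have hFm := hF.1
  have hfm := hf.bm.1
  rw [show 2 * b = -(2 * (-b)) by ring]
  refine sq_from_sg hF hf.bm (by fun_prop) x fun r hr => ?_
  obtain ⟨D0, hD0⟩ : ∃ D0 : ℝ → En n → ℝ, D0 = fun u y => P r F y - P (r + u) F y := ⟨_, rfl⟩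
  obtain ⟨D, hD⟩ : ∃ D : ℝ → En n → ℝ, D = fun u y => D0 u y - (Set.Ioi r).indicator (fun u => D0 u x) u := ⟨_, rfl⟩
  have hDm' : Measurable (fun q : ℝ × En n => D q.1 q.2) := by
    rw [hD, hD0]; exact Dmeas hFm r x
  have hDm : ∀ u, Measurable (D u) := fun u => hDm'.comp (measurable_prodMk_left (x := u))
  obtain ⟨Z, hZ⟩ : ∃ Z : ℝ → En n → ℝ≥0∞, Z = fun u y => ENNReal.ofReal (c * u ^ (-1 - b) * |D u y|) := ⟨_, rfl⟩
  have hZm : Measurable (Function.uncurry Z) := by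
    rw [hZ]; exact Zmeas hDm' c b
  obtain ⟨p3, p4⟩ := repr_B hn hf h0 h1 hr.le x
  have hmain : ∀ y, ENNReal.ofReal |P r f y - c * ∫ u in Set.Ioi 0, (Set.Ioi r).indicator (fun u => D0 u x * u ^ (-1 - b)) u| ≤
      ∫⁻ v in Set.Ioi 0, Z v y := by
    intro y
    obtain ⟨p1, p2⟩ := repr_B hn hf h0 h1 hr.le y
    have p5 : IntegrableOn ((Set.Ioi r).indicator (fun u => D0 u x * u ^ (-1 - b))) (Set.Ioi 0) :=
      Integrable.indicator (by rw [hD0]; exact p4) measurableSet_Ioi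
    have e : P r f y - c * ∫ u in Set.Ioi 0, (Set.Ioi r).indicator (fun u => D0 u x * u ^ (-1 - b)) u =
        ∫ u in Set.Ioi 0, c * (D u y * u ^ (-1 - b)) := by
      rw [integral_const_mul]
      have : ∫ u in Set.Ioi 0, D u y * u ^ (-1 - b) = Ca b * P r f y -
          ∫ u in Set.Ioi 0, (Set.Ioi r).indicator (fun u => D0 u x * u ^ (-1 - b)) u := by
        rw [p1, ← integral_sub p2 p5]
        refine integral_congr_ae (Eventually.of_forall fun u => ?_)
        simp only [hD, hD0]
        by_cases hu : u ∈ Set.Ioi r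
        · rw [Set.indicator_of_mem hu, Set.indicator_of_mem hu]; ring
        · rw [Set.indicator_of_notMem hu, Set.indicator_of_notMem hu]; ring
      rw [this, mul_sub, ← mul_assoc c (Ca b), hc, inv_mul_cancel₀ hCa.ne', one_mul]
    rw [e, ← Real.norm_eq_abs, ofReal_norm_eq_enorm]
    refine (enorm_integral_le_lintegral_enorm _).trans ?_
    refine setLIntegral_mono' measurableSet_Ioi fun v (hv : 0 < v) => ?_
    rw [← ofReal_norm_eq_enorm, Real.norm_eq_abs, abs_mul, abs_mul, abs_of_pos hc0, abs_of_pos (Real.rpow_pos_of_pos hv _)]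
    rw [hZ]
    exact ENNReal.ofReal_le_ofReal (le_of_eq (by ring))
  refine (sg_mink hr.le hf.bm x _ (volume.restrict (Set.Ioi 0)) hZm hmain).trans ?_
  have hpt : ∀ u, 0 < u → (∫⁻ y, ENNReal.ofReal (D u y ^ 2) ∂(hm r x)) ^ (1 / 2 : ℝ) ≤
      ENNReal.ofReal (A * min 1 √(u / r)) * (E2 (r / 2) F x ^ (1 / 2 : ℝ) + E2 ((r + u) / 2) F x ^ (1 / 2 : ℝ)) := by
    intro u hu
    rcases le_or_gt u r with hur | hur
    · have e : ∀ y, D u y = P r F y - P (r + u) F y := fun y => by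
        simp only [hD]
        rw [Set.indicator_of_notMem (by simpa using hur)]; simp [hD0]
      simp_rw [e]
      have hm1 : min 1 √(u / r) = √(u / r) := min_eq_right (by
        rw [Real.sqrt_le_one]; exact (div_le_one hr).2 hur)
      rw [hm1]
      refine (ENNReal.rpow_le_rpow (hv2 F u r x hF hu hur) (by norm_num)).trans ?_
      rw [sqrt_mul_E (by positivity)]
      refine mul_le_mul' (ENNReal.ofReal_le_ofReal ?_) le_self_add
      rw [hA, ← Real.sqrt_mul (by positivity)]
      refine Real.sqrt_le_sqrt ?_
      gcongr; linarith
    · have e : ∀ y, ENNReal.ofReal (D u y ^ 2) ≤ (ENNReal.ofReal (1 * |P r F y - P r F x|) +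
          ENNReal.ofReal (1 * |P (r + u) F y - P (r + u) F x|)) ^ 2 := fun y => by
        rw [one_mul, one_mul, ofReal_sq_eq, ← ENNReal.ofReal_add (abs_nonneg _) (abs_nonneg _)]
        refine pow_le_pow_left' (ENNReal.ofReal_le_ofReal ?_) 2
        simp only [hD]
        rw [Set.indicator_of_mem (by simpa using hur)]
        simp only [hD0]
        refine le_trans (le_of_eq ?_) (abs_sub _ _)
        congr 1; ring
      have hm1 : min 1 √(u / r) = 1 := min_eq_left (by
        rw [Real.one_le_sqrt]; exact (one_le_div hr).2 hur.le)
      rw [hm1, mul_one]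
      refine (ENNReal.rpow_le_rpow (lintegral_mono e) (by norm_num)).trans ?_
      refine (mink_add _ (by fun_prop) (by fun_prop)).trans ?_
      rw [sqrt_const _ (by norm_num) (by fun_prop), sqrt_const _ (by norm_num) (by fun_prop), ENNReal.ofReal_one, one_mul,
        one_mul, mul_add]
      have hgen : ∀ w, r ≤ w → (∫⁻ y, ENNReal.ofReal ((P w F y - P w F x) ^ 2) ∂(hm r x)) ^ (1 / 2 : ℝ) ≤
          ENNReal.ofReal A * E2 (w / 2) F x ^ (1 / 2 : ℝ) := by
        intro w hrw
        have hw0 : 0 < w := by linarith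
        refine (ENNReal.rpow_le_rpow (hv1 F r w x hF hr hrw) (by norm_num)).trans ?_
        rw [sqrt_mul_E (by positivity)]
        refine mul_le_mul_left (ENNReal.ofReal_le_ofReal (Real.sqrt_le_sqrt ?_)) _
        have : r / w ≤ 1 := (div_le_one hw0).2 hrw
        nlinarith
      exact add_le_add (hgen r le_rfl) (hgen (r + u) (by linarith))
  calc _ ≤ ∫⁻ u in Set.Ioi 0, ENNReal.ofReal (c * u ^ (-1 - b) * (A * min 1 √(u / r))) *
          (E2 (r / 2) F x ^ (1 / 2 : ℝ) + E2 ((r + u) / 2) F x ^ (1 / 2 : ℝ)) := by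
        refine setLIntegral_mono' measurableSet_Ioi fun v (hv0 : 0 < v) => ?_
        simp only [hZ]
        rw [sqrt_const _ (by positivity) (hDm v), ENNReal.ofReal_mul (p := c * v ^ (-1 - b)) (q := A * min 1 √(v / r)) (by positivity), mul_assoc]
        exact mul_le_mul_right (hpt v hv0) _
    _ = ENNReal.ofReal r * ∫⁻ y in Set.Ioi 0, ENNReal.ofReal (c * (r * y) ^ (-1 - b) * (A * min 1 √(r * y / r))) *
          (E2 (r / 2) F x ^ (1 / 2 : ℝ) + E2 ((r + r * y) / 2) F x ^ (1 / 2 : ℝ)) :=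
        lintegral_vol_scale (φ := fun u => ENNReal.ofReal (c * u ^ (-1 - b) * (A * min 1 √(u / r))) *
          (E2 (r / 2) F x ^ (1 / 2 : ℝ) + E2 ((r + u) / 2) F x ^ (1 / 2 : ℝ)))
          (by fun_prop) hr
    _ = _ := by
        rw [← lintegral_const_mul _ (by fun_prop), ← lintegral_const_mul _ (by fun_prop)]
        refine setLIntegral_congr_fun measurableSet_Ioi fun y (hy : 0 < y) => ?_
        simp only [hw]
        rw [← mul_assoc (ENNReal.ofReal r), ← mul_assoc (ENNReal.ofReal (c * A) * _), ← ENNReal.ofReal_mul hr.le, ← ENNReal.ofReal_mul (by positivity),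
          ← ENNReal.ofReal_mul (by positivity), show r + r * y = r * (1 + y) by ring]
        congr 2
        rw [mul_div_cancel_left₀ _ hr.ne', Real.mul_rpow hr.le hy.le]
        unfold wt
        have e2 : r ^ (-b) = r * r ^ (-1 - b) := by
          rw [show -1 - b = -b - 1 by ring, Real.rpow_sub_one hr.ne']; field_simp
        rw [e2]; ring

lemma Mf_bound {n : ℕ} (hn : 0 < n) {b : ℝ} (h0 : 0 < b) (h1 : b < 1 / 2) : ∃ C : ℝ≥0∞, C ≠ ⊤ ∧
    ∀ f : En n → ℝ, Nice f → ∀ x v, 0 < v →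
    ENNReal.ofReal |P v f x| ≤ C * ENNReal.ofReal (v ^ (-b)) * Mx (fun y => ENNReal.ofReal |F0 b f y|) x := by
  obtain ⟨C, hC, hd⟩ := diff_Mx n
  have hCa := Ca_pos h0 h1
  set c : ℝ := (Ca b)⁻¹ with hc
  have hc0 : 0 < c := inv_pos.2 hCa
  set K := ∫⁻ u in Set.Ioi 0, ENNReal.ofReal (wt b u) with hK
  refine ⟨ENNReal.ofReal (c * C) * K, ENNReal.mul_ne_top ENNReal.ofReal_ne_top (wt_int h0 h1), fun f hf x v hv => ?_⟩
  have hF := F0_BM hn hf h0 h1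
  obtain ⟨p3, p4⟩ := repr_B hn hf h0 h1 hv.le x
  set M := Mx (fun y => ENNReal.ofReal |F0 b f y|) x with hM
  have e : P v f x = ∫ u in Set.Ioi 0, c * ((P v (F0 b f) x - P (v + u) (F0 b f) x) * u ^ (-1 - b)) := by
    rw [integral_const_mul, ← p3, hc]; field_simp
  rw [e, ← Real.norm_eq_abs, ofReal_norm_eq_enorm]
  refine (enorm_integral_le_lintegral_enorm _).trans ?_
  calc _ ≤ ∫⁻ u in Set.Ioi 0, ENNReal.ofReal (c * C) * ENNReal.ofReal (min 1 √(u / v) * u ^ (-1 - b)) * M := by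
        refine setLIntegral_mono' measurableSet_Ioi fun u (hu : 0 < u) => ?_
        rw [← ofReal_norm_eq_enorm, Real.norm_eq_abs, abs_mul, abs_mul, abs_of_pos hc0, abs_of_pos (Real.rpow_pos_of_pos hu _),
          show c * (|P v (F0 b f) x - P (v + u) (F0 b f) x| * u ^ (-1 - b)) =
            (c * u ^ (-1 - b)) * |P v (F0 b f) x - P (v + u) (F0 b f) x| by ring, ENNReal.ofReal_mul (by positivity)]
        refine (mul_le_mul_right (hd (F0 b f) u v x hF hu hv) _).trans (le_of_eq ?_)
        rw [← mul_assoc, ← ENNReal.ofReal_mul (by positivity), ← ENNReal.ofReal_mul (by positivity)]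
        congr 2; ring
    _ = _ := by
        rw [lintegral_mul_const _ (by fun_prop), lintegral_const_mul _ (by fun_prop), wt_scale hv, ← hK]
        ring

lemma BM.imul {n : ℕ} {φ ψ : En n → ℝ} (hψ : BM ψ) (hφ : Integrable φ) : Integrable (fun x => φ x * ψ x) := by
  obtain ⟨M, hM, hb⟩ := hψ.bd
  exact hφ.mul_bdd (c := M) hψ.1.aestronglyMeasurable (Eventually.of_forall fun x => by simpa using hb x)

lemma BM.imul' {n : ℕ} {φ ψ : En n → ℝ} (hψ : BM ψ) (hφ : Integrable φ) : Integrable (fun x => ψ x * φ x) := by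
  simpa only [mul_comm] using hψ.imul hφ

lemma P_integrable {n : ℕ} {φ : En n → ℝ} (hφ : BM φ) (hi : Integrable φ) (t : ℝ) : Integrable (P t φ) := by
  have hm' := hφ.1
  refine ⟨(hφ.P t).1.aestronglyMeasurable, ?_⟩
  refine lt_of_le_of_lt (lintegral_mono fun x => enorm_P_le φ t x) ?_
  rw [lintegral_PE t (by fun_prop)]
  exact hi.2

lemma P_symm {n : ℕ} (t : ℝ) {φ ψ : En n → ℝ} (hφ : BM φ) (hi : Integrable φ) (hψ : BM ψ) :
    ∫ x, φ x * P t ψ x = ∫ x, P t φ x * ψ x := by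
  rcases le_or_gt t 0 with ht | ht
  · refine integral_congr_ae (Eventually.of_forall fun x => ?_)
    simp only [P, hm_nonpos ht, integral_dirac]
  · have h1 : Integrable (fun q : En n × En n => φ q.2 * hk t (q.1 - q.2)) (volume.prod volume) :=
      hi.convolution_integrand (ContinuousLinearMap.mul ℝ ℝ) (integrable_hk ht)
    obtain ⟨M, hM, hb⟩ := hψ.bd
    have h2 : Integrable (fun q : En n × En n => φ q.2 * hk t (q.1 - q.2) * ψ q.1) (volume.prod volume) :=
      h1.mul_bdd (c := M) (hψ.1.comp measurable_fst).aestronglyMeasurable (Eventually.of_forall fun x => by simpa using hb x.1)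
    have h3 := integral_integral_swap (f := fun x y => φ y * hk t (x - y) * ψ x) h2
    calc _ = ∫ y, ∫ x, φ y * hk t (x - y) * ψ x := by
          refine integral_congr_ae (Eventually.of_forall fun x => ?_)
          simp only [P_pos_eq ht]
          rw [← integral_const_mul]
          refine integral_congr_ae (Eventually.of_forall fun y => ?_)
          simp only [hk_sub_comm t x y]; ring
      _ = _ := h3.symm
      _ = _ := by
          refine integral_congr_ae (Eventually.of_forall fun x => ?_)
          simp only [P_pos_eq ht]
          rw [← integral_mul_const]
          refine integral_congr_ae (Eventually.of_forall fun y => ?_)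
          simp only; ring

lemma cov_le {n : ℕ} {r : ℝ} (hr : 0 ≤ r) {g h : En n → ℝ} (hg : BM g) (hh : BM h) (x : En n) :
    ENNReal.ofReal |P r (fun y => P r g y * P r h y) x - P (2 * r) g x * P (2 * r) h x| ≤
      sg r g x ^ (1 / 2 : ℝ) * sg r h x ^ (1 / 2 : ℝ) := by
  have hgr := hg.P r
  have hhr := hh.P r
  have hgm := hgr.1
  have hhm := hhr.1
  have eg : ∫ z, P r g z ∂(hm r x) = P (2 * r) g x := by rw [two_mul, ← P_semigroup hr hr hg]; rfl
  have eh : ∫ z, P r h z ∂(hm r x) = P (2 * r) h x := by rw [two_mul, ← P_semigroup hr hr hh]; rfl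
  have e : P r (fun y => P r g y * P r h y) x - P (2 * r) g x * P (2 * r) h x =
      ∫ y, (P r g y - P (2 * r) g x) * (P r h y - P (2 * r) h x) ∂(hm r x) := by
    have : ∀ y, (P r g y - P (2 * r) g x) * (P r h y - P (2 * r) h x) =
      P r g y * P r h y - (P (2 * r) h x * P r g y + P (2 * r) g x * P r h y - P (2 * r) g x * P (2 * r) h x) := fun y => by ring
    simp_rw [this]
    have i1 := (hgr.mul hhr).int (hm r x)
    have i2 := (hgr.int (hm r x)).const_mul (P (2 * r) h x)
    have i3 := (hhr.int (hm r x)).const_mul (P (2 * r) g x)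
    have i4 : Integrable (fun y => P (2 * r) h x * P r g y + P (2 * r) g x * P r h y) (hm r x) := i2.add i3
    have i5 : Integrable (fun y => P (2 * r) h x * P r g y + P (2 * r) g x * P r h y - P (2 * r) g x * P (2 * r) h x) (hm r x) :=
      i4.sub (integrable_const _)
    rw [integral_sub i1 i5, integral_sub i4 (integrable_const _),
      integral_add i2 i3, integral_const_mul, integral_const_mul, eg, eh]
    simp only [integral_const, probReal_univ, one_smul]
    unfold P; ring
  rw [e, ← Real.norm_eq_abs, ofReal_norm_eq_enorm]
  refine (enorm_integral_le_lintegral_enorm _).trans ?_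
  have := cs_lintegral (hm r x) (φ := fun y => ENNReal.ofReal |P r g y - P (2 * r) g x|)
    (ψ := fun y => ENNReal.ofReal |P r h y - P (2 * r) h x|) (by fun_prop) (by fun_prop)
  simp_rw [← ofReal_sq_eq] at this
  refine le_trans (le_of_eq ?_) this
  refine lintegral_congr fun y => ?_
  rw [← ofReal_norm_eq_enorm, Real.norm_eq_abs, abs_mul, ENNReal.ofReal_mul (abs_nonneg _)]

/-- the trilinear form -/
def J {n : ℕ} (g h f : En n → ℝ) (u r : ℝ) : ℝ := ∫ x, P r g x * P r h x * P (u - r) f x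

def bb {n : ℕ} (g h f : En n → ℝ) (u r : ℝ) : ℝ≥0∞ :=
  ∫⁻ x, ENNReal.ofReal |P (u - 2 * r) f x| * (sg r g x ^ (1 / 2 : ℝ) * sg r h x ^ (1 / 2 : ℝ))

lemma J_diff {n : ℕ} {g h f : En n → ℝ} (hg : BM g) (hh : BM h) (hf : BM f) (hi : Integrable h) (hif : Integrable f)
    {u r : ℝ} (hr : 0 ≤ r) (hu : 2 * r ≤ u) :
    ENNReal.ofReal |J g h f u r - J g h f u (2 * r)| ≤ bb g h f u r := by
  have e1 : J g h f u r = ∫ x, P r (fun y => P r g y * P r h y) x * P (u - 2 * r) f x := by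
    rw [← P_symm r ((hg.P r).mul (hh.P r)) ((hg.P r).imul' (P_integrable hh hi r)) (hf.P _)]
    refine integral_congr_ae (Eventually.of_forall fun x => ?_)
    simp only
    rw [P_semigroup hr (by linarith) hf, show r + (u - 2 * r) = u - r by ring]
  have iF := P_integrable hf hif (u - 2 * r)
  have e2 : J g h f u r - J g h f u (2 * r) =
      ∫ x, (P r (fun y => P r g y * P r h y) x - P (2 * r) g x * P (2 * r) h x) * P (u - 2 * r) f x := by
    rw [e1, J, ← integral_sub]
    · refine integral_congr_ae (Eventually.of_forall fun x => ?_)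
      simp only; ring
    · exact (((hg.P r).mul (hh.P r)).P r).imul' iF
    · exact ((hg.P (2 * r)).mul (hh.P (2 * r))).imul' iF
  rw [e2, ← Real.norm_eq_abs, ofReal_norm_eq_enorm]
  refine (enorm_integral_le_lintegral_enorm _).trans (lintegral_mono fun x => ?_)
  rw [← ofReal_norm_eq_enorm, Real.norm_eq_abs, abs_mul, mul_comm, ENNReal.ofReal_mul (abs_nonneg _)]
  exact mul_le_mul_right (cov_le hr hg hh x) _

lemma P_abs_sub_le {n : ℕ} {f g : En n → ℝ} (hf : BM f) (hg : BM g) {K : ℝ} (h : ∀ x, |f x - g x| ≤ K) (t : ℝ) (x : En n) :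
    |P t f x - P t g x| ≤ K := by
  rw [← P_sub hf hg]; exact P_abs_le h t x

lemma Nice.dist {n : ℕ} {f : En n → ℝ} (hf : Nice f) : ∃ K, 0 ≤ K ∧ ∀ r, 0 < r → ∀ x, |f x - P r f x| ≤ K * √r := by
  obtain ⟨L, hL, h⟩ := hf.lip
  exact ⟨_, by positivity, fun r hr x => P_dist hf.bm hL h hr x⟩

lemma Nice.mul {n : ℕ} {f g : En n → ℝ} (hf : Nice f) (hg : Nice g) : Nice (fun x => g x * f x) := by
  obtain ⟨L, hL, h⟩ := hf.lip
  obtain ⟨L', hL', h'⟩ := hg.lip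
  obtain ⟨M, hM, hb⟩ := hf.bm.bd
  obtain ⟨M', hM', hb'⟩ := hg.bm.bd
  refine ⟨hg.bm.mul hf.bm, ⟨M' * L + L' * M, by positivity, fun x y => ?_⟩, hg.bm.imul' hf.int⟩
  rw [show g x * f x - g y * f y = g x * (f x - f y) + (g x - g y) * f y by ring]
  refine (abs_add_le _ _).trans ?_
  rw [abs_mul, abs_mul, add_mul]
  have := mul_le_mul (hb' x) (h x y) (abs_nonneg _) hM'
  have := mul_le_mul (h' x y) (hb y) (abs_nonneg _) (by positivity)
  nlinarith

lemma Nice.P {n : ℕ} {f : En n → ℝ} (hf : Nice f) {t : ℝ} (ht : 0 < t) : Nice (P t f) := by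
  obtain ⟨M, hM, hb⟩ := hf.bm.bd
  refine ⟨hf.bm.P t, ⟨(4 * 2 ^ ((n : ℝ) / 2)) * (1 / √t) * (M + M), by positivity, fun x y => ?_⟩, P_integrable hf.bm hf.int t⟩
  refine (P_lip ht hf.bm x y).trans ?_
  have hb2 : ∀ x, |(|f x|)| ≤ M := fun x => by simpa using hb x
  have h1 := (abs_le.1 (P_abs_le hb2 (2 * t) x)).2
  have h2 := (abs_le.1 (P_abs_le hb2 (2 * t) y)).2
  calc _ ≤ (4 * 2 ^ ((n : ℝ) / 2)) * (‖x - y‖ / √t) * (M + M) := by gcongr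
    _ = _ := by ring

lemma J_lim1 {n : ℕ} {g h f : En n → ℝ} (hg : Nice g) (hh : BM h) (hf : Nice f) (hi : Integrable h)
    {u : ℝ} (hu : 0 < u) : ∃ K, ∀ r, 0 < r → r ≤ u →
    |J g h f u r - ∫ x, h x * (g x * P u f x)| ≤ K * √r := by
  obtain ⟨K1, hK1, h1⟩ := hg.dist
  obtain ⟨K2, hK2, h2⟩ := hf.dist
  obtain ⟨K3, hK3, h3⟩ := ((hf.P hu).mul hg).dist
  obtain ⟨M, hM, hb⟩ := hg.bm.bd
  obtain ⟨M', hM', hb'⟩ := hf.bm.bd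
  refine ⟨(∫ x, |h x|) * (K1 * M' + M * K2 + K3), fun r hr hru => ?_⟩
  have bmk : BM (fun y => P r g y * P (u - r) f y) := (hg.bm.P r).mul (hf.bm.P _)
  have bmg : BM (fun y => g y * P u f y) := hg.bm.mul (hf.bm.P _)
  have e : J g h f u r = ∫ x, h x * P r (fun y => P r g y * P (u - r) f y) x := by
    rw [P_symm r hh hi bmk, J]
    refine integral_congr_ae (Eventually.of_forall fun x => ?_)
    simp only; ring
  rw [e, ← integral_sub ((bmk.P r).imul hi) (bmg.imul hi)]
  have hpt : ∀ x, |P r (fun y => P r g y * P (u - r) f y) x - g x * P u f x| ≤ (K1 * M' + M * K2 + K3) * √r := by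
    intro x
    have a1 : |P r (fun y => P r g y * P (u - r) f y) x - P r (fun y => g y * P u f y) x| ≤ (K1 * M' + M * K2) * √r := by
      refine P_abs_sub_le bmk bmg (fun y => ?_) r x
      rw [show P r g y * P (u - r) f y - g y * P u f y = -((g y - P r g y) * P (u - r) f y) + g y * (P (u - r) f y - P u f y) by ring]
      refine (abs_add_le _ _).trans ?_
      rw [abs_neg, abs_mul, abs_mul]
      have b1 := mul_le_mul (h1 r hr y) (P_abs_le hb' (u - r) y) (abs_nonneg _) (by positivity)
      have b2 : |P (u - r) f y - P u f y| ≤ K2 * √r := by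
        have := P_abs_sub_le hf.bm (hf.bm.P r) (h2 r hr) (u - r) y
        rwa [P_semigroup (by linarith) hr.le hf.bm, sub_add_cancel] at this
      have b3 := mul_le_mul (hb y) b2 (abs_nonneg _) hM
      nlinarith
    have a2 := h3 r hr x
    rw [abs_sub_comm] at a2
    have := abs_sub_le (P r (fun y => P r g y * P (u - r) f y) x) (P r (fun y => g y * P u f y) x) (g x * P u f x)
    nlinarith
  refine (abs_integral_le_integral_abs).trans ?_
  rw [mul_assoc, ← integral_mul_const]
  refine integral_mono_of_nonneg (Eventually.of_forall fun x => abs_nonneg _) (hi.abs.mul_const _) (Eventually.of_forall fun x => ?_)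
  simp only
  rw [← mul_sub, abs_mul]
  exact mul_le_mul_of_nonneg_left (hpt x) (abs_nonneg _)

lemma J_lim2 {n : ℕ} {g h f : En n → ℝ} (hg : Nice g) (hh : BM h) (hf : Nice f) (hi : Integrable h)
    {u : ℝ} (hu : 0 < u) : ∃ K, ∀ r, 0 < r → r ≤ u →
    |J g f h u r - ∫ x, h x * P u (fun y => g y * f y) x| ≤ K * √r := by
  obtain ⟨K1, hK1, h1⟩ := hg.dist
  obtain ⟨K2, hK2, h2⟩ := hf.dist
  obtain ⟨K3, hK3, h3⟩ := (hf.mul hg).dist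
  obtain ⟨M, hM, hb⟩ := hg.bm.bd
  obtain ⟨M', hM', hb'⟩ := hf.bm.bd
  refine ⟨(∫ x, |h x|) * (K1 * M' + M * K2 + K3), fun r hr hru => ?_⟩
  have bmk : BM (fun y => P r g y * P r f y) := (hg.bm.P r).mul (hf.bm.P _)
  have bmg : BM (fun y => g y * f y) := hg.bm.mul hf.bm
  have e : J g f h u r = ∫ x, h x * P (u - r) (fun y => P r g y * P r f y) x := by
    rw [P_symm (u - r) hh hi bmk, J]
    refine integral_congr_ae (Eventually.of_forall fun x => ?_)
    simp only; ring
  rw [e, ← integral_sub ((bmk.P _).imul hi) ((bmg.P _).imul hi)]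
  have hpt : ∀ x, |P (u - r) (fun y => P r g y * P r f y) x - P u (fun y => g y * f y) x| ≤ (K1 * M' + M * K2 + K3) * √r := by
    intro x
    have a1 : |P (u - r) (fun y => P r g y * P r f y) x - P (u - r) (fun y => g y * f y) x| ≤ (K1 * M' + M * K2) * √r := by
      refine P_abs_sub_le bmk bmg (fun y => ?_) _ x
      rw [show P r g y * P r f y - g y * f y = -((g y - P r g y) * P r f y) + -(g y * (f y - P r f y)) by ring]
      refine (abs_add_le _ _).trans ?_
      rw [abs_neg, abs_neg, abs_mul, abs_mul]
      have b1 := mul_le_mul (h1 r hr y) (P_abs_le hb' r y) (abs_nonneg _) (by positivity)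
      have b3 := mul_le_mul (hb y) (h2 r hr y) (abs_nonneg _) hM
      nlinarith
    have a2 := P_abs_sub_le bmg (bmg.P r) (h3 r hr) (u - r) x
    rw [P_semigroup (by linarith) hr.le bmg, sub_add_cancel] at a2
    have := abs_sub_le (P (u - r) (fun y => P r g y * P r f y) x) (P (u - r) (fun y => g y * f y) x) (P u (fun y => g y * f y) x)
    nlinarith
  refine (abs_integral_le_integral_abs).trans ?_
  rw [mul_assoc, ← integral_mul_const]
  refine integral_mono_of_nonneg (Eventually.of_forall fun x => abs_nonneg _) (hi.abs.mul_const _) (Eventually.of_forall fun x => ?_)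
  simp only
  rw [← mul_sub, abs_mul]
  exact mul_le_mul_of_nonneg_left (hpt x) (abs_nonneg _)

lemma tele_bound {a : ℕ → ℝ} {b : ℕ → ℝ≥0∞} {A : ℝ} (h0 : a 0 = 0) (hd : ∀ j, ENNReal.ofReal |a (j + 1) - a j| ≤ b j)
    (hl : Tendsto a atTop (𝓝 A)) : ENNReal.ofReal |A| ≤ ∑' j, b j := by
  have h1 : ∀ N, ENNReal.ofReal |a N| ≤ ∑ j ∈ Finset.range N, b j := by
    intro N
    induction N with
    | zero => simp [h0]
    | succ N ih =>
      rw [Finset.sum_range_succ]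
      refine le_trans ?_ (add_le_add ih (hd N))
      rw [← ENNReal.ofReal_add (abs_nonneg _) (abs_nonneg _)]
      refine ENNReal.ofReal_le_ofReal ?_
      have := abs_add_le (a N) (a (N + 1) - a N)
      rwa [add_sub_cancel] at this
  refine le_of_tendsto ((ENNReal.continuous_ofReal.tendsto _).comp hl.abs) (Eventually.of_forall fun N => ?_)
  exact (h1 N).trans (ENNReal.sum_le_tsum _)

lemma Du_bound {n : ℕ} {g h f : En n → ℝ} (hg : Nice g) (hh : BM h) (hf : Nice f) (hi : Integrable h)
    {u : ℝ} (hu : 0 < u) :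
    ENNReal.ofReal |∫ x, h x * (g x * P u f x - P u (fun y => g y * f y) x)| ≤
      ∑' j : ℕ, (bb g h f u (u / 2 ^ (j + 2)) + bb g f h u (u / 2 ^ (j + 2))) := by
  have bmg : BM (fun y => g y * f y) := hg.bm.mul hf.bm
  refine tele_bound (a := fun j => J g h f u (u / 2 ^ (j + 1)) - J g f h u (u / 2 ^ (j + 1))) ?_ ?_ ?_
  · simp only [J, zero_add, pow_one, sub_half]
    rw [sub_eq_zero]
    refine integral_congr_ae (Eventually.of_forall fun x => ?_)
    simp only; ring
  · intro j
    have hp : (0:ℝ) < 2 ^ (j + 2) := by positivity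
    have hp1 : (4:ℝ) ≤ 2 ^ (j + 2) := by
      rw [pow_add]; nlinarith [one_le_pow₀ (one_le_two (α := ℝ)) (n := j)]
    have hr : 0 ≤ u / 2 ^ (j + 2) := by positivity
    have hru : 2 * (u / 2 ^ (j + 2)) ≤ u := by
      rw [← mul_div_assoc, div_le_iff₀ hp]; nlinarith
    have e : u / 2 ^ (j + 1) = 2 * (u / 2 ^ (j + 2)) := by rw [pow_succ _ (j + 1)]; field_simp
    have q1 := J_diff hg.bm hh hf.bm hi hf.int hr hru
    have q2 := J_diff hg.bm hf.bm hh hf.int hi hr hru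
    simp only [e]
    refine le_trans ?_ (add_le_add q1 q2)
    rw [← ENNReal.ofReal_add (abs_nonneg _) (abs_nonneg _)]
    refine ENNReal.ofReal_le_ofReal (le_trans (le_of_eq ?_) (abs_sub _ _))
    congr 1; ring
  · obtain ⟨K1, h1⟩ := J_lim1 hg hh hf hi hu
    obtain ⟨K2, h2⟩ := J_lim2 hg hh hf hi hu
    have e : ∫ x, h x * (g x * P u f x - P u (fun y => g y * f y) x) =
        (∫ x, h x * (g x * P u f x)) - ∫ x, h x * P u (fun y => g y * f y) x := by
      rw [← integral_sub ((hg.bm.mul (hf.bm.P _)).imul hi) ((bmg.P _).imul hi)]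
      refine integral_congr_ae (Eventually.of_forall fun x => ?_)
      simp only; ring
    rw [e]
    have hr0 : Tendsto (fun j : ℕ => u / 2 ^ (j + 1)) atTop (𝓝 0) := by
      have := (tendsto_pow_atTop_nhds_zero_of_lt_one (r := (1/2 : ℝ)) (by norm_num) (by norm_num)).const_mul (u / 2)
      rw [mul_zero] at this
      refine this.congr fun j => ?_
      rw [pow_succ, one_div, inv_pow]; field_simp
    have hs : ∀ K : ℝ, Tendsto (fun j : ℕ => K * √(u / 2 ^ (j + 1))) atTop (𝓝 0) := fun K => by
      have := ((Real.continuous_sqrt.tendsto _).comp hr0).const_mul K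
      simpa using this
    have hpos : ∀ j : ℕ, 0 < u / 2 ^ (j + 1) := fun j => by positivity
    have hle : ∀ j : ℕ, u / 2 ^ (j + 1) ≤ u := fun j => div_le_self hu.le (one_le_pow₀ one_le_two)
    refine Tendsto.sub ?_ ?_
    · rw [tendsto_iff_norm_sub_tendsto_zero]
      exact squeeze_zero (fun _ => norm_nonneg _) (fun j => h1 _ (hpos j) (hle j)) (hs K1)
    · rw [tendsto_iff_norm_sub_tendsto_zero]
      exact squeeze_zero (fun _ => norm_nonneg _) (fun j => h2 _ (hpos j) (hle j)) (hs K2)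

def T0 {n : ℕ} (a : ℝ) (g f : En n → ℝ) (x : En n) : ℝ :=
  ∫ u in Set.Ioi 0, (g x * P u f x - P u (fun y => g y * f y) x) * u ^ (-1 - a)

lemma T0_bound {n : ℕ} (hn : 0 < n) {a : ℝ} {g f : En n → ℝ} (hg : Nice g) (hf : Nice f) : ∃ C, 0 ≤ C ∧
    ∀ u, 0 < u → ∀ x, |(g x * P u f x - P u (fun y => g y * f y) x) * u ^ (-1 - a)| ≤ C * wt a u := by
  obtain ⟨C1, hC1, h1⟩ := G0_bound (a := a) hn (hf.mul hg)
  obtain ⟨C2, hC2, h2⟩ := G0_bound (a := a) hn hf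
  obtain ⟨M, hM, hb⟩ := hg.bm.bd
  refine ⟨C1 + M * C2, by positivity, fun u hu x => ?_⟩
  have e : (g x * P u f x - P u (fun y => g y * f y) x) * u ^ (-1 - a) =
    (g x * f x - P u (fun y => g y * f y) x) * u ^ (-1 - a) - g x * ((f x - P u f x) * u ^ (-1 - a)) := by ring
  rw [e]
  refine (abs_sub _ _).trans ?_
  rw [abs_mul (g x)]
  have := mul_le_mul (hb x) (h2 u hu x) (abs_nonneg _) hM
  have := h1 u hu x
  nlinarith

lemma T0_meas {n : ℕ} {a : ℝ} {g f : En n → ℝ} (hg : BM g) (hf : BM f) :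
    Measurable (Function.uncurry fun u x => (g x * P u f x - P u (fun y => g y * f y) x) * u ^ (-1 - a)) := by
  have := hg.1
  have := hf.1
  simp only [Function.uncurry_def]
  fun_prop

lemma T0_BM {n : ℕ} (hn : 0 < n) {a : ℝ} (h0 : 0 < a) (h1 : a < 1 / 2) {g f : En n → ℝ} (hg : Nice g) (hf : Nice f) :
    BM (T0 a g f) := by
  obtain ⟨C, hC, h⟩ := T0_bound (a := a) hn hg hf
  exact BM_int (T0_meas hg.bm hf.bm) ((wt_integrable h0 h1).const_mul C) h

lemma T0_eq {n : ℕ} (hn : 0 < n) {a : ℝ} (h0 : 0 < a) (h1 : a < 1 / 2) {g f : En n → ℝ} (hg : Nice g) (hf : Nice f) (x : En n) :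
    T0 a g f x = G0 a (fun y => g y * f y) x - g x * G0 a f x := by
  have key : ∀ k : En n → ℝ, Nice k → IntegrableOn (fun u => (k x - P u k x) * u ^ (-1 - a)) (Set.Ioi 0) := by
    intro k hk
    have := hk.bm.1
    obtain ⟨C, hC, h⟩ := G0_bound (a := a) hn hk
    refine Integrable.mono' ((wt_integrable h0 h1).const_mul C) (by fun_prop) ?_
    exact (ae_restrict_iff' measurableSet_Ioi).2 (Eventually.of_forall fun u hu => h u hu x)
  unfold T0 G0
  rw [← integral_const_mul, ← integral_sub (key _ (hf.mul hg)) ((key _ hf).const_mul _)]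
  refine integral_congr_ae (Eventually.of_forall fun u => ?_)
  simp only; ring

lemma T0_pair {n : ℕ} (hn : 0 < n) {a : ℝ} (h0 : 0 < a) (h1 : a < 1 / 2) {g f h : En n → ℝ} (hg : Nice g) (hf : Nice f)
    (hh : BM h) (hi : Integrable h) :
    ENNReal.ofReal |∫ x, h x * T0 a g f x| ≤
      ∫⁻ u in Set.Ioi 0, ENNReal.ofReal (u ^ (-1 - a)) *
        ∑' j : ℕ, (bb g h f u (u / 2 ^ (j + 2)) + bb g f h u (u / 2 ^ (j + 2))) := by
  obtain ⟨C, hC, hb⟩ := T0_bound (a := a) hn hg hf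
  have hhm := hh.1
  set K : En n → ℝ → ℝ := fun x u => h x * ((g x * P u f x - P u (fun y => g y * f y) x) * u ^ (-1 - a)) with hK
  have hKm : Measurable (Function.uncurry K) := by
    have := T0_meas (a := a) hg.bm hf.bm
    have h2 := (this.comp measurable_swap)
    exact (hhm.comp measurable_fst).mul h2
  have hKi : Integrable (Function.uncurry K) (volume.prod (volume.restrict (Set.Ioi 0))) := by
    refine Integrable.mono' (hi.abs.mul_prod ((wt_integrable h0 h1).const_mul C)) hKm.aestronglyMeasurable ?_
    have : volume.prod (volume.restrict (Set.Ioi (0:ℝ))) = (volume.prod volume).restrict ((Set.univ : Set (En n)) ×ˢ Set.Ioi (0:ℝ)) := by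
      rw [← Measure.prod_restrict, Measure.restrict_univ]
    rw [this]
    refine (ae_restrict_iff' (MeasurableSet.univ.prod measurableSet_Ioi)).2 (Eventually.of_forall fun q hq => ?_)
    simp only [Function.uncurry, hK, Real.norm_eq_abs, abs_mul (h q.1)]
    exact mul_le_mul_of_nonneg_left (hb q.2 hq.2 q.1) (abs_nonneg _)
  have e : ∫ x, h x * T0 a g f x = ∫ u in Set.Ioi 0, ∫ x, K x u := by
    rw [← integral_integral_swap hKi]
    refine integral_congr_ae (Eventually.of_forall fun x => ?_)
    simp only [hK, T0]
    rw [integral_const_mul]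
  rw [e, ← Real.norm_eq_abs, ofReal_norm_eq_enorm]
  refine (enorm_integral_le_lintegral_enorm _).trans ?_
  refine setLIntegral_mono' measurableSet_Ioi fun u (hu : 0 < u) => ?_
  have e2 : ∫ x, K x u = u ^ (-1 - a) * ∫ x, h x * (g x * P u f x - P u (fun y => g y * f y) x) := by
    rw [← integral_const_mul]
    refine integral_congr_ae (Eventually.of_forall fun x => ?_)
    simp only [hK]; ring
  rw [e2, ← ofReal_norm_eq_enorm, Real.norm_eq_abs, abs_mul, abs_of_pos (Real.rpow_pos_of_pos hu _),
    ENNReal.ofReal_mul (by positivity)]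
  exact mul_le_mul_right (Du_bound hg hh hf hi hu) _

lemma bb_int {n : ℕ} {a b : ℝ} (hb : 0 ≤ b) {g f h : En n → ℝ} (hg : BM g) (hf : BM f) (hh : BM h)
    {M : En n → ℝ≥0∞} (hM : Measurable M)
    (hMf : ∀ x v, 0 < v → ENNReal.ofReal |P v f x| ≤ ENNReal.ofReal (v ^ (-b)) * M x) (j : ℕ) :
    ∫⁻ u in Set.Ioi 0, ENNReal.ofReal (u ^ (-1 - a)) * bb g h f u (u / 2 ^ (j + 2)) ≤
      ENNReal.ofReal (2 ^ b) * ENNReal.ofReal ((2 ^ (j + 2)) ^ (-(a + b))) *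
      ∫⁻ x, M x * ∫⁻ r, ENNReal.ofReal (r ^ (-(a + b))) * (sg r g x ^ (1 / 2 : ℝ) * sg r h x ^ (1 / 2 : ℝ)) ∂mdt := by
  have hgm := hg.1
  have hfm := hf.1
  have hhm := hh.1
  set c : ℝ := 2 ^ (j + 2) with hc
  have hc0 : 0 < c := by positivity
  have hc4 : 4 ≤ c := by
    rw [hc, pow_add]; nlinarith [one_le_pow₀ (one_le_two (α := ℝ)) (n := j)]
  obtain ⟨φ, hφ⟩ : ∃ φ : ℝ → En n → ℝ≥0∞, φ = fun r x => sg r g x ^ (1 / 2 : ℝ) * sg r h x ^ (1 / 2 : ℝ) := ⟨_, rfl⟩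
  have hφm : Measurable (fun q : ℝ × En n => φ q.1 q.2) := by rw [hφ]; fun_prop
  have hφm1 : ∀ x, Measurable (fun r => φ r x) := fun x => by rw [hφ]; fun_prop
  have hφ' : ∀ r x, sg r g x ^ (1 / 2 : ℝ) * sg r h x ^ (1 / 2 : ℝ) = φ r x := fun r x => by rw [hφ]
  simp only [bb, hφ']
  calc _ ≤ ∫⁻ u in Set.Ioi 0, ∫⁻ x, ENNReal.ofReal (u ^ (-1 - a)) * (ENNReal.ofReal ((u / 2) ^ (-b)) * M x * φ (u / c) x) := by
        refine setLIntegral_mono' measurableSet_Ioi fun u (hu : 0 < u) => ?_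
        have hm1 : Measurable fun x => φ (u / c) x := by rw [hφ]; fun_prop
        rw [← lintegral_const_mul _ (by fun_prop)]
        refine lintegral_mono fun x => mul_le_mul_right (mul_le_mul_left ?_ _) _
        have hv : u / 2 ≤ u - 2 * (u / c) := by
          have : u / c ≤ u / 4 := by gcongr
          linarith
        refine (hMf x _ (by linarith)).trans (mul_le_mul_left (ENNReal.ofReal_le_ofReal ?_) _)
        exact Real.rpow_le_rpow_of_nonpos (by linarith) hv (by linarith)
    _ = ∫⁻ x, ∫⁻ u in Set.Ioi 0, ENNReal.ofReal (u ^ (-1 - a)) * (ENNReal.ofReal ((u / 2) ^ (-b)) * M x * φ (u / c) x) := by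
        refine lintegral_lintegral_swap ?_
        have : Measurable fun q : ℝ × En n => φ (q.1 / c) q.2 :=
          hφm.comp (f := fun q : ℝ × En n => (q.1 / c, q.2)) (by fun_prop)
        simp only [Function.uncurry_def]
        refine Measurable.aemeasurable ?_
        fun_prop
    _ = _ := by
        rw [← lintegral_const_mul]
        swap
        · refine hM.mul (Measurable.lintegral_prod_left' (f := fun q : ℝ × En n => ENNReal.ofReal (q.1 ^ (-(a + b))) * φ q.1 q.2) ?_)
          fun_prop
        refine lintegral_congr fun x => ?_
        have hx := hφm1 x
        have hx2 : Measurable fun u : ℝ => φ (u / c) x := hx.comp (f := fun u : ℝ => u / c) (by fun_prop)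
        rw [lintegral_vol_scale (c := c) (by fun_prop) hc0, lintegral_mdt (by fun_prop), ← lintegral_const_mul _ (by fun_prop),
          ← lintegral_const_mul _ (by fun_prop), ← lintegral_const_mul _ (by fun_prop)]
        refine setLIntegral_congr_fun measurableSet_Ioi fun t (ht : 0 < t) => ?_
        rw [mul_div_cancel_left₀ _ hc0.ne']
        have e : c * (c * t) ^ (-1 - a) * (c * t / 2) ^ (-b) = 2 ^ b * c ^ (-(a + b)) * (t⁻¹ * t ^ (-(a + b))) := by
          rw [Real.mul_rpow hc0.le ht.le, show c * t / 2 = 2⁻¹ * (c * t) by ring, Real.mul_rpow (by norm_num) (by positivity),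
            Real.mul_rpow hc0.le ht.le, Real.inv_rpow (by norm_num), Real.rpow_neg (by norm_num : (0:ℝ) ≤ 2), inv_inv,
            show -1 - a = -a - 1 by ring, Real.rpow_sub_one hc0.ne', Real.rpow_sub_one ht.ne', neg_add,
            Real.rpow_add hc0, Real.rpow_add ht]
          field_simp
        have e' := congrArg ENNReal.ofReal e
        rw [ENNReal.ofReal_mul (by positivity), ENNReal.ofReal_mul (by positivity), ENNReal.ofReal_mul (by positivity),
          ENNReal.ofReal_mul (by positivity), ENNReal.ofReal_mul (by positivity)] at e'
        calc _ = ENNReal.ofReal c * ENNReal.ofReal ((c * t) ^ (-1 - a)) * ENNReal.ofReal ((c * t / 2) ^ (-b)) * (M x * φ t x) := by ring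
          _ = _ := by rw [e']; ring

lemma cs_mdt {n : ℕ} {g h : En n → ℝ} (hg : BM g) (hh : BM h) (a e : ℝ) (x : En n) :
    ∫⁻ r, ENNReal.ofReal (r ^ (-a + e)) * (sg r g x ^ (1 / 2 : ℝ) * sg r h x ^ (1 / 2 : ℝ)) ∂mdt ≤
      (∫⁻ r, ENNReal.ofReal (r ^ (-(2 * a))) * sg r g x ∂mdt) ^ (1 / 2 : ℝ) *
      (∫⁻ r, ENNReal.ofReal (r ^ (2 * e)) * sg r h x ∂mdt) ^ (1 / 2 : ℝ) := by
  have hgm := hg.1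
  have hhm := hh.1
  have hh2 : ∀ X : ℝ≥0∞, (X ^ (1 / 2 : ℝ)) ^ 2 = X := fun X => by
    rw [← ENNReal.rpow_natCast, ← ENNReal.rpow_mul]; norm_num
  have := cs_lintegral mdt (φ := fun r => ENNReal.ofReal (r ^ (-a)) * sg r g x ^ (1 / 2 : ℝ))
    (ψ := fun r => ENNReal.ofReal (r ^ e) * sg r h x ^ (1 / 2 : ℝ)) (by fun_prop) (by fun_prop)
  have hc : ∀ (d : ℝ) (k : En n → ℝ), ∫⁻ r, (ENNReal.ofReal (r ^ d) * sg r k x ^ (1 / 2 : ℝ)) ^ 2 ∂mdt =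
      ∫⁻ r, ENNReal.ofReal (r ^ (2 * d)) * sg r k x ∂mdt := fun d k => by
    refine lintegral_congr_ae (ae_mdt_pos.mono fun r hr => ?_)
    simp only
    rw [mul_pow, hh2, ← ENNReal.ofReal_pow (by positivity), ← Real.rpow_mul_natCast hr.le]
    congr 3; push_cast; ring
  rw [hc, hc] at this
  rw [show -(2 * a) = 2 * (-a) by ring]
  refine le_trans (le_of_eq ?_) this
  refine lintegral_congr_ae (ae_mdt_pos.mono fun r hr => ?_)
  simp only
  rw [Real.rpow_add hr, ENNReal.ofReal_mul (by positivity)]; ring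

lemma geo_sum {α : ℝ} (hα : 0 < α) : ∑' j : ℕ, ENNReal.ofReal ((2 ^ (j + 2)) ^ (-α)) ≠ ⊤ := by
  have h1 : (2:ℝ) ^ (-α) < 1 := Real.rpow_lt_one_of_one_lt_of_neg (by norm_num) (by linarith)
  have : Summable fun j : ℕ => ((2:ℝ) ^ (j + 2)) ^ (-α) := by
    have := (summable_geometric_of_lt_one (by positivity) h1).mul_left (((2:ℝ) ^ (-α)) ^ 2)
    refine this.congr fun j => ?_
    rw [← pow_add, ← Real.rpow_natCast, ← Real.rpow_natCast, ← Real.rpow_mul (by norm_num), ← Real.rpow_mul (by norm_num)]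
    congr 1; push_cast; ring
  rw [← ENNReal.ofReal_tsum_of_nonneg (fun j => by positivity) this]
  exact ENNReal.ofReal_ne_top

lemma bb_meas {n : ℕ} {g f h : En n → ℝ} (hg : BM g) (hf : BM f) (hh : BM h) (c : ℝ) :
    Measurable fun u => bb g h f u (u / c) := by
  have hgm := hg.1
  have hfm := hf.1
  have hhm := hh.1
  unfold bb
  refine Measurable.lintegral_prod_right' (f := fun q : ℝ × En n => ENNReal.ofReal |P (q.1 - 2 * (q.1 / c)) f q.2| *
    (sg (q.1 / c) g q.2 ^ (1 / 2 : ℝ) * sg (q.1 / c) h q.2 ^ (1 / 2 : ℝ))) ?_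
  fun_prop

lemma main_tri {n : ℕ} (hn : 0 < n) {a b : ℝ} (h0 : 0 < a) (h1 : a < 1 / 2) (hb : 0 ≤ b) : ∃ C : ℝ≥0∞, C ≠ ⊤ ∧
    ∀ (g f h : En n → ℝ), Nice g → Nice f → BM h → Integrable h → ∀ Mf Mh : En n → ℝ≥0∞, Measurable Mf → Measurable Mh →
    (∀ x v, 0 < v → ENNReal.ofReal |P v f x| ≤ ENNReal.ofReal (v ^ (-b)) * Mf x) →
    (∀ x v, 0 < v → ENNReal.ofReal |P v h x| ≤ Mh x) →
    ENNReal.ofReal |∫ x, h x * T0 a g f x| ≤ C *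
      ((∫⁻ x, Mf x * ((∫⁻ r, ENNReal.ofReal (r ^ (-(2 * (a + b)))) * sg r g x ∂mdt) ^ (1 / 2 : ℝ) *
          (∫⁻ r, sg r h x ∂mdt) ^ (1 / 2 : ℝ))) +
       ∫⁻ x, Mh x * ((∫⁻ r, ENNReal.ofReal (r ^ (-(2 * (a + b)))) * sg r g x ∂mdt) ^ (1 / 2 : ℝ) *
          (∫⁻ r, ENNReal.ofReal (r ^ (2 * b)) * sg r f x ∂mdt) ^ (1 / 2 : ℝ))) := by
  set S1 := ∑' j : ℕ, ENNReal.ofReal (((2:ℝ) ^ (j + 2)) ^ (-(a + b))) with hS1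
  set S2' := ∑' j : ℕ, ENNReal.ofReal (((2:ℝ) ^ (j + 2)) ^ (-(a + 0))) with hS2
  have hS1t : S1 ≠ ⊤ := geo_sum (by linarith)
  have hS2t : S2' ≠ ⊤ := geo_sum (by linarith)
  refine ⟨ENNReal.ofReal (2 ^ b) * S1 + ENNReal.ofReal (2 ^ (0:ℝ)) * S2', ENNReal.add_ne_top.2
    ⟨ENNReal.mul_ne_top ENNReal.ofReal_ne_top hS1t, ENNReal.mul_ne_top ENNReal.ofReal_ne_top hS2t⟩, ?_⟩
  intro g f h hg hf hh hi Mf Mh hMf hMh hbf hbh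
  refine (T0_pair hn h0 h1 hg hf hh hi).trans ?_
  have m1 : ∀ j : ℕ, Measurable fun u => bb g h f u (u / 2 ^ (j + 2)) := fun j => bb_meas hg.bm hf.bm hh _
  have m2 : ∀ j : ℕ, Measurable fun u => bb g f h u (u / 2 ^ (j + 2)) := fun j => bb_meas hg.bm hh hf.bm _
  set I1 := ∫⁻ x, Mf x * ((∫⁻ r, ENNReal.ofReal (r ^ (-(2 * (a + b)))) * sg r g x ∂mdt) ^ (1 / 2 : ℝ) *
          (∫⁻ r, sg r h x ∂mdt) ^ (1 / 2 : ℝ)) with hI1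
  set I2 := ∫⁻ x, Mh x * ((∫⁻ r, ENNReal.ofReal (r ^ (-(2 * (a + b)))) * sg r g x ∂mdt) ^ (1 / 2 : ℝ) *
          (∫⁻ r, ENNReal.ofReal (r ^ (2 * b)) * sg r f x ∂mdt) ^ (1 / 2 : ℝ)) with hI2
  have hsw : ∫⁻ u in Set.Ioi 0, ENNReal.ofReal (u ^ (-1 - a)) *
        ∑' j : ℕ, (bb g h f u (u / 2 ^ (j + 2)) + bb g f h u (u / 2 ^ (j + 2))) =
      ∑' j : ℕ, ∫⁻ u in Set.Ioi 0, (ENNReal.ofReal (u ^ (-1 - a)) * bb g h f u (u / 2 ^ (j + 2)) +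
        ENNReal.ofReal (u ^ (-1 - a)) * bb g f h u (u / 2 ^ (j + 2))) := by
    rw [← lintegral_tsum (fun j => by have := m1 j; have := m2 j; fun_prop)]
    refine lintegral_congr fun u => ?_
    rw [← ENNReal.tsum_mul_left]
    simp_rw [mul_add]
  rw [hsw]
  have hj : ∀ j : ℕ, ∫⁻ u in Set.Ioi 0, (ENNReal.ofReal (u ^ (-1 - a)) * bb g h f u (u / 2 ^ (j + 2)) +
        ENNReal.ofReal (u ^ (-1 - a)) * bb g f h u (u / 2 ^ (j + 2))) ≤
      ENNReal.ofReal (2 ^ b) * ENNReal.ofReal ((2 ^ (j + 2)) ^ (-(a + b))) * I1 +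
      ENNReal.ofReal (2 ^ (0:ℝ)) * ENNReal.ofReal ((2 ^ (j + 2)) ^ (-(a + 0))) * I2 := by
    intro j
    have := m1 j
    have := m2 j
    rw [lintegral_add_left (by fun_prop)]
    refine add_le_add ?_ ?_
    · refine (bb_int hb hg.bm hf.bm hh hMf hbf j).trans (mul_le_mul_right (lintegral_mono fun x => mul_le_mul_right ?_ _) _)
      have := cs_mdt hg.bm hh (a + b) 0 x
      simpa using this
    · refine (bb_int le_rfl hg.bm hh hf.bm hMh (fun x v hv => by simpa using hbh x v hv) j).trans
        (mul_le_mul_right (lintegral_mono fun x => mul_le_mul_right ?_ _) _)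
      have := cs_mdt hg.bm hf.bm (a + b) b x
      rwa [show -(a + b) + b = -(a + 0) by ring] at this
  refine (ENNReal.tsum_le_tsum hj).trans ?_
  rw [ENNReal.tsum_add, ENNReal.tsum_mul_right, ENNReal.tsum_mul_right, ENNReal.tsum_mul_left, ENNReal.tsum_mul_left]
  rw [mul_add]
  exact add_le_add (mul_le_mul' le_self_add le_rfl) (mul_le_mul' le_add_self le_rfl)

def Fb {n : ℕ} (b : ℝ) (f : En n → ℝ) : En n → ℝ := if b = 0 then f else F0 b f

def NL {n : ℕ} (q : ℝ) (φ : En n → ℝ) : ℝ≥0∞ := (∫⁻ x, ENNReal.ofReal |φ x| ^ q) ^ (1 / q)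

lemma P_le_Mx {n : ℕ} {f : En n → ℝ} (hf : BM f) {v : ℝ} (hv : 0 < v) (x : En n) :
    ENNReal.ofReal |P v f x| ≤ ENNReal.ofReal (2 ^ ((n : ℝ) / 2)) * Mx (fun y => ENNReal.ofReal |f y|) x := by
  have hfm := hf.1
  refine le_trans ?_ (PE_le_Mx (by fun_prop) hv x)
  have := enorm_P_le f v x
  simpa only [← ofReal_norm_eq_enorm, Real.norm_eq_abs] using this

lemma pack {n : ℕ} (hn : 0 < n) {b : ℝ} (h0 : 0 ≤ b) (h1 : b < 1 / 2) : ∃ C : ℝ≥0∞, C ≠ ⊤ ∧ ∀ f : En n → ℝ, Nice f →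
    BM (Fb b f) ∧ (∀ x, ∫⁻ r, ENNReal.ofReal (r ^ (2 * b)) * sg r f x ∂mdt ≤ C * S2 (Fb b f) x) ∧
    (∀ x v, 0 < v → ENNReal.ofReal |P v f x| ≤ ENNReal.ofReal (v ^ (-b)) * (C * Mx (fun y => ENNReal.ofReal |Fb b f y|) x)) := by
  rcases h0.eq_or_lt with rfl | h0
  · obtain ⟨C, hC, h⟩ := Sh_bound n
    refine ⟨C + ENNReal.ofReal (2 ^ ((n : ℝ) / 2)), ENNReal.add_ne_top.2 ⟨hC, ENNReal.ofReal_ne_top⟩, fun f hf => ?_⟩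
    simp only [Fb, if_true]
    refine ⟨hf.bm, fun x => ?_, fun x v hv => ?_⟩
    · have := h f hf.bm x
      simp only [mul_zero, Real.rpow_zero, ENNReal.ofReal_one, one_mul]
      exact this.trans (mul_le_mul_left le_self_add _)
    · simp only [neg_zero, Real.rpow_zero, ENNReal.ofReal_one, one_mul]
      exact (P_le_Mx hf.bm hv x).trans (mul_le_mul_left le_add_self _)
  · obtain ⟨C, hC, h⟩ := Sf_bound hn h0 h1
    obtain ⟨C', hC', h'⟩ := Mf_bound hn h0 h1
    refine ⟨C + C', ENNReal.add_ne_top.2 ⟨hC, hC'⟩, fun f hf => ?_⟩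
    simp only [Fb, h0.ne', if_false]
    refine ⟨F0_BM hn hf h0 h1, fun x => (h f hf x).trans (mul_le_mul_left le_self_add _), fun x v hv => (h' f hf x v hv).trans ?_⟩
    rw [mul_comm C', mul_assoc]
    exact mul_le_mul_right (mul_le_mul_left le_add_self _) _

lemma holder3 {α : Type*} [MeasurableSpace α] (μ : Measure α) {A B D : α → ℝ≥0∞} (hA : Measurable A) (hB : Measurable B)
    (hD : Measurable D) {p q r : ℝ} (hp : 0 < p) (hq : 0 < q) (hr : 0 < r) (h : 1 / p + 1 / q + 1 / r = 1) :
    ∫⁻ x, A x * (B x * D x) ∂μ ≤ (∫⁻ x, A x ^ p ∂μ) ^ (1 / p) * ((∫⁻ x, B x ^ q ∂μ) ^ (1 / q) * (∫⁻ x, D x ^ r ∂μ) ^ (1 / r)) := by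
  have := ENNReal.lintegral_prod_norm_pow_le (μ := μ) (Finset.univ : Finset (Fin 3))
    (f := ![fun x => A x ^ p, fun x => B x ^ q, fun x => D x ^ r]) (p := ![1 / p, 1 / q, 1 / r])
    (by intro i _; fin_cases i <;> simp <;> fun_prop)
    (by simp [Fin.sum_univ_three]; simpa using h) (by intro i _; fin_cases i <;> simp <;> positivity)
  simp only [Fin.prod_univ_three, Matrix.cons_val_zero, Matrix.cons_val_one, Matrix.cons_val, mul_assoc,
    ← ENNReal.rpow_mul, mul_one_div_cancel hp.ne', mul_one_div_cancel hq.ne', mul_one_div_cancel hr.ne', ENNReal.rpow_one] at this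
  exact this

lemma L_sq {n : ℕ} (hn : 0 < n) {q : ℝ} (hq : 1 < q) {C : ℝ≥0∞} (hC : C ≠ ⊤) : ∃ K : ℝ≥0∞, K ≠ ⊤ ∧ ∀ (G : En n → ℝ) (X : En n → ℝ≥0∞),
    BM G → (∀ x, X x ≤ C * S2 G x) → (∫⁻ x, (X x ^ (1 / 2 : ℝ)) ^ q) ^ (1 / q) ≤ K * NL q G := by
  obtain ⟨C', hC', h⟩ := sq_main (n := n) hn hq
  have hq0 : 0 < q := by linarith
  refine ⟨(C ^ (q / 2) * C') ^ (1 / q), ENNReal.rpow_ne_top_of_nonneg (by positivity)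
    (ENNReal.mul_ne_top (ENNReal.rpow_ne_top_of_nonneg (by positivity) hC) hC'), fun G X hG hX => ?_⟩
  have hGm := hG.1
  unfold NL
  rw [← ENNReal.mul_rpow_of_nonneg _ _ (by positivity)]
  refine ENNReal.rpow_le_rpow ?_ (by positivity)
  calc _ ≤ ∫⁻ x, C ^ (q / 2) * S2 G x ^ (q / 2) := by
        refine lintegral_mono fun x => ?_
        rw [← ENNReal.rpow_mul, ← ENNReal.mul_rpow_of_nonneg _ _ (by positivity), show 1 / 2 * q = q / 2 by ring]
        exact ENNReal.rpow_le_rpow (hX x) (by positivity)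
    _ ≤ _ := by
        rw [lintegral_const_mul _ (by fun_prop), mul_assoc]
        exact mul_le_mul_right (h G hG) _

lemma L_Mx {n : ℕ} (hn : 0 < n) {q : ℝ} (hq : 1 < q) {C : ℝ≥0∞} (hC : C ≠ ⊤) : ∃ K : ℝ≥0∞, K ≠ ⊤ ∧ ∀ (G : En n → ℝ),
    BM G → (∫⁻ x, (C * Mx (fun y => ENNReal.ofReal |G y|) x) ^ q) ^ (1 / q) ≤ K * NL q G := by
  obtain ⟨C', hC', h⟩ := strong_type (n := n) hn hq
  have hq0 : 0 < q := by linarith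
  refine ⟨(C ^ q * C') ^ (1 / q), ENNReal.rpow_ne_top_of_nonneg (by positivity)
    (ENNReal.mul_ne_top (ENNReal.rpow_ne_top_of_nonneg (by positivity) hC) hC'), fun G hG => ?_⟩
  have hGm := hG.1
  unfold NL
  rw [← ENNReal.mul_rpow_of_nonneg _ _ (by positivity)]
  refine ENNReal.rpow_le_rpow ?_ (by positivity)
  obtain ⟨M, hM, hb⟩ := hG.bd
  simp_rw [ENNReal.mul_rpow_of_nonneg _ _ hq0.le]
  rw [lintegral_const_mul' _ _ (ENNReal.rpow_ne_top_of_nonneg (by positivity) hC), mul_assoc]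
  exact mul_le_mul_right (h (fun y => |G y|) (by fun_prop) (fun _ => abs_nonneg _) ⟨M, hb⟩) _

lemma main_dual {n : ℕ} (hn : 0 < n) {a b q₁ q₂ p' : ℝ} (h0 : 0 < a) (hb : 0 ≤ b) (hab : a + b < 1 / 2)
    (hq₁ : 1 < q₁) (hq₂ : 1 < q₂) (hp' : 1 < p') (hpq : 1 / q₁ + 1 / q₂ + 1 / p' = 1) : ∃ C : ℝ≥0∞, C ≠ ⊤ ∧
    ∀ (g f h : En n → ℝ), Nice g → Nice f → BM h → Integrable h →
    ENNReal.ofReal |∫ x, h x * T0 a g f x| ≤ C * (NL q₁ (G0 (a + b) g) * NL q₂ (Fb b f) * NL p' h) := by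
  obtain ⟨C1, hC1, k1⟩ := main_tri hn h0 (by linarith) hb
  obtain ⟨C2, hC2, k2⟩ := pack hn hb (by linarith)
  obtain ⟨C3, hC3, k3⟩ := Sg_bound hn (a := a + b) (by linarith) hab
  obtain ⟨C4, hC4, k4⟩ := Sh_bound n
  obtain ⟨K1, hK1, l1⟩ := L_sq hn hq₁ hC3
  obtain ⟨K2, hK2, l2⟩ := L_sq hn hq₂ hC2
  obtain ⟨K3, hK3, l3⟩ := L_sq hn hp' hC4
  obtain ⟨K4, hK4, l4⟩ := L_Mx hn hq₂ hC2
  obtain ⟨K5, hK5, l5⟩ := L_Mx hn hp' (C := ENNReal.ofReal (2 ^ ((n : ℝ) / 2))) ENNReal.ofReal_ne_top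
  refine ⟨C1 * (K4 * (K1 * K3) + K5 * (K1 * K2)), ENNReal.mul_ne_top hC1 (ENNReal.add_ne_top.2
    ⟨ENNReal.mul_ne_top hK4 (ENNReal.mul_ne_top hK1 hK3), ENNReal.mul_ne_top hK5 (ENNReal.mul_ne_top hK1 hK2)⟩), ?_⟩
  intro g f h hg hf hh hi
  have hG := G0_BM hn hg (a := a + b) (by linarith) hab
  obtain ⟨hF, k2a, k2b⟩ := k2 f hf
  have hgm := hg.bm.1
  have hfm := hf.bm.1
  have hhm := hh.1
  have hFm := hF.1
  have mG : Measurable fun x => (∫⁻ r, ENNReal.ofReal (r ^ (-(2 * (a + b)))) * sg r g x ∂mdt) :=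
    Measurable.lintegral_prod_left' (f := fun q : ℝ × En n => ENNReal.ofReal (q.1 ^ (-(2 * (a + b)))) * sg q.1 g q.2) (by fun_prop)
  have mF : Measurable fun x => (∫⁻ r, ENNReal.ofReal (r ^ (2 * b)) * sg r f x ∂mdt) :=
    Measurable.lintegral_prod_left' (f := fun q : ℝ × En n => ENNReal.ofReal (q.1 ^ (2 * b)) * sg q.1 f q.2) (by fun_prop)
  have mH : Measurable fun x => (∫⁻ r, sg r h x ∂mdt) :=
    Measurable.lintegral_prod_left' (f := fun q : ℝ × En n => sg q.1 h q.2) (by fun_prop)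
  have mMf : Measurable fun x => C2 * Mx (fun y => ENNReal.ofReal |Fb b f y|) x :=
    (measurable_Mx (by fun_prop)).const_mul _
  have mMh : Measurable fun x => ENNReal.ofReal (2 ^ ((n : ℝ) / 2)) * Mx (fun y => ENNReal.ofReal |h y|) x :=
    (measurable_Mx (by fun_prop)).const_mul _
  refine (k1 g f h hg hf hh hi _ _ mMf mMh k2b (fun x v hv => P_le_Mx hh hv x)).trans ?_
  rw [mul_assoc]
  refine mul_le_mul_right ?_ _
  rw [add_mul]
  have hx1 : 0 < q₁ := by linarith
  have hx2 : 0 < q₂ := by linarith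
  have hx3 : 0 < p' := by linarith
  refine add_le_add ?_ ?_
  · refine (holder3 _ mMf (mG.pow_const _) (mH.pow_const _) hx2 hx1 hx3 (by linarith)).trans ?_
    refine (mul_le_mul' (l4 _ hF) (mul_le_mul' (l1 _ _ hG (k3 g hg)) (l3 _ _ hh (k4 h hh)))).trans (le_of_eq ?_)
    ring
  · refine (holder3 _ mMh (mG.pow_const _) (mF.pow_const _) hx3 hx1 hx2 (by linarith)).trans ?_
    refine (mul_le_mul' (l5 _ hh) (mul_le_mul' (l1 _ _ hG (k3 g hg)) (l2 _ _ hF k2a))).trans (le_of_eq ?_)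
    ring

lemma main_T0 {n : ℕ} (hn : 0 < n) {a b q₁ q₂ p : ℝ} (h0 : 0 < a) (hb : 0 ≤ b) (hab : a + b < 1 / 2)
    (hq₁ : 1 < q₁) (hq₂ : 1 < q₂) (hp : 1 < p) (hpq : 1 / q₁ + 1 / q₂ = 1 / p) : ∃ C : ℝ≥0∞, C ≠ ⊤ ∧
    ∀ (g f : En n → ℝ), Nice g → Nice f →
    NL p (T0 a g f) ≤ C * (NL q₁ (G0 (a + b) g) * NL q₂ (Fb b f)) := by
  have hp0 : 0 < p := by linarith
  have hp1 : 0 < p - 1 := by linarith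
  obtain ⟨C, hC, k⟩ := main_dual hn (p' := p / (p - 1)) h0 hb hab hq₁ hq₂ (by rw [lt_div_iff₀ hp1]; linarith)
    (by rw [hpq]; field_simp; ring)
  refine ⟨C, hC, fun g f hg hf => ?_⟩
  set T := T0 a g f with hTd
  have hT : BM T := T0_BM hn h0 (by linarith) hg hf
  have hTm := hT.1
  obtain ⟨M, hM, hMb⟩ := hT.bd
  set K := C * (NL q₁ (G0 (a + b) g) * NL q₂ (Fb b f)) with hK
  -- truncated estimate
  have hN : ∀ N : ℕ, ∫⁻ x in Metric.closedBall (0 : En n) N, ENNReal.ofReal |T x| ^ p ≤ K ^ p := by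
    intro N
    set B := Metric.closedBall (0 : En n) N with hB
    have hBm : MeasurableSet B := measurableSet_closedBall
    have hBv : volume B ≠ ⊤ := measure_closedBall_lt_top.ne
    set h : En n → ℝ := B.indicator (fun x => SignType.sign (T x) * |T x| ^ (p - 1)) with hh
    have hsgn : Measurable fun x => ((SignType.sign (T x) : SignType) : ℝ) := by
      have : ∀ x, ((SignType.sign (T x) : SignType) : ℝ) = Real.sign (T x) := fun x => by
        rcases lt_trichotomy (T x) 0 with h | h | h
        · simp [h, Real.sign_of_neg]
        · simp [h]
        · simp [h, Real.sign_of_pos]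
      simp_rw [this]
      unfold Real.sign
      exact Measurable.ite (measurableSet_lt hTm measurable_const) measurable_const
        (Measurable.ite (measurableSet_lt measurable_const hTm) measurable_const measurable_const)
    have hmeas : Measurable h := (hsgn.mul (by fun_prop)).indicator hBm
    have habs : ∀ x ∈ B, |h x| = |T x| ^ (p - 1) := by
      intro x hx
      rw [hh, Set.indicator_of_mem hx, abs_mul, abs_of_nonneg (Real.rpow_nonneg (abs_nonneg _) _)]
      rcases lt_trichotomy (T x) 0 with h | h | h
      · simp [h]
      · simp [h, Real.zero_rpow hp1.ne']
      · simp [h]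
    have hout : ∀ x ∉ B, h x = 0 := fun x hx => by rw [hh, Set.indicator_of_notMem hx]
    have hhB : BM h := ⟨hmeas, M ^ (p - 1), fun x => by
      by_cases hx : x ∈ B
      · rw [habs x hx]; exact Real.rpow_le_rpow (abs_nonneg _) (hMb x) hp1.le
      · rw [hout x hx]; simp; positivity⟩
    have hhi : Integrable h := by
      have : IntegrableOn (fun _ => M ^ (p - 1)) B (volume : Measure (En n)) := integrableOn_const hBv
      refine Integrable.mono' (this.integrable_indicator hBm) hmeas.aestronglyMeasurable (Eventually.of_forall fun x => ?_)
      by_cases hx : x ∈ B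
      · rw [Real.norm_eq_abs, habs x hx, Set.indicator_of_mem hx]; exact Real.rpow_le_rpow (abs_nonneg _) (hMb x) hp1.le
      · rw [hout x hx, Set.indicator_of_notMem hx]; simp
    set A := ∫⁻ x in B, ENNReal.ofReal |T x| ^ p with hA
    have hAt : A ≠ ⊤ := by
      refine ne_top_of_le_ne_top ?_ (setLIntegral_mono' (g := fun _ => ENNReal.ofReal M ^ p) hBm fun x _ =>
        ENNReal.rpow_le_rpow (ENNReal.ofReal_le_ofReal (hMb x)) hp0.le)
      rw [setLIntegral_const]
      exact ENNReal.mul_ne_top (ENNReal.rpow_ne_top_of_nonneg hp0.le ENNReal.ofReal_ne_top) hBv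
    have hprod : ∀ x, h x * T x = B.indicator (fun x => |T x| ^ p) x := by
      intro x
      by_cases hx : x ∈ B
      · rw [hh, Set.indicator_of_mem hx, Set.indicator_of_mem hx]
        rcases eq_or_ne (T x) 0 with h | h
        · simp [h, Real.zero_rpow hp0.ne']
        · have : |T x| ^ p = |T x| ^ (p - 1) * |T x| := by
            rw [Real.rpow_sub_one (abs_ne_zero.2 h)]; field_simp
          rw [this]
          have : (SignType.sign (T x) : ℝ) * T x = |T x| := sign_mul_self _
          linear_combination |T x| ^ (p - 1) * this
      · rw [hout x hx, Set.indicator_of_notMem hx, zero_mul]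
    have hinteg : ENNReal.ofReal |∫ x, h x * T x| = A := by
      simp_rw [hprod]
      rw [integral_indicator hBm, abs_of_nonneg (integral_nonneg fun x => by positivity),
        ofReal_integral_eq_lintegral_ofReal]
      · refine lintegral_congr fun x => ?_
        rw [ENNReal.ofReal_rpow_of_nonneg (abs_nonneg _) hp0.le]
      · have : IntegrableOn (fun _ => M ^ p) B (volume : Measure (En n)) := integrableOn_const hBv
        refine Integrable.mono' this (hTm.abs.pow_const p).aestronglyMeasurable (Eventually.of_forall fun x => ?_)
        rw [Real.norm_eq_abs, abs_of_nonneg (by positivity)]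
        exact Real.rpow_le_rpow (abs_nonneg _) (hMb x) hp0.le
      · exact Eventually.of_forall fun x => by positivity
    have hnl : NL (p / (p - 1)) h = A ^ (1 - 1 / p) := by
      unfold NL
      rw [show 1 / (p / (p - 1)) = 1 - 1 / p by field_simp]
      congr 1
      rw [hA, ← lintegral_indicator hBm]
      refine lintegral_congr fun x => ?_
      by_cases hx : x ∈ B
      · rw [habs x hx, Set.indicator_of_mem hx, ← ENNReal.ofReal_rpow_of_nonneg (abs_nonneg _) hp1.le, ← ENNReal.rpow_mul,
          mul_div_cancel₀ _ hp1.ne']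
      · rw [hout x hx, Set.indicator_of_notMem hx, abs_zero, ENNReal.ofReal_zero, ENNReal.zero_rpow_of_pos (by positivity)]
    have key := k g f h hg hf hhB hhi
    rw [← hTd, hinteg, hnl, ← mul_assoc, ← hK] at key
    have := div_trick (θ := 1 / p) (A := A) (K := K) (I := 1) (by positivity) hAt (by simpa using key)
    simpa using this
  have hlim : ∫⁻ x, ENNReal.ofReal |T x| ^ p ≤ K ^ p := by
    have hmono : Monotone fun N : ℕ => Metric.closedBall (0 : En n) (N : ℝ) := fun i j hij =>
      Metric.closedBall_subset_closedBall (by exact_mod_cast hij)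
    have := setLIntegral_iUnion_of_directed (μ := volume) (fun x => ENNReal.ofReal |T x| ^ p) hmono.directed_le
    rw [Metric.iUnion_closedBall_nat, Measure.restrict_univ] at this
    rw [this]
    exact iSup_le hN
  unfold NL
  calc _ ≤ (K ^ p) ^ (1 / p) := ENNReal.rpow_le_rpow hlim (by positivity)
    _ = K := by rw [← ENNReal.rpow_mul, mul_one_div_cancel hp0.ne', ENNReal.rpow_one]

lemma ker_int {n : ℕ} {e : ℝ} (he : 0 < (n : ℝ) / 2 + e) {z : En n} (hz : z ≠ 0) :
    ∫ u in Set.Ioi 0, hk u z * u ^ (-1 - e) =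
      Real.Gamma ((n : ℝ) / 2 + e) * π ^ (-((n : ℝ) / 2 + e)) * ‖z‖ ^ (-((n : ℝ) + 2 * e)) := by
  have hz0 : 0 < ‖z‖ := norm_pos_iff.2 hz
  have hp := Real.pi_pos
  rw [← integral_comp_rpow_Ioi (fun u => hk u z * u ^ (-1 - e)) (p := -1) (by norm_num)]
  have h1 := Real.integral_rpow_mul_exp_neg_mul_Ioi (a := (n : ℝ) / 2 + e) (r := π * ‖z‖ ^ 2) he (by positivity)
  calc _ = ∫ t in Set.Ioi 0, t ^ ((n : ℝ) / 2 + e - 1) * Real.exp (-(π * ‖z‖ ^ 2 * t)) := by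
        refine setIntegral_congr_fun measurableSet_Ioi fun t (ht : 0 < t) => ?_
        simp only [hk, smul_eq_mul]
        rw [← Real.rpow_mul ht.le, ← Real.rpow_mul ht.le, Real.rpow_neg_one t,
          show -(π / t⁻¹) * ‖z‖ ^ 2 = -(π * ‖z‖ ^ 2 * t) by field_simp]
        rw [show |(-1 : ℝ)| = 1 by norm_num, one_mul]
        rw [show t ^ (-1 - 1 : ℝ) * (t ^ (-1 * (-(n : ℝ) / 2)) * rexp (-(π * ‖z‖ ^ 2 * t)) * t ^ (-1 * (-1 - e))) =
          (t ^ (-1 - 1 : ℝ) * t ^ (-1 * (-(n : ℝ) / 2)) * t ^ (-1 * (-1 - e))) * rexp (-(π * ‖z‖ ^ 2 * t)) by ring,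
          ← Real.rpow_add ht, ← Real.rpow_add ht]
        congr 2; ring
    _ = _ := by
        rw [h1, one_div, Real.inv_rpow (by positivity), ← Real.rpow_neg (by positivity), Real.mul_rpow hp.le (by positivity),
          ← Real.rpow_natCast, ← Real.rpow_mul hz0.le]
        rw [show ((2:ℕ):ℝ) * -((n : ℝ) / 2 + e) = -((n : ℝ) + 2 * e) by push_cast; ring]
        ring

lemma fub {n : ℕ} (hn : 0 < n) {k : En n → ℝ} (hk' : BM k) {e : ℝ} (he : 0 < (n : ℝ) / 2 + e) (x : En n)
    (hi : IntegrableOn (fun u => P u (fun y => |k y|) x * u ^ (-1 - e)) (Set.Ioi 0)) :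
    ∫ u in Set.Ioi 0, P u k x * u ^ (-1 - e) =
      Real.Gamma ((n : ℝ) / 2 + e) * π ^ (-((n : ℝ) / 2 + e)) * ∫ y, ‖x - y‖ ^ (-((n : ℝ) + 2 * e)) * k y := by
  have hkm := hk'.1
  set f : ℝ → En n → ℝ := fun u y => hk u (x - y) * k y * u ^ (-1 - e) with hf
  have hfm : Measurable (Function.uncurry f) := by
    simp only [hf, Function.uncurry_def]; fun_prop
  have hfi : Integrable (Function.uncurry f) ((volume.restrict (Set.Ioi 0)).prod volume) := by
    rw [integrable_prod_iff hfm.aestronglyMeasurable]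
    constructor
    · refine (ae_restrict_iff' measurableSet_Ioi).2 (Eventually.of_forall fun u (hu : 0 < u) => ?_)
      show Integrable (fun y => hk u (x - y) * k y * u ^ (-1 - e)) volume
      exact (hk'.int_hk hu x).mul_const (u ^ (-1 - e))
    · refine hi.congr ((ae_restrict_iff' measurableSet_Ioi).2 (Eventually.of_forall fun u (hu : 0 < u) => ?_))
      simp only
      rw [P_pos_eq hu, ← integral_mul_const]
      refine integral_congr_ae (Eventually.of_forall fun y => ?_)
      simp only [Function.uncurry, hf, norm_mul, Real.norm_eq_abs]
      rw [abs_of_pos (hk_pos hu _), abs_of_pos (Real.rpow_pos_of_pos hu _)]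
  calc _ = ∫ u in Set.Ioi 0, ∫ y, f u y := by
        refine setIntegral_congr_fun measurableSet_Ioi fun u (hu : 0 < u) => ?_
        simp only [hf]
        rw [P_pos_eq hu, ← integral_mul_const]
    _ = ∫ y, ∫ u in Set.Ioi 0, f u y := integral_integral_swap hfi
    _ = _ := by
        rw [← integral_const_mul]
        haveI : Nonempty (Fin n) := ⟨⟨0, hn⟩⟩
        have hne : ∀ᵐ y : En n, y ≠ x := by
          rw [ae_iff]; simp
        refine integral_congr_ae (hne.mono fun y hy => ?_)
        simp only [hf]
        rw [← mul_assoc, ← ker_int he (sub_ne_zero.2 hy.symm), ← integral_mul_const]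
        refine integral_congr_ae (Eventually.of_forall fun u => ?_)
        simp only; ring

lemma fracLap_eq {n : ℕ} (hn : 0 < n) {a : ℝ} (h0 : 0 < a) (h1 : a < 1 / 2) : ∃ c : ℝ, c ≠ 0 ∧ ∀ g : En n → ℝ, Nice g →
    ∀ x, fracLapN a g x = c * G0 a g x := by
  have hp := Real.pi_pos
  have he : 0 < (n : ℝ) / 2 + a := by positivity
  have hG1 := Real.Gamma_pos_of_pos he
  have hG2 : Real.Gamma (((n : ℝ) + 2 * a) / 2) ≠ 0 := (Real.Gamma_pos_of_pos (by positivity)).ne'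
  have hG3 : Real.Gamma (-a) ≠ 0 := by
    refine Real.Gamma_ne_zero fun m => ?_
    intro h
    have h2 : a = (m : ℝ) := by linarith
    rcases m with _ | m
    · simp at h2; linarith
    · push_cast at h2; linarith [(Nat.cast_nonneg m : (0:ℝ) ≤ m)]
  set κ := Real.Gamma ((n : ℝ) / 2 + a) * π ^ (-((n : ℝ) / 2 + a)) with hκ
  have hκ0 : κ ≠ 0 := by positivity
  refine ⟨(Real.Gamma (((n : ℝ) + 2 * a) / 2) / ((2 : ℝ) ^ (-(2 * a)) * Real.pi ^ ((n : ℝ) / 2) * |Real.Gamma (-a)|)) / κ,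
    ?_, fun g hg x => ?_⟩
  · have := abs_pos.2 hG3
    positivity
  have hgm := hg.bm.1
  have bmk : BM (fun y => g x - g y) := (BM.const (g x)).sub hg.bm
  have bmk' := bmk.abs
  have hi : IntegrableOn (fun u => P u (fun y => |g x - g y|) x * u ^ (-1 - a)) (Set.Ioi 0) := by
    obtain ⟨M, hM, hb⟩ := bmk'.bd
    obtain ⟨L, hL, hl⟩ := hg.lip
    have hl' : ∀ y z, |(|g x - g y|) - (|g x - g z|)| ≤ L * ‖y - z‖ := fun y z => by
      refine (abs_abs_sub_abs_le _ _).trans ?_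
      rw [show g x - g y - (g x - g z) = -(g y - g z) by ring, abs_neg]
      exact hl y z
    set K := max M (L * (3 * 2 ^ ((n : ℝ) / 2))) with hK
    have hkm := bmk'.1
    refine Integrable.mono' ((wt_integrable h0 h1).const_mul K) ?_ ?_
    · exact Measurable.aestronglyMeasurable (by fun_prop)
    refine (ae_restrict_iff' measurableSet_Ioi).2 (Eventually.of_forall fun u (hu : 0 < u) => ?_)
    have a1 := P_abs_le hb u x
    have a2 := P_dist bmk' hL hl' hu x
    rw [Real.norm_eq_abs, abs_mul, abs_of_pos (Real.rpow_pos_of_pos hu _), wt, ← mul_assoc]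
    simp only [sub_self, abs_zero, zero_sub, abs_neg] at a2
    refine mul_le_mul_of_nonneg_right ?_ (by positivity)
    rcases le_total 1 √u with h | h
    · rw [min_eq_left h, mul_one]; exact a1.trans (le_max_left _ _)
    · rw [min_eq_right h]; exact a2.trans (mul_le_mul_of_nonneg_right (le_max_right _ _) (Real.sqrt_nonneg _))
  have key := fub hn bmk he x hi
  have e : G0 a g x = ∫ u in Set.Ioi 0, P u (fun y => g x - g y) x * u ^ (-1 - a) := by
    unfold G0
    refine integral_congr_ae (Eventually.of_forall fun u => ?_)
    simp only
    rw [P_sub (BM.const (g x)) hg.bm, P_const]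
  rw [e, key, ← hκ, ← mul_assoc, div_mul_cancel₀ _ hκ0]
  rfl

lemma Nice.abs {n : ℕ} {f : En n → ℝ} (hf : Nice f) : Nice (fun y => |f y|) := by
  obtain ⟨L, hL, hl⟩ := hf.lip
  exact ⟨hf.bm.abs, ⟨L, hL, fun x y => (abs_abs_sub_abs_le _ _).trans (hl x y)⟩, hf.int.abs⟩

lemma riesz_eq {n : ℕ} (hn : 0 < n) {b : ℝ} (h0 : 0 ≤ b) (h1 : b < 1 / 2) : ∃ c : ℝ, c ≠ 0 ∧ ∀ f : En n → ℝ, Nice f →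
    ∀ x, rieszPotI (2 * b) f x = c * Fb b f x := by
  rcases h0.eq_or_lt with rfl | h0
  · exact ⟨1, one_ne_zero, fun f hf x => by simp [rieszPotI, Fb]⟩
  have hp := Real.pi_pos
  have hn1 : (1 : ℝ) ≤ n := by exact_mod_cast hn
  have he : 0 < (n : ℝ) / 2 + -b := by linarith
  have hG1 := Real.Gamma_pos_of_pos he
  have hG2 := (Real.Gamma_pos_of_pos (show 0 < ((n : ℝ) - 2 * b) / 2 by linarith))
  have hG3 := (Real.Gamma_pos_of_pos (show 0 < 2 * b / 2 by linarith))
  set κ := Real.Gamma ((n : ℝ) / 2 + -b) * π ^ (-((n : ℝ) / 2 + -b)) with hκ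
  have hκ0 : κ ≠ 0 := by positivity
  refine ⟨(Real.Gamma (((n : ℝ) - 2 * b) / 2) / (Real.pi ^ ((n : ℝ) / 2) * (2 : ℝ) ^ (2 * b) * Real.Gamma (2 * b / 2))) / κ,
    by positivity, fun f hf x => ?_⟩
  have hi : IntegrableOn (fun u => P u (fun y => |f y|) x * u ^ (-1 - -b)) (Set.Ioi 0) := by
    have := (P_F0 hn hf.abs h0 h1 le_rfl x).2
    simpa only [zero_add, sub_neg_eq_add, neg_add_eq_sub] using this
  have key := fub hn hf.bm he x hi
  have e : F0 b f x = ∫ u in Set.Ioi 0, P u f x * u ^ (-1 - -b) := by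
    unfold F0
    simp only [sub_neg_eq_add, neg_add_eq_sub]
  simp only [rieszPotI, Fb, h0.ne', if_false, mul_eq_zero, OfNat.ofNat_ne_zero, or_self]
  rw [e, key, ← hκ, ← mul_assoc, div_mul_cancel₀ _ hκ0]
  unfold rieszPotN
  congr 2
  ext y
  congr 2; ring

lemma nice_of_smooth {n : ℕ} {f : En n → ℝ} (hf : ContDiff ℝ (⊤ : ℕ∞) f) (hc : HasCompactSupport f) : Nice f := by
  have h1 : ContDiff ℝ 1 f := hf.of_le (by exact_mod_cast le_top)
  obtain ⟨M, hM⟩ := hc.exists_bound_of_continuous hf.continuous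
  obtain ⟨L, hL⟩ := h1.lipschitzWith_of_hasCompactSupport hc one_ne_zero
  refine ⟨⟨hf.continuous.measurable, M, fun x => by simpa using hM x⟩, ⟨L, L.2, fun x y => ?_⟩,
    hf.continuous.integrable_of_hasCompactSupport hc⟩
  have := hL.dist_le_mul x y
  rwa [Real.dist_eq, dist_eq_norm] at this

lemma eLp_NL {n : ℕ} {q : ℝ} (hq : 1 < q) {c : ℝ} {φ ψ : En n → ℝ} (h : ∀ x, φ x = c * ψ x) :
    eLpNorm φ (ENNReal.ofReal q) volume = ENNReal.ofReal |c| * NL q ψ := by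
  have hq0 : 0 < q := by linarith
  have : φ = c • ψ := by ext x; simp [h x]
  rw [this, eLpNorm_const_smul, ← ofReal_norm_eq_enorm, Real.norm_eq_abs,
    eLpNorm_eq_lintegral_rpow_enorm_toReal (by simpa using hq0) ENNReal.ofReal_ne_top, ENNReal.toReal_ofReal hq0.le]
  simp only [NL, ← ofReal_norm_eq_enorm, Real.norm_eq_abs]

/-- **Coifman–McIntosh–Meyer type commutator estimate, Lebesgue form** (Lemma 2.1,
inequality (2.2)).  Let `s ∈ (0,1]`, `p, q₁, q₂ ∈ (1,∞)` with `1/q₁ + 1/q₂ = 1/p`, and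
`σ ∈ [s,1)`.  Then for all `f, g ∈ C_c^∞(ℝⁿ)`,
`‖(−Δ)^{s/2}(g f) − g (−Δ)^{s/2} f‖_{L^p} ≤ C ‖(−Δ)^{σ/2} g‖_{L^{q₁}} ‖I^{σ−s} f‖_{L^{q₂}}`. -/
theorem commutator_estimate_lebesgue
    (n : ℕ) (hn : 0 < n) (s σ p q₁ q₂ : ℝ)
    (hs : 0 < s) (hs' : s ≤ 1) (hp : 1 < p) (hq₁ : 1 < q₁) (hq₂ : 1 < q₂)
    (hpq : 1 / q₁ + 1 / q₂ = 1 / p) (hσ : s ≤ σ) (hσ' : σ < 1) :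
    ∃ C : ℝ≥0, ∀ f g : En n → ℝ,
      ContDiff ℝ (⊤ : ℕ∞) f → HasCompactSupport f →
      ContDiff ℝ (⊤ : ℕ∞) g → HasCompactSupport g →
      eLpNorm (fun x => fracLapN (s / 2) (fun y => g y * f y) x - g x * fracLapN (s / 2) f x)
          (ENNReal.ofReal p) volume ≤
        C * eLpNorm (fracLapN (σ / 2) g) (ENNReal.ofReal q₁) volume *
          eLpNorm (rieszPotI (σ - s) f) (ENNReal.ofReal q₂) volume := by
  have hab : s / 2 + (σ - s) / 2 = σ / 2 := by ring
  obtain ⟨C, hC, hmain⟩ := main_T0 hn (a := s / 2) (b := (σ - s) / 2) (by linarith) (by linarith) (by linarith) hq₁ hq₂ hp hpq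
  obtain ⟨c1, hc1, k1⟩ := fracLap_eq hn (a := s / 2) (by linarith) (by linarith)
  obtain ⟨c2, hc2, k2⟩ := fracLap_eq hn (a := σ / 2) (by linarith) (by linarith)
  obtain ⟨c3, hc3, k3⟩ := riesz_eq hn (b := (σ - s) / 2) (by linarith) (by linarith)
  rw [mul_div_cancel₀ _ two_ne_zero] at k3
  rw [hab] at hmain
  refine ⟨(ENNReal.ofReal (|c1| / (|c2| * |c3|)) * C).toNNReal, fun f g hf hfc hg hgc => ?_⟩
  have nf := nice_of_smooth hf hfc
  have ng := nice_of_smooth hg hgc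
  rw [ENNReal.coe_toNNReal (ENNReal.mul_ne_top ENNReal.ofReal_ne_top hC)]
  rw [eLp_NL hp (c := c1) (ψ := T0 (s / 2) g f) (fun x => by
      rw [k1 _ (nf.mul ng), k1 _ nf, T0_eq hn (by linarith) (by linarith) ng nf]; ring),
    eLp_NL hq₁ (k2 g ng), eLp_NL hq₂ (k3 f nf)]
  have e : ENNReal.ofReal (|c1| / (|c2| * |c3|)) * (ENNReal.ofReal |c2| * ENNReal.ofReal |c3|) = ENNReal.ofReal |c1| := by
    rw [← ENNReal.ofReal_mul (abs_nonneg _), ← ENNReal.ofReal_mul (by positivity), div_mul_cancel₀ _ (by positivity)]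
  calc _ ≤ ENNReal.ofReal |c1| * (C * (NL q₁ (G0 (σ / 2) g) * NL q₂ (Fb ((σ - s) / 2) f))) :=
        mul_le_mul_right (hmain g f ng nf) _
    _ = _ := by rw [← e]; ring
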